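/- arXiv:1702.06447 — 4 statements merged into one kernel-verified Lean document; each statement's English description precedes it below -/
import Mathlib

section
/- (Noether–Deuring theorem) Let K/E be a field extension, A a finite-dimensional E-algebra, and M₁, M₂ finitely generated A-modules. If K ⊗_E M₁ ≅ K ⊗_E M₂ as modules over A_K = K ⊗_E A, then M₁ ≅ M₂ as A-modules. -/
open TensorProduct

namespace NoetherDeuring

lemma finrank_ker_of_comm (E K : Type) [Field E] [Field K] [Algebra E K]
    {V₂ V₃ W₂ W₃ : Type} [AddCommGroup V₂] [AddCommGroup V₃] [AddCommGroup W₂] [AddCommGroup W₃]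
    [Module E V₂] [Module E V₃] [Module E W₂] [Module E W₃] [Module K W₂] [Module K W₃]
    [IsScalarTower E K W₂] [IsScalarTower E K W₃]
    (h₂ : V₂ →ₗ[E] W₂) (h₃ : V₃ →ₗ[E] W₃) (g : V₂ →ₗ[E] V₃) (g' : W₂ →ₗ[K] W₃)
    (hcomm : h₃ ∘ₗ g = g'.restrictScalars E ∘ₗ h₂)
    (isb₂ : IsBaseChange K h₂) (isb₃ : IsBaseChange K h₃) :
    Module.finrank E (LinearMap.ker g) = Module.finrank K (LinearMap.ker g') := by
  have hmem : ∀ x : LinearMap.ker g, h₂ x ∈ LinearMap.ker g' := by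
    intro x
    have h := LinearMap.congr_fun hcomm x
    have hx : g x = 0 := x.2
    simp only [LinearMap.comp_apply, hx, map_zero, LinearMap.restrictScalars_apply] at h
    exact h.symm
  let h₁ : LinearMap.ker g →ₗ[E] LinearMap.ker g' :=
    { toFun := fun x => ⟨h₂ x, hmem x⟩
      map_add' := by intro x y; ext; simp
      map_smul' := by intro c x; ext; simp }
  have hb : IsBaseChange K h₁ := by
    refine IsBaseChange.of_left_exact K h₁ h₂ h₃
      (f := (LinearMap.ker g).subtype) (g := g)
      (f' := (LinearMap.ker g').subtype) (g' := g')
      ?_ hcomm isb₂ isb₃ ?_ ?_ ?_ ?_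
    · rfl
    · exact LinearMap.exact_subtype_ker_map _
    · exact Subtype.val_injective
    · exact LinearMap.exact_subtype_ker_map _
    · exact Subtype.val_injective
  rw [← hb.equiv.finrank_eq, Module.finrank_baseChange]

section BC
variable (E K A : Type) [Field E] [Field K] [Algebra E K]
    [Ring A] [Algebra E A] [FiniteDimensional E A]
    (M X : Type) [AddCommGroup M] [AddCommGroup X]
    [Module E M] [Module E X] [Module A M] [Module A X]
    [IsScalarTower E A M] [IsScalarTower E A X]
    [SMulCommClass A E M] [SMulCommClass A E X]

/-- action of `a` as an `E`-linear map -/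
def act (a : A) : M →ₗ[E] M := DistribSMul.toLinearMap E M a

@[simp] lemma act_apply (a : A) (m : M) : act E A M a m = a • m := rfl

/-- commutator map over `K` with basis of `A` -/
noncomputable def TK : (K ⊗[E] M →ₗ[K] K ⊗[E] X) →ₗ[K]
    (Fin (Module.finrank E A) → (K ⊗[E] M →ₗ[K] K ⊗[E] X)) where
  toFun φ i := φ ∘ₗ (act E A M (Module.finBasis E A i)).baseChange K
      - (act E A X (Module.finBasis E A i)).baseChange K ∘ₗ φ
  map_add' φ ψ := by
    ext1 i
    simp only [LinearMap.add_comp, LinearMap.comp_add, Pi.add_apply]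
    abel
  map_smul' c φ := by
    ext1 i
    refine LinearMap.ext fun x => ?_
    simp only [LinearMap.sub_apply, LinearMap.comp_apply, LinearMap.smul_apply, Pi.smul_apply,
      RingHom.id_apply, map_smul, smul_sub]

noncomputable def TE : (M →ₗ[E] X) →ₗ[E] (Fin (Module.finrank E A) → (M →ₗ[E] X)) where
  toFun φ i := φ ∘ₗ (act E A M (Module.finBasis E A i)) - (act E A X (Module.finBasis E A i)) ∘ₗ φ
  map_add' φ ψ := by
    ext1 i
    simp only [LinearMap.add_comp, LinearMap.comp_add, Pi.add_apply]
    abel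
  map_smul' c φ := by
    ext1 i
    simp only [LinearMap.smul_comp, LinearMap.comp_smul, Pi.smul_apply, smul_sub, RingHom.id_apply]

lemma TE_exact : Function.Exact (LinearMap.restrictScalarsₗ E A M X E) (TE E A M X) := by
  intro φ
  constructor
  · intro h
    have h1 : ∀ (a : A) (m : M), φ (a • m) = a • φ m := by
      intro a m
      have h2 : (φ ∘ₗ (LinearMap.toSpanSingleton A M m).restrictScalars E)
          = (LinearMap.toSpanSingleton A X (φ m)).restrictScalars E := by
        refine (Module.finBasis E A).ext fun i => ?_
        have h3 := LinearMap.congr_fun (congrFun h i) m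
        simpa [TE, sub_eq_zero] using h3
      simpa using LinearMap.congr_fun h2 a
    exact ⟨{ φ with map_smul' := h1 }, rfl⟩
  · rintro ⟨ψ, rfl⟩
    ext i m
    simp [TE]

lemma isBaseChange_hom [FiniteDimensional E M] :
    IsBaseChange K (LinearMap.baseChangeHom E K M X) := by
  have h := IsBaseChange.linearMapLeftRight (TensorProduct.isBaseChange E M K)
    (TensorProduct.isBaseChange E X K)
  convert h using 1
  ext φ m
  have := IsBaseChange.linearMapLeftRightHom_comp_apply (TensorProduct.isBaseChange E M K)
    (TensorProduct.mk E K X 1) φ m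
  simp at this
  simp [this]

lemma hcomm : ((LinearMap.baseChangeHom E K M X).compLeft (Fin (Module.finrank E A))) ∘ₗ
      (TE E A M X) = ((TK E K A M X).restrictScalars E) ∘ₗ (LinearMap.baseChangeHom E K M X) := by
  refine LinearMap.ext fun φ => funext fun i => ?_
  simp only [TE, TK, LinearMap.baseChangeHom, LinearMap.comp_apply, LinearMap.coe_mk,
    AddHom.coe_mk, LinearMap.compLeft_apply, Function.comp_apply, LinearMap.restrictScalars_apply,
    LinearMap.baseChange_sub, LinearMap.baseChange_comp]

lemma finrank_hom [FiniteDimensional E M] :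
    Module.finrank E (M →ₗ[A] X) = Module.finrank K (LinearMap.ker (TK E K A M X)) := by
  have hex := LinearMap.exact_iff.1 (TE_exact E A M X)
  have h1 := by
   refine finrank_ker_of_comm E K (V₂ := M →ₗ[E] X) (W₂ := K ⊗[E] M →ₗ[K] K ⊗[E] X)
    (V₃ := Fin (Module.finrank E A) → (M →ₗ[E] X))
    (W₃ := Fin (Module.finrank E A) → (K ⊗[E] M →ₗ[K] K ⊗[E] X)) (LinearMap.baseChangeHom E K M X)
    ((LinearMap.baseChangeHom E K M X).compLeft (Fin (Module.finrank E A)))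
    (TE E A M X) (TK E K A M X) (hcomm E K A M X) ?_ ?_
   · have := isBaseChange_hom E K M X
     unfold IsBaseChange at this ⊢
     unfold IsTensorProduct at this ⊢
     exact ⟨fun x y h => this.1 h, fun y => this.2 y⟩
   · have := (isBaseChange_hom E K M X).finitePow (Fin (Module.finrank E A))
     unfold IsBaseChange at this ⊢
     unfold IsTensorProduct at this ⊢
     exact ⟨fun x y h => this.1 h, fun y => this.2 y⟩
  rw [← h1, hex]
  exact (LinearEquiv.ofInjective _ (LinearMap.restrictScalars_injective E)).finrank_eq

end BC

section transport
variable (E K A : Type) [Field E] [Field K] [Algebra E K]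
    [Ring A] [Algebra E A] [FiniteDimensional E A]
    (M₁ M₂ X : Type) [AddCommGroup M₁] [AddCommGroup M₂] [AddCommGroup X]
    [Module E M₁] [Module E M₂] [Module A M₁] [Module A M₂]
    [Module E X] [Module A X] [IsScalarTower E A X] [SMulCommClass A E X]
    [IsScalarTower E A M₁] [IsScalarTower E A M₂]
    [SMulCommClass A E M₁] [SMulCommClass A E M₂]
    [FiniteDimensional E M₁] [FiniteDimensional E M₂]

lemma hom_eq (e : (K ⊗[E] M₁) ≃ₗ[K] (K ⊗[E] M₂))
    (he : ∀ (a : A) (k : K) (m : M₁),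
      e (k ⊗ₜ[E] (a • m)) =
        LinearMap.lTensor K (DistribMulAction.toLinearMap E M₂ a) (e (k ⊗ₜ[E] m))) :
    Module.finrank E (M₁ →ₗ[A] X) = Module.finrank E (M₂ →ₗ[A] X) := by
  have he1 : ∀ a : A, e.toLinearMap ∘ₗ (act E A M₁ a).baseChange K =
      (act E A M₂ a).baseChange K ∘ₗ e.toLinearMap := by
    intro a
    ext m
    exact he a 1 m
  rw [finrank_hom E K A M₁ X, finrank_hom E K A M₂ X]
  symm
  let c : (K ⊗[E] M₂ →ₗ[K] K ⊗[E] X) ≃ₗ[K] (K ⊗[E] M₁ →ₗ[K] K ⊗[E] X) :=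
    LinearEquiv.congrLeft _ K e.symm
  have hc : ∀ φ, c φ = φ ∘ₗ e.toLinearMap := fun φ => rfl
  refine (LinearEquiv.ofSubmodules c _ _ ?_).finrank_eq
  have key : ∀ φ i, TK E K A M₁ X (c φ) i = (TK E K A M₂ X φ i) ∘ₗ e.toLinearMap := by
    intro φ i
    simp only [TK, hc, LinearMap.coe_mk, AddHom.coe_mk, LinearMap.sub_comp, LinearMap.comp_assoc,
      he1]
  have key2 : ∀ φ, c φ ∈ LinearMap.ker (TK E K A M₁ X) ↔ φ ∈ LinearMap.ker (TK E K A M₂ X) := by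
    intro φ
    simp only [LinearMap.mem_ker, funext_iff, key, Pi.zero_apply]
    refine forall_congr' fun i => ?_
    constructor
    · intro h
      ext1
      ext m
      have := LinearMap.congr_fun h (e.symm (1 ⊗ₜ m))
      simpa using this
    · intro h; rw [h, LinearMap.zero_comp]
  ext ψ
  constructor
  · rintro ⟨φ, h, rfl⟩
    exact (key2 φ).2 h
  · intro h
    refine ⟨c.symm ψ, (key2 _).1 (by simpa using h), by simp⟩
end transport

lemma one_sub_unit {R ι : Type} [Ring R] (s : Finset ι) (u : ι → R)
    (hu : ∀ i h, IsNilpotent (h * u i)) : ∀ h, IsUnit (1 - h * ∑ i ∈ s, u i) := by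
  classical
  induction s using Finset.induction_on with
  | empty => intro h; simp
  | insert i s hi ih =>
    intro h
    obtain ⟨v, hv⟩ := ih h
    have : 1 - h * ∑ i ∈ insert i s, u i = v * (1 - (↑v⁻¹ * h) * u i) := by
      rw [Finset.sum_insert hi, mul_sub, mul_one, mul_assoc, Units.mul_inv_cancel_left, hv]
      noncomm_ring
    rw [this]
    exact v.isUnit.mul (hu i _).isUnit_one_sub

lemma retract (A : Type) [Ring A] {M P : Type} [AddCommGroup M] [Module A M] [AddCommGroup P] [Module A P] (i : P →ₗ[A] M) (r : M →ₗ[A] P)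
    (h : ∀ x, r (i x) = x) : Nonempty (M ≃ₗ[A] P × LinearMap.ker r) := by
  refine ⟨LinearEquiv.ofLinearMap
    (r.prod ((LinearMap.id - i ∘ₗ r).codRestrict _ (fun x => by simp [h])))
    (i.coprod (LinearMap.ker r).subtype) ?_ ?_⟩
  · apply LinearMap.ext
    rintro ⟨p, ⟨x, hx⟩⟩
    have hx' : r x = 0 := hx
    ext <;> simp [h, hx']
  · ext x; simp

variable (E A : Type) [Field E] [Ring A] [Algebra E A]

lemma finite_hom (M X : Type) [AddCommGroup M] [AddCommGroup X]
    [Module E M] [Module E X] [Module A M] [Module A X]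
    [IsScalarTower E A M] [IsScalarTower E A X]
    [FiniteDimensional E M] [FiniteDimensional E X] : FiniteDimensional E (M →ₗ[A] X) :=
  Module.Finite.of_injective (LinearMap.restrictScalarsₗ E A M X E)
    (LinearMap.restrictScalars_injective E)

/-- post-composition -/
noncomputable def post (X : Type) {M N : Type} [AddCommGroup M] [AddCommGroup N] [AddCommGroup X]
    [Module E M] [Module E N] [Module A M] [Module A N]
    [IsScalarTower E A M] [IsScalarTower E A N]
    [Module E X] [Module A X] [IsScalarTower E A X]
    (f : M →ₗ[A] N) : (X →ₗ[A] M) →ₗ[E] (X →ₗ[A] N) where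
  toFun φ := f ∘ₗ φ
  map_add' := by intros; ext; simp
  map_smul' := by
    intro c φ; ext x
    simp only [LinearMap.comp_apply, LinearMap.smul_apply, RingHom.id_apply]
    exact (f.restrictScalars E).map_smul c (φ x)

lemma finrank_post (X : Type) {M N : Type} [AddCommGroup M] [AddCommGroup N] [AddCommGroup X]
    [Module E M] [Module E N] [Module A M] [Module A N]
    [IsScalarTower E A M] [IsScalarTower E A N]
    [Module E X] [Module A X] [IsScalarTower E A X]
    [FiniteDimensional E M] [FiniteDimensional E X]
    (f : M →ₗ[A] N) :
    Module.finrank E (LinearMap.range (post E A X f)) +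
      Module.finrank E (X →ₗ[A] LinearMap.ker f) = Module.finrank E (X →ₗ[A] M) := by
  have := finite_hom E A X M
  rw [← LinearMap.finrank_range_add_finrank_ker (post E A X f)]
  congr 1
  let j := post E A X (LinearMap.ker f).subtype
  have hj : Function.Injective j := by
    intro φ ψ h
    ext x
    exact LinearMap.congr_fun h x
  have hr : LinearMap.range j = LinearMap.ker (post E A X f) := by
    ext φ
    constructor
    · rintro ⟨ψ, rfl⟩
      ext x
      exact (ψ x).2
    · intro h
      exact ⟨φ.codRestrict _ fun x => LinearMap.congr_fun h x, rfl⟩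
  rw [← hr]
  exact (LinearEquiv.ofInjective j hj).finrank_eq

/-- Fitting splitting. -/
lemma split (E A : Type) [Field E] [Ring A] [Algebra E A]
    {M N : Type} [AddCommGroup M] [AddCommGroup N]
    [Module E N] [Module A M] [Module A N] [IsScalarTower E A N] [FiniteDimensional E N]
    (f : M →ₗ[A] N) (g : N →ₗ[A] M) (hfg : ¬ IsNilpotent (f ∘ₗ g : Module.End A N)) :
    ∃ (P : Submodule A N) (r : M →ₗ[A] P) (r' : N →ₗ[A] P), Nontrivial P ∧
      Nonempty (M ≃ₗ[A] P × LinearMap.ker r) ∧ Nonempty (N ≃ₗ[A] P × LinearMap.ker r') := by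
  set p : Module.End A N := f ∘ₗ g with hp
  have : IsNoetherian A N := isNoetherian_of_tower E inferInstance
  have : IsArtinian A N := isArtinian_of_tower E inferInstance
  obtain ⟨n, hn⟩ := Filter.eventually_atTop.1 p.eventually_isCompl_ker_pow_range_pow
  have hc := (hn (n + 1) (by omega)).symm
  set P := LinearMap.range (p ^ (n + 1)) with hP
  let π : N →ₗ[A] P := P.projectionOnto _ hc
  have hπ : ∀ x : P, π x = x := fun x => Submodule.projectionOnto_apply_left hc x
  have hpP : ∀ x : P, p x ∈ P := by
    rintro ⟨_, ⟨y, rfl⟩⟩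
    exact ⟨p y, by rw [← Module.End.mul_apply, ← Module.End.mul_apply, ← pow_succ, pow_succ']⟩
  let φ : P →ₗ[A] P := (p ∘ₗ P.subtype).codRestrict P hpP
  have hφ : Function.Injective φ := by
    rw [← LinearMap.ker_eq_bot, LinearMap.ker_eq_bot']
    intro x hx
    have h0 : p x = 0 := congrArg Subtype.val hx
    have h1 : (x : N) ∈ LinearMap.ker (p ^ (n+1)) := by
      rw [LinearMap.mem_ker, pow_succ, Module.End.mul_apply, h0, map_zero]
    exact Subtype.ext (Submodule.disjoint_def.1 hc.disjoint x x.2 h1)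
  have hφs : Function.Bijective φ := IsArtinian.bijective_of_injective_endomorphism φ hφ
  let Φ := LinearEquiv.ofBijective φ hφs
  refine ⟨P, Φ.symm.toLinearMap ∘ₗ π ∘ₗ f, π, ?_, retract A (g ∘ₗ P.subtype) _ ?_,
    retract A P.subtype _ hπ⟩
  · rw [Submodule.nontrivial_iff_ne_bot]
    intro hb
    exact hfg ⟨n+1, LinearMap.range_eq_bot.1 hb⟩
  · intro x
    have : π (f (g x)) = Φ x := hπ (φ x)
    simp [this]

section main
variable (M N : Type) [AddCommGroup M] [AddCommGroup N]
    [Module E M] [Module E N] [Module A M] [Module A N]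
    [IsScalarTower E A M] [IsScalarTower E A N]
    [FiniteDimensional E M] [FiniteDimensional E N]

/-- equality of all Hom dimensions -/
def SameHom : Prop := ∀ (X : Type) [AddCommGroup X] [Module E X] [Module A X]
  [IsScalarTower E A X] [FiniteDimensional E X],
  Module.finrank E (M →ₗ[A] X) = Module.finrank E (N →ₗ[A] X)

variable {M N}

lemma exists_sum (h : SameHom E A M N) :
    ∃ (n : ℕ) (f : Fin n → (M →ₗ[A] N)) (g : Fin n → (N →ₗ[A] M)),
      (∑ i, (f i ∘ₗ g i) : N →ₗ[A] N) = LinearMap.id := by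
  have := finite_hom E A M N
  have := finite_hom E A N N
  let b := Module.finBasis E (M →ₗ[A] N)
  let F : (Fin (Module.finrank E (M →ₗ[A] N)) → M) →ₗ[A] N :=
    ∑ i, b i ∘ₗ LinearMap.proj i
  have h1 := finrank_post E A M F
  have h2 := finrank_post E A N F
  have hs : LinearMap.range (post E A M F) = ⊤ := by
    rw [eq_top_iff, ← b.span_eq, Submodule.span_le]
    rintro _ ⟨i, rfl⟩
    refine ⟨LinearMap.single A (fun _ => M) i, ?_⟩
    ext m
    simp only [post, F, LinearMap.coe_mk, AddHom.coe_mk, LinearMap.comp_apply, LinearMap.sum_apply,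
      LinearMap.proj_apply, LinearMap.single_apply]
    rw [Finset.sum_eq_single i]
    · simp
    · intro j _ hj; simp [hj]
    · simp
  rw [hs, finrank_top] at h1
  have h3 := h (Fin (Module.finrank E (M →ₗ[A] N)) → M)
  have : FiniteDimensional E (LinearMap.ker F) :=
    inferInstanceAs (FiniteDimensional E ((LinearMap.ker F).restrictScalars E))
  have h4 := h (LinearMap.ker F)
  have h5 := h N
  have h6 : LinearMap.range (post E A N F) = ⊤ := by
    apply Submodule.eq_top_of_finrank_eq
    omega
  obtain ⟨s, hs⟩ := LinearMap.range_eq_top.1 h6 LinearMap.id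
  refine ⟨_, b, fun i => LinearMap.proj i ∘ₗ s, ?_⟩
  rw [← hs]
  ext x
  simp [post, F]

lemma exists_not_nilpotent (h : SameHom E A M N) [Nontrivial N] :
    ∃ (f : M →ₗ[A] N) (g : N →ₗ[A] M), ¬ IsNilpotent (f ∘ₗ g : Module.End A N) := by
  by_contra! hn
  obtain ⟨n, f, g, hs⟩ := exists_sum E A h
  have := one_sub_unit (R := Module.End A N) Finset.univ (fun i => f i ∘ₗ g i)
    (fun i k => hn (k ∘ₗ f i) (g i)) 1
  rw [hs] at this
  have h0 : (1 - 1 * LinearMap.id : Module.End A N) = 0 := by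
    ext; simp
  rw [h0] at this
  exact not_isUnit_zero this

end main

lemma hom_congr {M N : Type} (X : Type) [AddCommGroup M] [AddCommGroup N] [AddCommGroup X]
    [Module A M] [Module A N] [Module E X] [Module A X] [IsScalarTower E A X]
    (e : M ≃ₗ[A] N) : Module.finrank E (M →ₗ[A] X) = Module.finrank E (N →ₗ[A] X) :=
  (LinearEquiv.congrLeft X E e).finrank_eq

lemma hom_prod (P Q X : Type) [AddCommGroup P] [AddCommGroup Q] [AddCommGroup X]
    [Module E P] [Module E Q] [Module A P] [Module A Q]
    [IsScalarTower E A P] [IsScalarTower E A Q]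
    [FiniteDimensional E P] [FiniteDimensional E Q] [Module E X] [Module A X]
    [IsScalarTower E A X] [FiniteDimensional E X] :
    Module.finrank E (P × Q →ₗ[A] X) =
      Module.finrank E (P →ₗ[A] X) + Module.finrank E (Q →ₗ[A] X) := by
  have := finite_hom E A P X
  have := finite_hom E A Q X
  rw [← Module.finrank_prod]
  exact (LinearMap.coprodEquiv (R := A) E (M := P) (M₂ := Q) (M₃ := X)).symm.finrank_eq

lemma bongartz (n : ℕ) : ∀ (M N : Type) [AddCommGroup M] [AddCommGroup N]
    [Module E M] [Module E N] [Module A M] [Module A N]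
    [IsScalarTower E A M] [IsScalarTower E A N]
    [FiniteDimensional E M] [FiniteDimensional E N],
    Module.finrank E N ≤ n → SameHom E A M N → Nonempty (M ≃ₗ[A] N) := by
  induction n with
  | zero =>
    intro M N _ _ _ _ _ _ _ _ _ _ hn h
    have : Subsingleton N := Module.finrank_zero_iff.1 (Nat.le_zero.1 hn)
    have hM : Subsingleton M := by
      have := finite_hom E A M M
      have h1 := h M
      rw [Module.finrank_zero_of_subsingleton (M := N →ₗ[A] M), Module.finrank_zero_iff] at h1
      refine subsingleton_of_forall_eq 0 fun x => ?_
      exact LinearMap.congr_fun (Subsingleton.elim (LinearMap.id : M →ₗ[A] M) 0) x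
    exact ⟨0⟩
  | succ n ih =>
    intro M N _ _ _ _ _ _ _ _ _ _ hn h
    cases subsingleton_or_nontrivial N with
    | inl hN =>
      exact ih M N (by rw [Module.finrank_zero_of_subsingleton]; omega) h
    | inr hN =>
      obtain ⟨f, g, hfg⟩ := exists_not_nilpotent E A h
      obtain ⟨P, r, r', hP, ⟨e⟩, ⟨e'⟩⟩ := split E A f g hfg
      have hfin : FiniteDimensional E P := 
        inferInstanceAs (FiniteDimensional E (P.restrictScalars E))
      have hfin : FiniteDimensional E (LinearMap.ker r) := 
        inferInstanceAs (FiniteDimensional E ((LinearMap.ker r).restrictScalars E))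
      have hfin : FiniteDimensional E (LinearMap.ker r') := 
        inferInstanceAs (FiniteDimensional E ((LinearMap.ker r').restrictScalars E))
      have hd : Module.finrank E N = Module.finrank E P + Module.finrank E (LinearMap.ker r') := by
        rw [← Module.finrank_prod]
        exact (e'.restrictScalars E).finrank_eq
      have hpos : 0 < Module.finrank E P := Module.finrank_pos
      obtain ⟨e0⟩ := ih (LinearMap.ker r) (LinearMap.ker r') (by omega) (by
        intro X _ _ _ _ _
        have h1 := h X
        rw [hom_congr E A X e, hom_congr E A X e', hom_prod, hom_prod] at h1
        omega)
      exact ⟨e.trans (((LinearEquiv.refl A P).prodCongr e0).trans e'.symm)⟩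

end NoetherDeuring

/-- **Noether–Deuring theorem.** Let `K/E` be a field extension, `A` a
finite-dimensional `E`-algebra, and `M₁`, `M₂` finitely generated `A`-modules.  If
`K ⊗_E M₁ ≅ K ⊗_E M₂` as `A_K`-modules (i.e. via a `K`-linear equivalence commuting
with the `A`-action `1 ⊗ a`), then `M₁ ≅ M₂` as `A`-modules. -/
theorem noether_deuring
    (E K A : Type) [Field E] [Field K] [Algebra E K]
    [Ring A] [Algebra E A] [FiniteDimensional E A]
    (M₁ M₂ : Type) [AddCommGroup M₁] [AddCommGroup M₂]
    [Module E M₁] [Module E M₂] [Module A M₁] [Module A M₂]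
    [IsScalarTower E A M₁] [IsScalarTower E A M₂]
    [SMulCommClass A E M₁] [SMulCommClass A E M₂]
    [Module.Finite A M₁] [Module.Finite A M₂]
    (e : (K ⊗[E] M₁) ≃ₗ[K] (K ⊗[E] M₂))
    (he : ∀ (a : A) (k : K) (m : M₁),
      e (k ⊗ₜ[E] (a • m)) =
        LinearMap.lTensor K (DistribMulAction.toLinearMap E M₂ a) (e (k ⊗ₜ[E] m))) :
    ∃ g : M₁ ≃ₗ[E] M₂, ∀ (a : A) (m : M₁), g (a • m) = a • g m := by
  have : FiniteDimensional E M₁ := Module.Finite.trans A M₁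
  have : FiniteDimensional E M₂ := Module.Finite.trans A M₂
  obtain ⟨g⟩ := NoetherDeuring.bongartz E A (Module.finrank E M₂) M₁ M₂ le_rfl
    (fun X _ _ _ _ _ => NoetherDeuring.hom_eq E K A M₁ M₂ X e he)
  exact ⟨g.restrictScalars E, fun a m => g.map_smul a m⟩
end

section
/- Let A be a finite-dimensional F-algebra, F ⊆ E ⊆ K a tower of fields, N a finitely generated A_E-module, M = K ⊗_E N, and F ⊆ E₀ ⊆ E an intermediate field. Then M descends to E₀ if and only if N descends to E₀. -/
open TensorProduct

/-- `M` (a module over `A_K`, encoded as a `K`-module with a commuting `A`-action)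
descends to the intermediate field `E` of `K/F`: there is an `A`-stable `E`-form
`N ⊆ M` with `M ≅ K ⊗_E N`. -/
def DescendsTo (F K A : Type) [Field F] [Field K] [Algebra F K]
    [Ring A] [Algebra F A]
    (M : Type) [AddCommGroup M] [Module F M] [Module K M] [Module A M]
    [IsScalarTower F K M] [IsScalarTower F A M] [SMulCommClass K A M]
    (E : IntermediateField F K) : Prop :=
  ∃ N : Submodule E M, (∀ (a : A) (x : M), x ∈ N → a • x ∈ N) ∧
    IsBaseChange K N.subtype

namespace ND

set_option linter.unusedSectionVars false

open Module

section
variable {E K R M N N' X : Type} [Field E] [Field K] [Algebra E K] [Ring R] [Algebra E R]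
  [AddCommGroup M] [Module E M] [Module K M] [Module R M] [IsScalarTower E K M]
  [IsScalarTower E R M] [SMulCommClass K R M] [SMulCommClass R K M]
  [AddCommGroup N] [Module E N] [Module R N] [IsScalarTower E R N]
  [AddCommGroup N'] [Module E N'] [Module R N'] [IsScalarTower E R N']
  [AddCommGroup X] [Module E X] [Module R X] [IsScalarTower E R X]

/-- coordinates along a functional of `K` -/
theorem exists_coord (j : N →ₗ[R] M) (hj : IsBaseChange K (j.restrictScalars E))
    (φ : K →ₗ[E] E) : ∃ π : M →ₗ[R] N, ∀ (k : K) (n : N), π (k • j n) = φ k • n := by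
  let π₀ : M →ₗ[E] N := (TensorProduct.lid E N).toLinearMap ∘ₗ (φ.rTensor N) ∘ₗ
    (hj.equiv.symm.toLinearMap.restrictScalars E)
  have h0 : ∀ (k : K) (n : N), π₀ (k • j n) = φ k • n := by
    intro k n
    have : hj.equiv.symm (k • j n) = k ⊗ₜ[E] n := by
      rw [LinearEquiv.symm_apply_eq, hj.equiv_tmul]; rfl
    simp [π₀, this]
  refine ⟨{ toFun := π₀, map_add' := map_add π₀, map_smul' := ?_ }, h0⟩
  intro r m
  obtain ⟨t, rfl⟩ := hj.equiv.surjective m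
  induction t with
  | zero => simp
  | tmul k n =>
    rw [hj.equiv_tmul]
    change π₀ (r • k • j n) = r • π₀ (k • j n)
    rw [smul_comm r k, ← map_smul, h0, h0, smul_comm]
  | add x y hx hy =>
    simp only [map_add, smul_add, hx, hy]

theorem exists_decomp [Module.Finite E X] (j : N →ₗ[R] M)
    (hj : IsBaseChange K (j.restrictScalars E)) (f : X →ₗ[R] M) :
    ∃ (ι : Type) (s : Finset ι) (c : ι → K) (h : ι → X →ₗ[R] N),
      ∀ x, f x = ∑ i ∈ s, c i • j (h i x) := by
  classical
  let B := Basis.ofVectorSpace E K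
  choose π hπ using fun i => exists_coord (K := K) j hj (B.coord i)
  have key : ∀ m : M, ∃ s : Finset _, ∀ s', s ⊆ s' → m = ∑ i ∈ s', B i • j (π i m) := by
    intro m
    obtain ⟨t, rfl⟩ := hj.equiv.surjective m
    induction t with
    | zero => exact ⟨∅, by simp⟩
    | tmul k n =>
      refine ⟨(B.repr k).support, fun s' hs => ?_⟩
      rw [hj.equiv_tmul]
      change k • j n = ∑ i ∈ s', B i • j (π i (k • j n))
      simp only [hπ]
      have : ∀ i, B i • j (B.coord i k • n) = (B.repr k i • B i) • j n := by
        intro i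
        have : j (B.coord i k • n) = B.coord i k • j n :=
          (j.restrictScalars E).map_smul _ _
        rw [this, smul_comm, ← smul_assoc]; rfl
      simp only [this, ← Finset.sum_smul]
      congr 1
      conv_lhs => rw [← B.linearCombination_repr k]
      rw [Finsupp.linearCombination_apply, Finsupp.sum]
      refine Finset.sum_subset hs ?_
      intro i _ hi
      simp [Finsupp.notMem_support_iff.mp hi]
    | add x y hx hy =>
      obtain ⟨s, hs⟩ := hx
      obtain ⟨t, ht⟩ := hy
      refine ⟨s ∪ t, fun s' h => ?_⟩
      have h1 := hs s' (Finset.subset_union_left.trans h)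
      have h2 := ht s' (Finset.subset_union_right.trans h)
      simp only [map_add, smul_add, Finset.sum_add_distrib]
      rw [← h1, ← h2]
  choose S hS using key
  let b := Module.finBasis E X
  let s := Finset.univ.biUnion fun i => S (f (b i))
  refine ⟨_, s, B, fun i => (π i) ∘ₗ f, fun x => ?_⟩
  let g : X →ₗ[E] M := ∑ i ∈ s, B i • ((j ∘ₗ π i ∘ₗ f).restrictScalars E)
  have hg : f.restrictScalars E = g := by
    refine b.ext fun i => ?_
    have := hS (f (b i)) s (Finset.subset_biUnion_of_mem (fun i => S (f (b i))) (Finset.mem_univ i))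
    simpa [g, LinearMap.sum_apply] using this
  have := congrArg (fun q => q x) hg
  simpa [g, LinearMap.sum_apply] using this

theorem finrank_hom [Module.Finite E X] (j : N →ₗ[R] M)
    (hj : IsBaseChange K (j.restrictScalars E)) :
    finrank E (X →ₗ[R] N) = finrank K (X →ₗ[R] M) := by
  classical
  let b := Basis.ofVectorSpace E (X →ₗ[R] N)
  have li : LinearIndependent K (fun i => j ∘ₗ b i) := by
    rw [linearIndependent_iff']
    intro s c hc i hi
    let B := Basis.ofVectorSpace E K
    refine B.ext_elem fun κ => ?_
    obtain ⟨π, hπ⟩ := exists_coord (K := K) j hj (B.coord κ)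
    have h2 : ∑ i ∈ s, (B.coord κ (c i)) • b i = 0 := by
      ext x
      have := congrArg (fun q : X →ₗ[R] M => π (q x)) hc
      simpa [LinearMap.sum_apply, hπ] using this
    have := linearIndependent_iff'.mp b.linearIndependent s _ h2 i hi
    simpa using this
  have sp : ⊤ ≤ Submodule.span K (Set.range (fun i => j ∘ₗ b i)) := by
    rintro f -
    obtain ⟨ι, s, c, h, hf⟩ := exists_decomp (K := K) j hj f
    have : f = ∑ i ∈ s, c i • (j ∘ₗ h i) := by
      ext x; simp [hf x, LinearMap.sum_apply]
    rw [this]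
    refine Submodule.sum_mem _ fun i _ => Submodule.smul_mem _ _ ?_
    generalize h i = u
    induction b.mem_span u using Submodule.span_induction with
    | mem x hx => obtain ⟨k, rfl⟩ := hx; exact Submodule.subset_span ⟨k, rfl⟩
    | zero => simp
    | add x y _ _ hx hy => rw [LinearMap.comp_add]; exact Submodule.add_mem _ hx hy
    | smul a x _ hx =>
      have : j ∘ₗ (a • x) = (algebraMap E K a) • (j ∘ₗ x) := by
        ext y
        have : j (a • x y) = a • j (x y) := (j.restrictScalars E).map_smul _ _
        simp [this]
      rw [this]; exact Submodule.smul_mem _ _ hx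
  rw [finrank_eq_nat_card_basis b, finrank_eq_nat_card_basis (Basis.mk li sp)]

theorem finrank_form (j : N →ₗ[R] M) (hj : IsBaseChange K (j.restrictScalars E)) :
    finrank E N = finrank K M := by
  let b := Basis.ofVectorSpace E N
  rw [finrank_eq_nat_card_basis b, finrank_eq_nat_card_basis (hj.basis b)]

theorem finite_form [Module.Finite K M] (j : N →ₗ[R] M)
    (hj : IsBaseChange K (j.restrictScalars E)) : Module.Finite E N := by
  let b := Basis.ofVectorSpace E N
  have := Module.Finite.finite_basis (hj.basis b)
  exact Module.Finite.of_basis b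

theorem equiv_of_injective [Module.Finite E N] [Module.Finite E N']
    (h : finrank E N' = finrank E N) (f : N' →ₗ[R] N) (hf : Function.Injective f) :
    Nonempty (N' ≃ₗ[R] N) := by
  refine ⟨LinearEquiv.ofBijective f ⟨hf, ?_⟩⟩
  exact (LinearMap.injective_iff_surjective_of_finrank_eq_finrank
    (f := f.restrictScalars E) h).mp hf

theorem nd_infinite [Infinite E] [Module.Finite K M]
    (j : N →ₗ[R] M) (hj : IsBaseChange K (j.restrictScalars E))
    (j' : N' →ₗ[R] M) (hj' : IsBaseChange K (j'.restrictScalars E)) :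
    Nonempty (N' ≃ₗ[R] N) := by
  classical
  have fN := finite_form j hj
  have fN' := finite_form j' hj'
  have hr : finrank E N' = finrank E N := by rw [finrank_form j hj, finrank_form j' hj']
  obtain ⟨ι, s, c, h, hf⟩ := exists_decomp (K := K) j hj j'
  let b := Module.finBasis E N
  let b' := Module.finBasisOfFinrankEq E N' hr
  let H : ι → Matrix (Fin (finrank E N)) (Fin (finrank E N)) E :=
    fun i => LinearMap.toMatrix b' b ((h i).restrictScalars E)
  let P : Matrix (Fin (finrank E N)) (Fin (finrank E N)) (MvPolynomial ι E) :=
    ∑ i ∈ s, (MvPolynomial.X i : MvPolynomial ι E) •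
      (H i).map (MvPolynomial.C : E →+* MvPolynomial ι E)
  have hP : P.det ≠ 0 := by
    intro h0
    have h1 := congrArg (MvPolynomial.aeval c) h0
    rw [map_zero, AlgHom.map_det] at h1
    have h2 : (MvPolynomial.aeval c).mapMatrix P = (hj.basis b).toMatrix (hj'.basis b') := by
      have h3 : ∀ q, hj'.basis b' q = ∑ p, (∑ i ∈ s, c i * algebraMap E K (H i p q)) •
          hj.basis b p := by
        intro q
        rw [hj'.basis_apply]
        change j' (b' q) = _
        rw [hf]
        simp only [hj.basis_apply, Finset.sum_smul]
        rw [Finset.sum_comm]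
        refine Finset.sum_congr rfl fun i _ => ?_
        have h4 : h i (b' q) = ∑ p, H i p q • b p := by
          simp only [H, LinearMap.toMatrix_apply]
          exact (b.sum_repr _).symm
        rw [h4, map_sum, Finset.smul_sum]
        refine Finset.sum_congr rfl fun p _ => ?_
        have : j (H i p q • b p) = H i p q • j (b p) := (j.restrictScalars E).map_smul _ _
        rw [this, mul_smul, algebraMap_smul]; rfl
      ext p q
      rw [Basis.toMatrix_apply, h3 q]
      simp [P, Matrix.sum_apply, Finsupp.single_apply]
    rw [h2] at h1
    have := (hj.basis b).invertibleToMatrix (hj'.basis b')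
    exact (Matrix.isUnit_det_of_invertible ((hj.basis b).toMatrix (hj'.basis b'))).ne_zero h1
  have : ∃ e : ι → E, MvPolynomial.eval e P.det ≠ 0 := by
    by_contra! hc
    exact hP (MvPolynomial.funext fun x => by simp [hc x])
  obtain ⟨e, he⟩ := this
  refine equiv_of_injective hr (∑ i ∈ s, e i • h i) ?_
  have hm : (MvPolynomial.eval e).mapMatrix P =
      LinearMap.toMatrix b' b ((∑ i ∈ s, e i • h i).restrictScalars E) := by
    have : (∑ i ∈ s, e i • h i).restrictScalars E = ∑ i ∈ s, e i • (h i).restrictScalars E := by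
      ext x; simp [LinearMap.sum_apply]
    rw [this, map_sum]
    ext p q
    simp [H, Matrix.sum_apply]
  rw [RingHom.map_det, hm] at he
  exact (LinearEquiv.ofIsUnitDet (isUnit_iff_ne_zero.mpr he)).injective

/-- counting step -/
theorem card_hom [Finite E] [Finite X] (hXE : Module.Finite E X) [Finite N] [Finite N']
    (j : N →ₗ[R] M) (hj : IsBaseChange K (j.restrictScalars E))
    (j' : N' →ₗ[R] M) (hj' : IsBaseChange K (j'.restrictScalars E)) :
    Nat.card (X →ₗ[R] N) = Nat.card (X →ₗ[R] N') := by
  have : Finite (X →ₗ[R] N) := DFunLike.finite _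
  have : Finite (X →ₗ[R] N') := DFunLike.finite _
  rw [Module.natCard_eq_pow_finrank (K := E) (V := X →ₗ[R] N),
    Module.natCard_eq_pow_finrank (K := E) (V := X →ₗ[R] N'),
    finrank_hom (K := K) j hj, finrank_hom (K := K) j' hj']

def liftEquiv (Y : Submodule R X) : {f : X →ₗ[R] N // Y ≤ f.ker} ≃ (X ⧸ Y →ₗ[R] N) where
  toFun f := Y.liftQ f.1 f.2
  invFun g := ⟨g ∘ₗ Y.mkQ, by intro y hy; simp [(Submodule.Quotient.mk_eq_zero Y).mpr hy]⟩
  left_inv f := by ext; simp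
  right_inv g := by ext; simp

theorem card_le_ker [Finite X] [Finite N] (Y : Submodule R X) [Fintype {Z // Y ≤ Z}] :
    Nat.card {f : X →ₗ[R] N // Y ≤ f.ker} =
      ∑ Z : {Z // Y ≤ Z}, Nat.card {f : X →ₗ[R] N // f.ker = Z.1} := by
  have : Finite (X →ₗ[R] N) := DFunLike.finite _
  rw [← Nat.card_sigma]
  exact Nat.card_congr
    { toFun := fun f => ⟨⟨f.1.ker, f.2⟩, ⟨f.1, rfl⟩⟩
      invFun := fun p => ⟨p.2.1, p.1.2.trans_eq p.2.2.symm⟩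
      left_inv := fun f => rfl
      right_inv := by
        rintro ⟨⟨Z, hZ⟩, ⟨f, (hf : f.ker = Z)⟩⟩
        cases hf
        rfl }

theorem card_ker_eq [Finite E] [Finite X] (hXE : Module.Finite E X) [Finite N] [Finite N']
    (j : N →ₗ[R] M) (hj : IsBaseChange K (j.restrictScalars E))
    (j' : N' →ₗ[R] M) (hj' : IsBaseChange K (j'.restrictScalars E)) (Y : Submodule R X) :
    Nat.card {f : X →ₗ[R] N // f.ker = Y} = Nat.card {f : X →ₗ[R] N' // f.ker = Y} := by
  classical
  have : Finite (Submodule R X) := Finite.of_injective _ SetLike.coe_injective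
  have := Fintype.ofFinite (Submodule R X)
  induction Y using (wellFounded_gt (α := Submodule R X)).induction with
  | _ Y ih =>
  have hq : Module.Finite E (X ⧸ Y) :=
    Module.Finite.of_surjective (Y.mkQ.restrictScalars E) Y.mkQ_surjective
  have : Finite (X ⧸ Y) := Finite.of_surjective _ Y.mkQ_surjective
  have h1 := card_hom (K := K) (X := X ⧸ Y) hq j hj j' hj'
  rw [← Nat.card_congr (liftEquiv Y), ← Nat.card_congr (liftEquiv Y), card_le_ker,
    card_le_ker, ← Finset.add_sum_erase _ _ (Finset.mem_univ ⟨Y, le_rfl⟩),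
    ← Finset.add_sum_erase _ _ (Finset.mem_univ ⟨Y, le_rfl⟩)] at h1
  rw [Finset.sum_congr rfl (g := fun Z : {Z // Y ≤ Z} =>
    Nat.card {f : X →ₗ[R] N' // f.ker = Z.1})] at h1
  · exact Nat.add_right_cancel h1
  · rintro ⟨Z, hZ⟩ hm
    refine ih Z (lt_of_le_of_ne hZ ?_)
    rintro rfl
    simp at hm

theorem nd_finite [Finite E] [Module.Finite K M]
    (j : N →ₗ[R] M) (hj : IsBaseChange K (j.restrictScalars E))
    (j' : N' →ₗ[R] M) (hj' : IsBaseChange K (j'.restrictScalars E)) :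
    Nonempty (N' ≃ₗ[R] N) := by
  have fN := finite_form j hj
  have fN' := finite_form j' hj'
  have hr : finrank E N' = finrank E N := by rw [finrank_form j hj, finrank_form j' hj']
  have : Finite N := Module.finite_of_finite E
  have : Finite N' := Module.finite_of_finite E
  have : Finite (N' →ₗ[R] N) := DFunLike.finite _
  have : Finite (N' →ₗ[R] N') := DFunLike.finite _
  have h := card_ker_eq (K := K) (X := N') fN' j hj j' hj' ⊥
  have : Nonempty {f : N' →ₗ[R] N' // f.ker = ⊥} := ⟨LinearMap.id, LinearMap.ker_id⟩
  have h2 := Nat.card_pos (α := {f : N' →ₗ[R] N' // f.ker = ⊥})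
  rw [← h] at h2
  obtain ⟨⟨f, hf⟩⟩ := (Nat.card_pos_iff.mp h2).1
  exact equiv_of_injective hr f (LinearMap.ker_eq_bot.mp hf)

/-- Noether–Deuring -/
theorem noether_deuring [Module.Finite K M]
    (j : N →ₗ[R] M) (hj : IsBaseChange K (j.restrictScalars E))
    (j' : N' →ₗ[R] M) (hj' : IsBaseChange K (j'.restrictScalars E)) :
    Nonempty (N' ≃ₗ[R] N) := by
  rcases finite_or_infinite E with h | h
  · exact nd_finite j hj j' hj'
  · exact nd_infinite j hj j' hj'

end

end ND

namespace ND

/-- the `E`-span of an `E₀`-form is an `E`-form -/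
theorem isBaseChange_span {F K M : Type} [Field F] [Field K] [Algebra F K]
    [AddCommGroup M] [Module K M] (E E₀ : IntermediateField F K) (hE₀ : E₀ ≤ E)
    (Q : Submodule E₀ M) (hQ : IsBaseChange K Q.subtype) :
    IsBaseChange K (Submodule.span E (Q : Set M)).subtype := by
  let q := Module.Basis.ofVectorSpace E₀ Q
  let b := hQ.basis q
  have hb : ∀ i, b i = (q i : M) := fun i => hQ.basis_apply q i
  have hspan : Submodule.span E (Q : Set M) = Submodule.span E (Set.range b) := by
    apply le_antisymm
    · rw [Submodule.span_le]
      intro x hx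
      have h1 := q.mem_span ⟨x, hx⟩
      have h2 : ∀ y : Q, y ∈ Submodule.span E₀ (Set.range q) →
          (y : M) ∈ Submodule.span E (Set.range b) := by
        intro y hy
        induction hy using Submodule.span_induction with
        | mem x hx =>
          obtain ⟨i, rfl⟩ := hx
          exact Submodule.subset_span ⟨i, hb i⟩
        | zero => simp
        | add x y _ _ hx hy => exact add_mem hx hy
        | smul c x _ hx => exact Submodule.smul_mem _ (⟨c, hE₀ c.2⟩ : E) hx
      exact h2 _ h1
    · rw [Submodule.span_le]
      rintro _ ⟨i, rfl⟩
      rw [hb]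
      exact Submodule.subset_span (q i).2
  have li : LinearIndependent E b := b.linearIndependent.restrict_scalars' E
  rw [hspan]
  have hbc := IsBaseChange.of_basis E b
  let e := (Module.Basis.span li).repr
  refine (IsBaseChange.iff_of_equiv_comm e (LinearEquiv.refl K M) ?_).mpr hbc
  refine (Module.Basis.span li).ext fun i => ?_
  simp [e, Module.Basis.span_apply]

/-- two `R`-stable forms are conjugate under an automorphism -/
theorem exists_conj {E K R M : Type} [Field E] [Field K] [Algebra E K] [Ring R] [Algebra E R]
    [AddCommGroup M] [Module E M] [Module K M] [Module R M] [IsScalarTower E K M]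
    [IsScalarTower E R M] [SMulCommClass K R M] [Module.Finite K M]
    (N N' : Submodule E M) (hN : IsBaseChange K N.subtype) (hN' : IsBaseChange K N'.subtype)
    (st : ∀ (r : R) (x : M), x ∈ N → r • x ∈ N) (st' : ∀ (r : R) (x : M), x ∈ N' → r • x ∈ N') :
    ∃ φ : M ≃ₗ[K] M, (∀ x ∈ N', φ x ∈ N) ∧ (∀ y ∈ N, ∃ x ∈ N', φ x = y) ∧
      ∀ (r : R) (x : M), x ∈ N' → φ (r • x) = r • φ x := by
  have : SMulCommClass R K M := SMulCommClass.symm _ _ _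
  let NR : Submodule R M := { N with smul_mem' := fun r x hx => st r x hx }
  let NR' : Submodule R M := { N' with smul_mem' := fun r x hx => st' r x hx }
  have hNR : IsBaseChange K (NR.subtype.restrictScalars E) := hN
  have hNR' : IsBaseChange K (NR'.subtype.restrictScalars E) := hN'
  obtain ⟨e⟩ := ND.noether_deuring (K := K) NR.subtype hNR NR'.subtype hNR'
  let φ : M ≃ₗ[K] M := hNR'.equiv.symm ≪≫ₗ
    (e.restrictScalars E).baseChange E K NR' NR ≪≫ₗ hNR.equiv
  have hφ : ∀ x : NR', φ x = (e x : M) := by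
    intro x
    have h1 : hNR'.equiv.symm (x : M) = 1 ⊗ₜ x := hNR'.equiv_symm_apply x
    simp only [φ, LinearEquiv.trans_apply, h1, LinearEquiv.baseChange_tmul, hNR.equiv_tmul]
    simp
  refine ⟨φ, fun x hx => ?_, fun y hy => ?_, fun r x hx => ?_⟩
  · rw [hφ ⟨x, hx⟩]
    exact (e _).2
  · refine ⟨(e.symm ⟨y, hy⟩ : NR'), (e.symm ⟨y, hy⟩ : NR').2, ?_⟩
    rw [hφ]; simp
  · rw [hφ ⟨x, hx⟩]
    have := hφ (r • ⟨x, hx⟩)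
    rw [map_smul] at this
    exact this

end ND

set_option maxHeartbeats 2000000

/-- Let `F ⊆ E₀ ⊆ E ⊆ K` be a tower of fields, `N` a finitely
generated `A_E`-module (realized as an `A`-stable `E`-form of `M = K ⊗_E N`).
Then `M` descends to `E₀` if and only if `N` descends to `E₀`
(the latter meaning: there is an `A`-stable `E₀`-form `P` of `M` contained in `N`
which spans `N` over `E`, i.e. `N ≅ E ⊗_{E₀} P` as `A_E`-modules). -/
theorem descendsTo_iff_form_descendsTo
    (F K A : Type) [Field F] [Field K] [Algebra F K]
    [Ring A] [Algebra F A] [FiniteDimensional F A]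
    (M : Type) [AddCommGroup M] [Module F M] [Module K M] [Module A M]
    [IsScalarTower F K M] [IsScalarTower F A M] [SMulCommClass K A M]
    [Module.Finite K M]
    (E E₀ : IntermediateField F K) (hE₀ : E₀ ≤ E)
    (N : Submodule E M) (hNA : ∀ (a : A) (x : M), x ∈ N → a • x ∈ N)
    (hN : IsBaseChange K N.subtype) :
    DescendsTo F K A M E₀ ↔
      ∃ P : Submodule E₀ M, (∀ (a : A) (x : M), x ∈ P → a • x ∈ P) ∧
        IsBaseChange K P.subtype ∧ (P : Set M) ⊆ (N : Set M) ∧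
        Submodule.span E (P : Set M) = N := by
  constructor
  swap
  · rintro ⟨P, h1, h2, -, -⟩
    exact ⟨P, h1, h2⟩
  rintro ⟨Q, hQA, hQ⟩
  -- the `E`-span of `Q`
  let N' : Submodule E M := Submodule.span E (Q : Set M)
  have comm : ∀ (a : A) (e : E) (x : M), a • e • x = e • a • x :=
    fun a e x => (smul_comm (e : K) a x).symm
  have hN'A : ∀ (a : A) (x : M), x ∈ N' → a • x ∈ N' := by
    intro a x hx
    induction hx using Submodule.span_induction with
    | mem x hx => exact Submodule.subset_span (hQA a x hx)
    | zero => simp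
    | add x y _ _ hx hy => rw [smul_add]; exact add_mem hx hy
    | smul e x _ hx => rw [comm]; exact N'.smul_mem _ hx
  have hN' : IsBaseChange K N'.subtype := ND.isBaseChange_span E E₀ hE₀ Q hQ
  -- the module structure over `E ⊗ A`
  have : SMulCommClass E A M := ⟨fun e a x => (comm a e x).symm⟩
  have : IsScalarTower F E M := ⟨fun f e m => smul_assoc f (e : K) m⟩
  letI : Module (E ⊗[F] A) M := TensorProduct.Algebra.module
  have sd : ∀ (e : E) (a : A) (m : M), (e ⊗ₜ[F] a) • m = e • a • m :=
    TensorProduct.Algebra.smul_def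
  have zs : ∀ m : M, (0 : E ⊗[F] A) • m = 0 := fun m => by
    rw [← TensorProduct.zero_tmul E (0 : A), sd, zero_smul]
  have ads : ∀ (x y : E ⊗[F] A) (m : M), (x + y) • m = x • m + y • m :=
    fun x y m => add_smul x y m
  have : IsScalarTower E (E ⊗[F] A) M := ⟨fun e r m => by
    induction r with
    | zero => rw [smul_zero, zs, smul_zero]
    | tmul e' a => rw [TensorProduct.smul_tmul', sd, sd, smul_eq_mul, mul_smul]
    | add x y hx hy => rw [smul_add, ads, hx, hy, ads, smul_add]⟩
  have : SMulCommClass K (E ⊗[F] A) M := ⟨fun k r m => by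
    induction r with
    | zero => rw [zs, zs, smul_zero]
    | tmul e a => rw [sd, sd, ← smul_comm k a, smul_comm k e]
    | add x y hx hy => rw [ads, ads, smul_add, hx, hy]⟩
  have stab : ∀ (S : Submodule E M), (∀ (a : A) (x : M), x ∈ S → a • x ∈ S) →
      ∀ (r : E ⊗[F] A) (x : M), x ∈ S → r • x ∈ S := by
    intro S hS r x hx
    induction r with
    | zero => rw [zs]; exact S.zero_mem
    | tmul e a => rw [sd]; exact S.smul_mem _ (hS a x hx)
    | add x y hx hy => rw [ads]; exact add_mem hx hy
  obtain ⟨φ, hφN, hφs, hφR⟩ := ND.exists_conj (R := E ⊗[F] A) N N' hN hN'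
    (stab N hNA) (stab N' hN'A)
  have hQN : ∀ x ∈ Q, x ∈ N' := fun x hx => Submodule.subset_span (s := (Q : Set M)) hx
  have hφA : ∀ (a : A) (x : M), x ∈ N' → φ (a • x) = a • φ x := by
    intro a x hx
    have h1 : ∀ y : M, a • y = ((1 : E) ⊗ₜ[F] a) • y := fun y => by rw [sd, one_smul]
    rw [h1, h1, hφR _ _ hx]
  let ψ : M ≃ₗ[E₀] M := φ.restrictScalars E₀
  let P : Submodule E₀ M := Q.map ψ.toLinearMap
  refine ⟨P, ?_, ?_, ?_, ?_⟩
  · rintro a _ ⟨x, hx, rfl⟩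
    exact ⟨a • x, hQA a x hx, hφA a x (hQN x hx)⟩
  · exact (IsBaseChange.iff_of_equiv_comm (ψ.submoduleMap Q) φ (by ext; rfl)).mp hQ
  · rintro _ ⟨x, hx, rfl⟩
    exact hφN x (hQN x hx)
  · apply le_antisymm
    · rw [Submodule.span_le]
      rintro _ ⟨x, hx, rfl⟩
      exact hφN x (hQN x hx)
    · intro y hy
      obtain ⟨x, hx, rfl⟩ := hφs y hy
      have h2 : ∀ z ∈ N', φ z ∈ Submodule.span E (P : Set M) := by
        intro z hz
        induction hz using Submodule.span_induction with
        | mem x hx => exact Submodule.subset_span ⟨x, hx, rfl⟩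
        | zero => simp
        | add x y _ _ hx hy => rw [map_add]; exact add_mem hx hy
        | smul c x _ hx =>
          have : φ (c • x) = c • φ x := φ.map_smul (c : K) x
          rw [this]; exact Submodule.smul_mem _ _ hx
      exact h2 _ hx
end

section
/- Let F be a C₁-field, A a finite-dimensional F-algebra, K/F a field extension, M a finitely generated A_K-module, and F ⊆ K₀ ⊆ K an intermediate field with [K₀ : F] < ∞. If the direct sum M^n of n copies of M is defined over K₀ for some positive integer n, then M is defined over K₀. -/
open TensorProduct

/-- `F` is a `C₁`-field: every homogeneous polynomial of degree `d` with `0 < d < n`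
in `n` variables over `F` has a nontrivial zero in `Fⁿ`. -/
def IsC1Field (F : Type) [Field F] : Prop :=
  ∀ (n d : ℕ) (f : MvPolynomial (Fin n) F), f.IsHomogeneous d → 0 < d → d < n →
    ∃ x : Fin n → F, x ≠ 0 ∧ MvPolynomial.eval x f = 0

section PartOne

open MvPolynomial in
lemma topComponent_mul {σ R : Type*} [CommRing R] (c q : MvPolynomial σ R) :
    homogeneousComponent (c.totalDegree + q.totalDegree) (c * q) =
      homogeneousComponent c.totalDegree c * homogeneousComponent q.totalDegree q := by
  have hcq : c * q = ∑ i ∈ Finset.range (c.totalDegree + 1),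
      ∑ j ∈ Finset.range (q.totalDegree + 1),
        homogeneousComponent i c * homogeneousComponent j q := by
    rw [← Finset.sum_mul_sum, sum_homogeneousComponent, sum_homogeneousComponent]
  have key : ∀ i j, homogeneousComponent (c.totalDegree + q.totalDegree)
      (homogeneousComponent i c * homogeneousComponent j q) =
      if c.totalDegree + q.totalDegree = i + j then
        homogeneousComponent i c * homogeneousComponent j q else 0 := by
    intro i j
    have := homogeneousComponent_of_mem (n := i + j) (m := c.totalDegree + q.totalDegree)
      (((homogeneousComponent_isHomogeneous i c).mul (homogeneousComponent_isHomogeneous j q)))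
    rw [this]
  rw [hcq]
  simp only [map_sum, key]
  rw [Finset.sum_eq_single c.totalDegree, Finset.sum_eq_single q.totalDegree]
  · simp
  · intro j hj hne
    rw [if_neg]
    simp at hj
    omega
  · simp
  · intro i hi hne
    apply Finset.sum_eq_zero
    intro j hj
    rw [if_neg]
    simp at hi hj
    omega
  · simp

open MvPolynomial in
/-- over a `C₁` field, a form of degree `n` in `n` variables without nontrivial zero cannot factor. -/
lemma no_factor {F : Type} [Field F] (hC1 : IsC1Field F) (n : ℕ) (c q : MvPolynomial (Fin n) F)
    (hh : (c * q).IsHomogeneous n) (hz : ∀ y : Fin n → F, y ≠ 0 → eval y (c * q) ≠ 0)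
    (hne : c * q ≠ 0)
    (hc : 0 < c.totalDegree) (hq : 0 < q.totalDegree) : False := by
  have hs : c.totalDegree + q.totalDegree = n := by
    rw [← totalDegree_mul_of_isDomain (left_ne_zero_of_mul hne) (right_ne_zero_of_mul hne)]
    exact hh.totalDegree hne
  obtain ⟨y, hy, hy0⟩ := hC1 n c.totalDegree (homogeneousComponent c.totalDegree c)
    (homogeneousComponent_isHomogeneous _ _) hc (by omega)
  apply hz y hy
  have h1 := topComponent_mul c q
  rw [hs, homogeneousComponent_eq_self hh] at h1
  rw [h1, map_mul, hy0, zero_mul]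

open Polynomial in
lemma coeff_zero_of_monic_dvd {R : Type*} [CommRing R] [IsDomain R] (a : R) (n : ℕ)
    (m : R[X]) (hm : m.Monic) (hd : m ∣ (X - C a) ^ n) : m.coeff 0 = (-a) ^ m.natDegree := by
  obtain ⟨i, -, hi⟩ := (dvd_prime_pow (prime_X_sub_C a) n).1 hd
  have := eq_of_monic_of_associated hm ((monic_X_sub_C a).pow i) hi
  rw [this, coeff_zero_eq_eval_zero]
  simp

open MvPolynomial in
/-- Generic left multiplication matrix. -/
noncomputable def genMat {F D : Type} [Field F] [Ring D] [Algebra F D] {n : ℕ}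
    (b : Module.Basis (Fin n) F D) : Matrix (Fin n) (Fin n) (MvPolynomial (Fin n) F) :=
  ∑ i, (X i : MvPolynomial (Fin n) F) • (Algebra.leftMulMatrix b (b i)).map C

open MvPolynomial in
lemma genMat_map {F D S : Type} [Field F] [Ring D] [Algebra F D] {n : ℕ}
    (b : Module.Basis (Fin n) F D) [CommRing S] [Algebra F S] (y : Fin n → S) :
    (genMat b).map (aeval (R := F) y) =
      ∑ i, y i • (Algebra.leftMulMatrix b (b i)).map (algebraMap F S) := by
  ext j k
  simp [genMat, Matrix.sum_apply]

open MvPolynomial in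
lemma genMat_eval {F D : Type} [Field F] [Ring D] [Algebra F D] {n : ℕ}
    (b : Module.Basis (Fin n) F D) (y : Fin n → F) :
    (genMat b).map (eval y) = Algebra.leftMulMatrix b (∑ i, y i • b i) := by
  ext j k
  simp [genMat, Matrix.sum_apply]

open MvPolynomial in
lemma genMat_det_homog {F D : Type} [Field F] [Ring D] [Algebra F D] {n : ℕ}
    (b : Module.Basis (Fin n) F D) : (genMat b).det.IsHomogeneous n := by
  rw [Matrix.det_apply]
  apply IsHomogeneous.sum
  intro σ _
  rw [Units.smul_def, zsmul_eq_mul]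
  have h1 : (∏ i, genMat b (σ i) i).IsHomogeneous (∑ i : Fin n, 1) := by
    apply IsHomogeneous.prod
    intro i _
    simp only [genMat, Matrix.sum_apply, Matrix.smul_apply, Matrix.map_apply, smul_eq_mul]
    apply IsHomogeneous.sum
    intro j _
    rw [mul_comm]
    exact isHomogeneous_C_mul_X _ _
  have := h1.C_mul ((Equiv.Perm.sign σ : ℤ) : F)
  simpa using this

open MvPolynomial in
lemma genMat_minpoly_lt {F D : Type} [Field F] [Ring D] [Algebra F D] {n : ℕ}
    (b : Module.Basis (Fin n) F D) (hnc : ∃ x y : D, x * y ≠ y * x) :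
    (minpoly (FractionRing (MvPolynomial (Fin n) F))
      ((genMat b).map (algebraMap _ (FractionRing (MvPolynomial (Fin n) F))))).natDegree < n := by
  set Q := FractionRing (MvPolynomial (Fin n) F)
  set G := (genMat b).map (algebraMap _ Q) with hG
  by_contra! hle
  -- powers are linearly independent
  have hli := linearIndependent_pow (K := Q) G
  have hli2 : LinearIndependent Q (fun i : Fin n => G ^ (i : ℕ)) :=
    hli.comp (Fin.castLE hle) (Fin.castLE_injective hle)
  let L : Fin n → Matrix (Fin n) (Fin n) Q :=
    fun i => (Algebra.leftMulMatrix b (b i)).map (algebraMap F Q)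
  let W : Submodule Q (Matrix (Fin n) (Fin n) Q) := Submodule.span Q (Set.range L)
  have hLf : ∀ x : D, (Algebra.leftMulMatrix b x).map (algebraMap F Q) ∈ W := by
    intro x
    have : (Algebra.leftMulMatrix b x).map (algebraMap F Q) =
        ∑ i, (algebraMap F Q (b.repr x i)) • L i := by
      conv_lhs => rw [← b.sum_repr x]
      ext j k
      simp only [L, Matrix.sum_apply, Matrix.smul_apply, Matrix.map_apply, map_sum, map_smul,
        smul_eq_mul, map_mul]
    rw [this]
    exact Submodule.sum_mem _ fun i _ => Submodule.smul_mem _ _ (Submodule.subset_span ⟨i, rfl⟩)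
  have hLmul : ∀ i j, L i * L j ∈ W := by
    intro i j
    have : L i * L j = (Algebra.leftMulMatrix b (b i * b j)).map (algebraMap F Q) := by
      rw [map_mul, Matrix.map_mul]
    rw [this]
    exact hLf _
  have hWmul : ∀ x ∈ W, ∀ y ∈ W, x * y ∈ W := by
    intro x hx y hy
    have : W * W ≤ W := by
      rw [Submodule.span_mul_span, Submodule.span_le]
      rintro _ ⟨_, ⟨i, rfl⟩, _, ⟨j, rfl⟩, rfl⟩
      exact hLmul i j
    exact this (Submodule.mul_mem_mul hx hy)
  have hGW : G ∈ W := by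
    have : G = ∑ i, (algebraMap (MvPolynomial (Fin n) F) Q (X i)) • L i := by
      ext j k
      simp only [hG, genMat, L, Matrix.sum_apply, Matrix.smul_apply, Matrix.map_apply, map_sum,
        smul_eq_mul, map_mul, IsScalarTower.algebraMap_apply F (MvPolynomial (Fin n) F) Q,
        MvPolynomial.algebraMap_eq]
    rw [this]
    exact Submodule.sum_mem _ fun i _ => Submodule.smul_mem _ _ (Submodule.subset_span ⟨i, rfl⟩)
  have h1W : (1 : Matrix (Fin n) (Fin n) Q) ∈ W := by
    have := hLf 1
    rwa [map_one, Matrix.map_one _ (map_zero _) (map_one _)] at this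
  have hpow : ∀ k : ℕ, G ^ k ∈ W := by
    intro k
    induction k with
    | zero => simpa using h1W
    | succ k ih => rw [pow_succ]; exact hWmul _ ih _ hGW
  have hfin : Module.finrank Q W ≤ n := by
    have := finrank_range_le_card (R := Q) L
    simpa [Set.finrank] using this
  have hspan : Submodule.span Q (Set.range (fun i : Fin n => G ^ (i : ℕ))) = W := by
    apply Submodule.eq_of_le_of_finrank_le
    · rw [Submodule.span_le]
      rintro _ ⟨i, rfl⟩
      exact hpow _
    · rw [finrank_span_eq_card hli2]
      simpa using hfin
  have hcomm : ∀ x ∈ W, ∀ y ∈ W, x * y = y * x := by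
    have had : W ≤ Subalgebra.toSubmodule (Algebra.adjoin Q {G}) := by
      rw [← hspan, Submodule.span_le]
      rintro _ ⟨i, rfl⟩
      exact pow_mem (Algebra.subset_adjoin (Set.mem_singleton G)) _
    intro x hx y hy
    have h := (Algebra.isMulCommutative_adjoin Q (s := {G}) (by simp))
    exact congrArg Subtype.val (mul_comm' (⟨x, had hx⟩ : Algebra.adjoin Q {G}) ⟨y, had hy⟩)
  obtain ⟨x, y, hxy⟩ := hnc
  apply hxy
  have h1 := hcomm _ (hLf x) _ (hLf y)
  rw [← Matrix.map_mul, ← Matrix.map_mul, ← map_mul, ← map_mul] at h1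
  apply Algebra.leftMulMatrix_injective b
  ext j k
  have := congrFun (congrFun h1 j) k
  simpa using this

open Polynomial in
theorem C1_comm {F D : Type} [Field F] (hC1 : IsC1Field F) [DivisionRing D] [Algebra F D]
    [FiniteDimensional F D] (x y : D) : x * y = y * x := by
  by_contra hxy
  set n := Module.finrank F D with hn
  let b : Module.Basis (Fin n) F D := Module.finBasis F D
  set S := MvPolynomial (Fin n) F
  set Q := FractionRing S
  have hlt := genMat_minpoly_lt b ⟨x, y, hxy⟩
  set G := genMat b
  set GQ := G.map (algebraMap S Q)
  have hIntegral : IsIntegral Q GQ := IsIntegral.of_finite Q GQ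
  have hmdvd : minpoly Q GQ ∣ G.charpoly.map (algebraMap S Q) := by
    rw [← Matrix.charpoly_map]
    exact Matrix.minpoly_dvd_charpoly _
  obtain ⟨m, hm⟩ := IsIntegrallyClosed.eq_map_mul_C_of_dvd Q G.charpoly_monic hmdvd
  rw [(minpoly.monic hIntegral).leadingCoeff, C_1, mul_one] at hm
  have hinj : Function.Injective (algebraMap S Q) := IsFractionRing.injective S Q
  have hmm : m.Monic := by
    apply monic_of_injective hinj
    rw [hm]; exact minpoly.monic hIntegral
  have hdeg : m.natDegree < n := by
    rw [← natDegree_map_eq_of_injective hinj m, hm]; exact hlt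
  have hpos : 0 < n := by omega
  have hdegpos : 0 < m.natDegree := by
    rw [← natDegree_map_eq_of_injective hinj m, hm]
    have : Nonempty (Fin n) := ⟨⟨0, hpos⟩⟩
    exact minpoly.natDegree_pos hIntegral
  have hdvd : m ∣ G.charpoly := by
    rw [← map_dvd_map (algebraMap S Q) hinj hmm, hm]; exact hmdvd
  obtain ⟨q, hq⟩ := hdvd
  have hqm : q.Monic := hmm.of_mul_monic_left (hq ▸ G.charpoly_monic)
  have hqdeg : 0 < q.natDegree := by
    have h1 := congrArg natDegree hq
    rw [hmm.natDegree_mul hqm, Matrix.charpoly_natDegree_eq_dim, Fintype.card_fin] at h1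
    omega
  -- specialization
  let φ : S →ₐ[F] F[X] := MvPolynomial.aeval (fun i => C (b.repr 1 i) * X)
  have hφG : (G.map φ).charpoly = (X - C X) ^ n := by
    have : G.map φ = Matrix.scalar (Fin n) X := by
      have h1 := genMat_map b (S := F[X]) (fun i => C (b.repr 1 i) * X)
      refine h1.trans ?_
      have h2 : Algebra.leftMulMatrix b (∑ i, b.repr 1 i • b i) = 1 := by
        rw [b.sum_repr, map_one]
      ext1 j k
      have h3 := congrArg C (congrFun (congrFun h2 j) k)
      simp only [map_sum, map_smul, Matrix.sum_apply, Matrix.smul_apply, smul_eq_mul, map_mul] at h3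
      simp only [Matrix.sum_apply, Matrix.smul_apply, Matrix.map_apply, smul_eq_mul,
        Polynomial.algebraMap_eq]
      have h4 : ∀ i, C (b.repr 1 i) * X * C (Algebra.leftMulMatrix b (b i) j k) =
        X * (C (b.repr 1 i) * C (Algebra.leftMulMatrix b (b i) j k)) := fun i => by ring
      simp_rw [h4]
      rw [← Finset.mul_sum, h3]
      by_cases hjk : j = k
      · subst hjk; simp
      · simp [hjk]
    rw [this, Matrix.scalar_apply, Matrix.charpoly_diagonal]
    simp
  have hsplit : (m.map φ.toRingHom) * (q.map φ.toRingHom) = (X - C X) ^ n := by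
    rw [← Polynomial.map_mul, ← hq, ← hφG, ← Matrix.charpoly_map]
    rfl
  have hdegc : ∀ p : S[X], p.Monic → (p.map φ.toRingHom) ∣ (X - C X) ^ n →
      p.natDegree ≤ (p.coeff 0).totalDegree := by
    intro p hp hpd
    have h1 := coeff_zero_of_monic_dvd X n _ (hp.map _) hpd
    rw [hp.natDegree_map, coeff_map] at h1
    have h2 := MvPolynomial.aeval_natDegree_le (p.coeff 0) le_rfl (n := 1)
      (fun i => C (b.repr 1 i) * X) (fun i => (natDegree_C_mul_le _ _).trans natDegree_X_le)
    have h3 : φ (p.coeff 0) = (-X) ^ p.natDegree := h1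
    have h4 : (φ (p.coeff 0)).natDegree ≤ _ := h2
    rw [h3, natDegree_pow, natDegree_neg, natDegree_X] at h4
    simpa using h4
  have hdet : G.det = (-1) ^ n * (m.coeff 0 * q.coeff 0) := by
    rw [Matrix.det_eq_sign_charpoly_coeff, hq, mul_coeff_zero, Fintype.card_fin]
  have hprod : m.coeff 0 * q.coeff 0 = (-1) ^ n * G.det := by
    rw [hdet, ← mul_assoc, ← mul_pow]; simp
  have hev : ∀ y : Fin n → F, y ≠ 0 → MvPolynomial.eval y (m.coeff 0 * q.coeff 0) ≠ 0 := by
    intro y hy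
    rw [hprod, map_mul]
    apply mul_ne_zero
    · simp
    have h1 : MvPolynomial.eval y G.det = (Algebra.leftMulMatrix b (∑ i, y i • b i)).det := by
      rw [← genMat_eval, RingHom.map_det]; rfl
    rw [h1]
    have hne : (∑ i, y i • b i) ≠ 0 := by
      intro h0
      apply hy
      funext i
      exact Fintype.linearIndependent_iff.1 b.linearIndependent y h0 i
    have hu : IsUnit (∑ i, y i • b i) := isUnit_iff_ne_zero.2 hne
    exact ((Matrix.isUnit_iff_isUnit_det _).1 (hu.map (Algebra.leftMulMatrix b))).ne_zero
  refine no_factor hC1 n (m.coeff 0) (q.coeff 0) ?_ hev ?_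
    (hdegpos.trans_le (hdegc m hmm ⟨_, hsplit.symm⟩))
    (hqdeg.trans_le (hdegc q hqm ⟨_, by rw [mul_comm]; exact hsplit.symm⟩))
  · rw [hprod]
    have := (genMat_det_homog b).C_mul ((-1) ^ n)
    simpa using this
  · intro h0
    apply hev (fun _ => 1)
    · intro h
      exact one_ne_zero (congrFun h ⟨0, hpos⟩)
    · rw [h0, map_zero]

end PartOne

section PartTwo

lemma matrix_idem {C : Type*} [CommRing C] [Nontrivial C] [Finite (MaximalSpectrum C)] (d n : ℕ)
    (i₀ : Fin n) (E : Fin n → Fin n → Matrix (Fin d) (Fin d) C)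
    (hE : ∀ i j l, E i j * E j l = E i l)
    (hE0 : ∀ i j k l, j ≠ k → E i j * E k l = 0)
    (h1 : ∑ i, E i i = 1) :
    ∃ u v : Matrix (Fin d) (Fin d) C,
      u * v = Matrix.diagonal (fun i : Fin d => if i.1 < d / n then 1 else 0) ∧
      v * u = E i₀ i₀ := by
  classical
  let f : Fin n → Fin n → ((Fin d → C) →ₗ[C] (Fin d → C)) := fun i j => Matrix.toLin' (E i j)
  have hf : ∀ i j l x, f i j (f j l x) = f i l x := by
    intro i j l x
    simp only [f, ← Matrix.toLin'_mul_apply, hE]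
  have hf0 : ∀ i j k l x, j ≠ k → f i j (f k l x) = 0 := by
    intro i j k l x h
    simp only [f, ← Matrix.toLin'_mul_apply, hE0 i j k l h]
    simp
  have hf1 : ∀ x, ∑ i, f i i x = x := by
    intro x
    have := congrArg (fun M => Matrix.toLin' M x) h1
    simpa [f, map_sum] using this
  let P := LinearMap.range (f i₀ i₀)
  have hP : ∀ p : P, f i₀ i₀ p = p := by
    rintro ⟨_, x, rfl⟩
    exact hf _ _ _ _
  let r : (Fin d → C) →ₗ[C] P := (f i₀ i₀).rangeRestrict
  have hr : ∀ p : P, r p = p := fun p => Subtype.ext (hP p)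
  have : Module.Projective C P :=
    Module.Projective.of_split P.subtype r (LinearMap.ext hr)
  have : Module.Finite C P := Module.Finite.range _
  -- the decomposition
  let φ : (Fin d → C) ≃ₗ[C] (Fin n → P) :=
    { toFun := fun x i => r (f i₀ i x)
      map_add' := by intro x y; ext i; simp
      map_smul' := by intro c x; ext i; simp
      invFun := fun p => ∑ i, f i i₀ (p i)
      left_inv := by
        intro x
        simp only [r, LinearMap.codRestrict_apply, LinearMap.rangeRestrict, hf]
        exact hf1 x
      right_inv := by
        intro p
        funext i
        apply Subtype.ext
        simp only [map_sum]
        rw [Finset.sum_eq_single i]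
        · rw [hf, hP, hr]
        · intro j _ hj
          rw [hf0 _ _ _ _ _ hj.symm, map_zero]
        · simp }
  have hn : 0 < n := i₀.pos
  have hrk : ∀ m : MaximalSpectrum C,
      n * Module.finrank (C ⧸ m.1) ((C ⧸ m.1) ⊗[C] P) = d := by
    intro m
    let _ := Ideal.Quotient.field m.1
    have e1 : ((C ⧸ m.1) ⊗[C] (Fin d → C)) ≃ₗ[C ⧸ m.1] ((C ⧸ m.1) ⊗[C] (Fin n → P)) :=
      φ.baseChange C (C ⧸ m.1) _ _
    have e2 := (TensorProduct.piScalarRight C (C ⧸ m.1) (C ⧸ m.1) (Fin d)).symm.trans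
      (e1.trans (TensorProduct.piRight C (C ⧸ m.1) (C ⧸ m.1) (fun _ : Fin n => P)))
    have := e2.finrank_eq
    rw [Module.finrank_pi, Module.finrank_pi_fintype] at this
    simpa using this.symm
  obtain ⟨m0⟩ : Nonempty (MaximalSpectrum C) := inferInstance
  have hk : n * (d / n) = d := Nat.mul_div_cancel' ⟨_, (hrk m0).symm⟩
  obtain ⟨b⟩ := Module.nonempty_basis_of_flat_of_finrank_eq C P (d / n) (fun m => by
    have := hrk m
    exact (Nat.div_eq_of_eq_mul_right hn this.symm).symm)
  have hkd : d / n ≤ d := Nat.div_le_self _ _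
  set k := d / n
  let g := b.equivFun
  let ι : (Fin k → C) →ₗ[C] (Fin d → C) :=
    { toFun := fun x i => if h : i.1 < k then x ⟨i.1, h⟩ else 0
      map_add' := by intro x y; ext i; simp only [Pi.add_apply]; split_ifs <;> simp
      map_smul' := by intro c x; ext i; simp }
  let π : (Fin d → C) →ₗ[C] (Fin k → C) := LinearMap.funLeft C C (Fin.castLE hkd)
  refine ⟨LinearMap.toMatrix' (ι ∘ₗ g.toLinearMap ∘ₗ r),
    LinearMap.toMatrix' (P.subtype ∘ₗ g.symm.toLinearMap ∘ₗ π), ?_, ?_⟩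
  · rw [← LinearMap.toMatrix'_comp, ← Matrix.toLin'.injective.eq_iff, Matrix.toLin'_toMatrix']
    apply LinearMap.ext
    intro x
    funext i
    simp only [LinearMap.comp_apply, Submodule.subtype_apply, hr, LinearEquiv.coe_coe,
      LinearEquiv.apply_symm_apply, Matrix.toLin'_apply, Matrix.mulVec_diagonal]
    simp [ι, π, LinearMap.funLeft]
  · rw [← LinearMap.toMatrix'_comp, ← Matrix.toLin'.injective.eq_iff, Matrix.toLin'_toMatrix']
    apply LinearMap.ext
    intro x
    have hπι : ∀ y, π (ι y) = y := by
      intro y; funext j; simp [π, ι, LinearMap.funLeft]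
    simp only [LinearMap.comp_apply, hπι, LinearEquiv.coe_coe, LinearEquiv.symm_apply_apply]
    rfl

lemma lift_equiv {T T' : Type*} [Ring T] [Ring T'] (Φ : T →+* T') (hs : Function.Surjective Φ)
    (hnil : ∀ x, Φ x = 0 → IsNilpotent x) (e ε : T) (he : e * e = e) (hε : ε * ε = ε)
    (u' v' : T') (h1 : u' * v' = Φ e) (h2 : v' * u' = Φ ε) :
    ∃ u v w : T, e * u = u ∧ u * ε = u ∧ u * v = e ∧ w * u = ε := by
  obtain ⟨u0, rfl⟩ := hs u'
  obtain ⟨v0, rfl⟩ := hs v'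
  have key : ∀ e ε u0 v0 : T, e * e = e → ε * ε = ε → Φ u0 * Φ v0 = Φ e → Φ v0 * Φ u0 = Φ ε →
      ∃ z, (e * u0 * ε) * (ε * v0 * e) * z = e ∧ z * ((e * u0 * ε) * (ε * v0 * e)) = e := by
    intro e ε u0 v0 he hε h1 h2
    set y := (e * u0 * ε) * (ε * v0 * e) with hy
    have hey : e * y = y := by simp only [hy, ← mul_assoc, he]
    have hye : y * e = y := by simp only [hy, mul_assoc, he]
    have hN : IsNilpotent (e - y) := by
      apply hnil
      have : Φ y = Φ e := by
        simp only [hy, map_mul, ← h2]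
        have h3 : Φ e * Φ e = Φ e := by rw [← map_mul, he]
        calc _ = Φ e * (Φ u0 * Φ v0) * (Φ u0 * Φ v0) * (Φ u0 * Φ v0) * Φ e := by
              simp only [mul_assoc]
          _ = _ := by simp only [h1, h3]
      rw [map_sub, this, sub_self]
    obtain ⟨w, hw⟩ := hN.isUnit_one_sub
    have hyw : y = e * w := by rw [hw, mul_sub, mul_sub, hey, he]; simp
    have hyw' : y = w * e := by rw [hw, sub_mul, sub_mul, hye, he]; simp
    refine ⟨e * ↑w⁻¹ , ?_, ?_⟩
    · rw [← mul_assoc, hye, hyw, mul_assoc, Units.mul_inv, mul_one]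
    · have : e * (↑w⁻¹ : T) = ↑w⁻¹ * e := by
        rw [Units.eq_inv_mul_iff_mul_eq, ← mul_assoc, ← hyw', hyw, mul_assoc, Units.mul_inv, mul_one]
      rw [this, mul_assoc, hey, hyw', ← mul_assoc, Units.inv_mul, one_mul]
  obtain ⟨z, hz, -⟩ := key e ε u0 v0 he hε h1 h2
  obtain ⟨z', -, hz'⟩ := key ε e v0 u0 hε he h2 h1
  refine ⟨e * u0 * ε, ε * v0 * e * z, z' * (ε * v0 * e), ?_, ?_, ?_, ?_⟩
  · simp only [← mul_assoc, he]
  · simp only [mul_assoc, hε]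
  · rw [← mul_assoc]; exact hz
  · rw [mul_assoc]; exact hz'

end PartTwo

section PartThree

lemma nil_ker {k K R B : Type*} [Field k] [Field K] [Algebra k K] [Ring R] [Algebra k R]
    [Ring B] [Algebra k B] (Ψ : R →ₐ[k] B) (hs : Function.Surjective Ψ)
    (J : Ideal R) (hJ : IsNilpotent J) (hker : ∀ x, Ψ x = 0 → x ∈ J) (x : K ⊗[k] R)
    (hx : Algebra.TensorProduct.map (AlgHom.id k K) Ψ x = 0) : IsNilpotent x := by
  have hex : Function.Exact (LinearMap.ker Ψ.toLinearMap).subtype Ψ.toLinearMap :=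
    LinearMap.exact_subtype_ker_map _
  have h1 := (lTensor_exact K hex hs x).1 hx
  obtain ⟨y, rfl⟩ := h1
  let I : ℕ → Submodule k (K ⊗[k] R) := fun m =>
    Submodule.span k {z | ∃ a : K, ∃ j ∈ J ^ m, z = a ⊗ₜ[k] j}
  set x := LinearMap.lTensor K (LinearMap.ker Ψ.toLinearMap).subtype y with hxdef
  have hx1 : x ∈ I 1 := by
    rw [hxdef]
    clear_value x
    clear hxdef hx
    induction y with
    | zero => simp
    | add a b ha hb => rw [map_add]; exact Submodule.add_mem _ ha hb
    | tmul a b =>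
      refine Submodule.subset_span ⟨a, b, ?_, by simp⟩
      rw [Submodule.pow_one]
      exact hker _ b.2
  have hmul : ∀ a, I a * I 1 ≤ I (a + 1) := by
    intro a
    rw [Submodule.span_mul_span, Submodule.span_le]
    rintro _ ⟨_, ⟨c, j, hj, rfl⟩, _, ⟨c', j', hj', rfl⟩, rfl⟩
    refine Submodule.subset_span ⟨c * c', j * j', ?_, by simp⟩
    rw [Submodule.pow_one] at hj'
    rw [Submodule.pow_succ]
    exact Ideal.mul_mem_mul hj hj'
  have hpow : ∀ m, x ^ m ∈ I m := by
    intro m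
    induction m with
    | zero => exact Submodule.subset_span ⟨1, 1, by rw [Submodule.pow_zero]; exact Submodule.one_le.1 le_rfl, by simp [Algebra.TensorProduct.one_def]⟩
    | succ m ih => rw [pow_succ]; exact hmul _ (Submodule.mul_mem_mul ih hx1)
  obtain ⟨m, hm⟩ := hJ
  refine ⟨m, ?_⟩
  have h2 := hpow m
  have h3 : I m ≤ ⊥ := by
    rw [Submodule.span_le]
    rintro _ ⟨a, j, hj, rfl⟩
    rw [hm] at hj
    have : j = 0 := by simpa using hj
    simp [this]
  simpa using h3 h2

/-- `K ⊗ Mat_d(L) ≃ Mat_d(K ⊗ L)` -/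
noncomputable def tensorMat (k K L : Type*) [Field k] [Field K] [Field L] [Algebra k K]
    [Algebra k L] (d : ℕ) :
    K ⊗[k] Matrix (Fin d) (Fin d) L ≃ₐ[k] Matrix (Fin d) (Fin d) (K ⊗[k] L) :=
  ((Algebra.TensorProduct.congr AlgEquiv.refl (matrixEquivTensor (Fin d) k L)).trans
    (Algebra.TensorProduct.assoc k k k K L (Matrix (Fin d) (Fin d) k)).symm).trans
    (matrixEquivTensor (Fin d) k (K ⊗[k] L)).symm

lemma tensorMat_one_tmul (k K L : Type*) [Field k] [Field K] [Field L] [Algebra k K]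
    [Algebra k L] (d : ℕ) (M : Matrix (Fin d) (Fin d) L) :
    tensorMat k K L d (1 ⊗ₜ M) = M.map (fun x => (1 : K) ⊗ₜ[k] x) := by
  simp only [tensorMat, AlgEquiv.trans_apply]
  rw [AlgEquiv.symm_apply_eq, AlgEquiv.symm_apply_eq]
  simp [TensorProduct.tmul_sum, matrixEquivTensor_apply]

lemma exists_fields (k R : Type) [Field k] [Ring R] [Algebra k R] [FiniteDimensional k R]
    (H : ∀ (D : Type) [DivisionRing D] [Algebra k D] [FiniteDimensional k D] (x y : D),
      x * y = y * x) :
    ∃ (s : ℕ) (L : Fin s → Type) (d : Fin s → ℕ) (_ : ∀ i, Field (L i)) (_ : ∀ i, Algebra k (L i))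
      (_ : ∀ i, FiniteDimensional k (L i))
      (Ψ : R →ₐ[k] Π i, Matrix (Fin (d i)) (Fin (d i)) (L i)) (J : Ideal R),
      Function.Surjective Ψ ∧ IsNilpotent J ∧ ∀ x, Ψ x = 0 → x ∈ J := by
  have : IsArtinianRing R := IsArtinianRing.of_finite k R
  have hsp : IsSemiprimaryRing R := inferInstance
  have : Module.Finite k (R ⧸ Ring.jacobson R) :=
    Module.Finite.of_surjective (Ideal.Quotient.mkₐ k (Ring.jacobson R)).toLinearMap
      (Ideal.Quotient.mk_surjective)
  obtain ⟨s, D, d, iD, iA, iF, -, ⟨e⟩⟩ :=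
    IsSemisimpleRing.exists_algEquiv_pi_matrix_divisionRing_finite k (R ⧸ Ring.jacobson R)
  refine ⟨s, D, d, fun i => { iD i with mul_comm := fun x y => H (D i) x y }, iA, iF,
    e.toAlgHom.comp (Ideal.Quotient.mkₐ k (Ring.jacobson R)), Ring.jacobson R, ?_,
    hsp.isNilpotent, ?_⟩
  · exact e.surjective.comp Ideal.Quotient.mk_surjective
  · intro x hx
    have h1 : e (Ideal.Quotient.mk (Ring.jacobson R) x) = 0 := hx
    rw [map_eq_zero_iff e e.injective] at h1
    exact Ideal.Quotient.eq_zero_iff_mem.1 h1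

theorem ring_descent (k K R : Type) [Field k] [Field K] [Algebra k K] [Ring R] [Algebra k R]
    [FiniteDimensional k R]
    (H : ∀ (D : Type) [DivisionRing D] [Algebra k D] [FiniteDimensional k D] (x y : D),
      x * y = y * x) (n : ℕ)
    (i₀ : Fin n) (E : Fin n → Fin n → K ⊗[k] R)
    (hE : ∀ i j l, E i j * E j l = E i l)
    (hE0 : ∀ i j k l, j ≠ k → E i j * E k l = 0)
    (h1 : ∑ i, E i i = 1) :
    ∃ (e : R) (u v w : K ⊗[k] R), e * e = e ∧ (1 ⊗ₜ e) * u = u ∧ u * E i₀ i₀ = u ∧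
      u * v = 1 ⊗ₜ e ∧ w * u = E i₀ i₀ := by
  classical
  obtain ⟨s, L, d, _, _, _, Ψ, J, hs, hJ, hker⟩ := exists_fields k R H
  let Φ1 : K ⊗[k] R →ₐ[k] K ⊗[k] (Π i, Matrix (Fin (d i)) (Fin (d i)) (L i)) :=
    Algebra.TensorProduct.map (AlgHom.id k K) Ψ
  let Θ : K ⊗[k] (Π i, Matrix (Fin (d i)) (Fin (d i)) (L i)) ≃ₐ[k]
      Π i, Matrix (Fin (d i)) (Fin (d i)) (K ⊗[k] L i) :=
    (Algebra.TensorProduct.piRight k k K (fun i => Matrix (Fin (d i)) (Fin (d i)) (L i))).trans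
      (AlgEquiv.piCongrRight fun i => tensorMat k K (L i) (d i))
  let Φ : K ⊗[k] R →ₐ[k] Π i, Matrix (Fin (d i)) (Fin (d i)) (K ⊗[k] L i) := Θ.toAlgHom.comp Φ1
  have hΦs : Function.Surjective Φ :=
    Θ.surjective.comp (TensorProduct.map_surjective Function.surjective_id hs)
  have hΦnil : ∀ x, Φ x = 0 → IsNilpotent x := by
    intro x hx
    have hx' : Θ (Φ1 x) = 0 := hx
    rw [map_eq_zero_iff Θ Θ.injective] at hx'
    exact nil_ker Ψ hs J hJ hker x hx'
  let eb : Π i, Matrix (Fin (d i)) (Fin (d i)) (L i) :=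
    fun i => Matrix.diagonal (fun j => if j.1 < d i / n then 1 else 0)
  have heb : IsIdempotentElem eb := by
    funext i
    simp [eb]
  have hΨnil : ∀ x ∈ RingHom.ker Ψ.toRingHom, IsNilpotent x := by
    intro x hx
    obtain ⟨m, hm⟩ := hJ
    refine ⟨m, ?_⟩
    have := Ideal.pow_mem_pow (hker x hx) m
    rw [hm] at this
    simpa using this
  obtain ⟨e, he, hee⟩ := exists_isIdempotentElem_eq_of_ker_isNilpotent Ψ.toRingHom hΨnil eb
    (hs eb) heb
  have hee' : Ψ e = eb := hee
  have hΦe : ∀ i, Φ (1 ⊗ₜ e) i =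
      Matrix.diagonal (fun j : Fin (d i) => if j.1 < d i / n then (1 : K ⊗[k] L i) else 0) := by
    intro i
    have : Φ (1 ⊗ₜ e) i = tensorMat k K (L i) (d i) (1 ⊗ₜ (Ψ e i)) := rfl
    rw [this, hee', tensorMat_one_tmul]
    ext a b
    by_cases hab : a = b
    · subst hab
      simp only [eb, Matrix.map_apply, Matrix.diagonal_apply_eq]
      split_ifs <;> simp [Algebra.TensorProduct.one_def]
    · simp [eb, hab]
  have hloc : ∀ i, ∃ u v : Matrix (Fin (d i)) (Fin (d i)) (K ⊗[k] L i),
      u * v = Φ (1 ⊗ₜ e) i ∧ v * u = Φ (E i₀ i₀) i := by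
    intro i
    have : IsArtinianRing (K ⊗[k] L i) := IsArtinianRing.of_finite K _
    rw [hΦe i]
    refine matrix_idem (d i) n i₀ (fun a b => Φ (E a b) i) ?_ ?_ ?_
    · intro a b c
      rw [← Pi.mul_apply, ← map_mul, hE]
    · intro a b c c' h
      rw [← Pi.mul_apply, ← map_mul, hE0 _ _ _ _ h, map_zero, Pi.zero_apply]
    · rw [← Finset.sum_apply, ← map_sum, h1, map_one, Pi.one_apply]
  choose u' v' hu hv using hloc
  obtain ⟨u, v, w, h⟩ := lift_equiv Φ.toRingHom hΦs hΦnil (1 ⊗ₜ e) (E i₀ i₀)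
    (by simp [he.eq]) (hE _ _ _) u' v' (funext hu) (funext hv)
  exact ⟨e, u, v, w, he, h⟩

end PartThree

section PartFour

variable {k K N V : Type} [Field k] [Field K] [Algebra k K] [AddCommGroup N] [Module k N]
  [AddCommGroup V] [Module k V] [Module K V] [IsScalarTower k K V]

/-- `endHom` as an algebra homomorphism. -/
noncomputable def endAlgHom {α : N →ₗ[k] V} (j : IsBaseChange K α) :
    Module.End k N →ₐ[k] Module.End K V :=
  AlgHom.ofLinearMap (IsBaseChange.endHom j) (IsBaseChange.endHom_one j) (by
    intro f g
    refine j.algHom_ext _ _ fun x => ?_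
    simp [IsBaseChange.endHom_comp_apply])

lemma endAlgHom_apply {α : N →ₗ[k] V} (j : IsBaseChange K α) (f : Module.End k N) (x : N) :
    endAlgHom j f (α x) = α (f x) := IsBaseChange.endHom_comp_apply j f x

/-- the extension to `K ⊗ End N`. -/
noncomputable def rhoHom {α : N →ₗ[k] V} (j : IsBaseChange K α) :
    K ⊗[k] Module.End k N →ₐ[K] Module.End K V :=
  Algebra.TensorProduct.lift (Algebra.ofId K _) (endAlgHom j)
    (fun a _ => Algebra.commutes a _)

lemma rhoHom_one_tmul {α : N →ₗ[k] V} (j : IsBaseChange K α) (f : Module.End k N) :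
    rhoHom j (1 ⊗ₜ f) = endAlgHom j f := by
  refine (Algebra.TensorProduct.lift_tmul _ _ _ _ _).trans ?_
  rw [map_one, one_mul]

lemma rhoHom_bijective [FiniteDimensional k N] {α : N →ₗ[k] V} (j : IsBaseChange K α) :
    Function.Bijective (rhoHom j) := by
  have : ⇑(rhoHom j) = ⇑(IsBaseChange.end j).equiv := by
    have h : (rhoHom j).toLinearMap = (IsBaseChange.end j).equiv.toLinearMap := by
      refine TensorProduct.AlgebraTensorModule.ext fun a f => ?_
      simp only [AlgHom.toLinearMap_apply, LinearEquiv.coe_coe, IsBaseChange.equiv_tmul]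
      simp only [rhoHom]
      rfl
    funext x
    exact LinearMap.congr_fun h x
  rw [this]
  exact (IsBaseChange.end j).equiv.bijective

/-- structure of the commuting algebra -/
lemma commutant {A : Type} [FiniteDimensional k N] {α : N →ₗ[k] V} (j : IsBaseChange K α)
    (aN : A → Module.End k N) (aV : A → Module.End K V) (ha : ∀ a x, aV a (α x) = α (aN a x)) :
    ∃ (R : Type) (_ : Ring R) (_ : Algebra k R) (_ : FiniteDimensional k R)
      (τ : R → Module.End k N) (ρ : K ⊗[k] R →ₐ[k] Module.End K V),
      Function.Injective ρ ∧ (∀ x a, aV a * ρ x = ρ x * aV a) ∧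
      (∀ y : Module.End K V, (∀ a, aV a * y = y * aV a) → ∃ x, ρ x = y) ∧
      (∀ e x, ρ (1 ⊗ₜ e) (α x) = α (τ e x)) := by
  have haV : ∀ a, rhoHom j (1 ⊗ₜ aN a) = aV a := by
    intro a
    rw [rhoHom_one_tmul]
    refine j.algHom_ext _ _ fun x => ?_
    rw [endAlgHom_apply, ha]
  let ι := Algebra.TensorProduct.map (AlgHom.id k K) (Subalgebra.centralizer k (Set.range aN)).val
  have hι : Function.Injective ι :=
    Module.Flat.lTensor_preserves_injective_linearMap (M := K)
      (Subalgebra.centralizer k (Set.range aN)).val.toLinearMap Subtype.val_injective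
  have hc := Subalgebra.centralizer_coe_image_includeRight_eq_center_tensorProduct k K
    (Module.End k N) (Set.range aN)
  refine ⟨Subalgebra.centralizer k (Set.range aN), inferInstance, inferInstance,
    Module.Finite.of_injective (Subalgebra.centralizer k (Set.range aN)).val.toLinearMap
      Subtype.val_injective,
    (Subalgebra.centralizer k (Set.range aN)).val, ((rhoHom j).restrictScalars k).comp ι,
    (rhoHom_bijective j).1.comp hι, ?_, ?_, ?_⟩
  · intro x a
    have hx : ι x ∈ ι.range := ⟨x, rfl⟩
    rw [← hc, Subalgebra.mem_centralizer_iff] at hx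
    have := hx (1 ⊗ₜ aN a) ⟨aN a, ⟨a, rfl⟩, rfl⟩
    have h2 := congrArg (rhoHom j) this
    rwa [map_mul, map_mul, haV] at h2
  · intro y hy
    obtain ⟨z, rfl⟩ := (rhoHom_bijective j).2 y
    have hz : z ∈ ι.range := by
      rw [← hc, Subalgebra.mem_centralizer_iff]
      rintro _ ⟨_, ⟨a, rfl⟩, rfl⟩
      apply (rhoHom_bijective j).1
      rw [map_mul, map_mul]
      have := hy a
      rw [← haV] at this
      exact this
    obtain ⟨x, hx⟩ := hz
    exact ⟨x, congrArg (rhoHom j) hx⟩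
  · intro e x
    have : (((rhoHom j).restrictScalars k).comp ι) (1 ⊗ₜ e) = rhoHom j (1 ⊗ₜ e.1) := by
      simp [ι]
    rw [this, rhoHom_one_tmul, endAlgHom_apply]
    rfl

end PartFour

section PartFive

/-- the matrix units of `End_K (M^n)` -/
noncomputable def matUnit (K M : Type) [Field K] [AddCommGroup M] [Module K M] (n : ℕ)
    (i j : Fin n) : Module.End K (Fin n → M) :=
  (LinearMap.single K (fun _ => M) i).comp (LinearMap.proj j)

lemma matUnit_apply (K M : Type) [Field K] [AddCommGroup M] [Module K M] (n : ℕ)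
    (i j : Fin n) (x : Fin n → M) : matUnit K M n i j x = Pi.single i (x j) := rfl

theorem core_descent {k K M A : Type} [Field k] [Field K] [Algebra k K]
    [AddCommGroup M] [Module k M] [Module K M] [IsScalarTower k K M] [Module.Finite K M]
    (act : A → Module.End K M)
    (H : ∀ (D : Type) [DivisionRing D] [Algebra k D] [FiniteDimensional k D] (x y : D),
      x * y = y * x)
    (n : ℕ) (hn : 0 < n) (N : Submodule k (Fin n → M))
    (hN : ∀ a x, x ∈ N → (fun i => act a (x i)) ∈ N)
    (j : IsBaseChange K N.subtype) :
    ∃ N' : Submodule k M, (∀ a x, x ∈ N' → act a x ∈ N') ∧ IsBaseChange K N'.subtype := by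
  classical
  let i₀ : Fin n := ⟨0, hn⟩
  have hfin : Module.Finite K (K ⊗[k] N) := Module.Finite.equiv j.equiv.symm
  have hfN : FiniteDimensional k N :=
    Module.Finite.of_finite_tensorProduct_of_faithfullyFlat (R := k) K
  let aV : A → Module.End K (Fin n → M) := fun a =>
    LinearMap.pi fun i => (act a).comp (LinearMap.proj i)
  have haV : ∀ a x i, aV a x i = act a (x i) := fun _ _ _ => rfl
  let aN : A → Module.End k N := fun a =>
    ((aV a).restrictScalars k).restrict (fun x hx => hN a x hx)
  obtain ⟨R, _, _, _, τ, ρ, hinj, hcomm, hsurj, hρ⟩ := commutant j aN aV (fun a x => rfl)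
  have hunit : ∀ i l, ∃ x, ρ x = matUnit K M n i l := by
    intro i l
    refine hsurj _ fun a => ?_
    ext x m m'
    simp only [Module.End.mul_apply, LinearMap.comp_apply, matUnit_apply, haV]
    by_cases h : m' = i
    · subst h; simp [haV]
    · simp [h]
  choose E hEρ using hunit
  obtain ⟨e, u, v, w, he, h1, h2, h3, h4⟩ := ring_descent k K
    R H n i₀ E
    (by
      intro a b c
      apply hinj
      rw [map_mul, hEρ, hEρ, hEρ]
      refine LinearMap.ext fun x => ?_
      simp [matUnit_apply])
    (by
      intro a b c d hbc
      apply hinj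
      rw [map_mul, hEρ, hEρ, map_zero]
      refine LinearMap.ext fun x => ?_
      simp [matUnit_apply, hbc])
    (by
      apply hinj
      rw [map_sum, map_one]
      refine LinearMap.ext fun x => ?_
      simp only [hEρ, LinearMap.sum_apply, matUnit_apply, Module.End.one_apply]
      exact Finset.univ_sum_single x)
  let g : M →ₗ[K] (Fin n → M) := (ρ u).comp (LinearMap.single K (fun _ => M) i₀)
  have hg : ∀ m, g m = ρ u (Pi.single i₀ m) := fun _ => rfl
  have hwg : ∀ m, ρ w (g m) = Pi.single i₀ m := by
    intro m
    rw [hg, ← Module.End.mul_apply, ← map_mul, h4, hEρ, matUnit_apply]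
    simp
  have hginj : Function.Injective g := by
    intro a b hab
    have := hwg a
    rw [hab, hwg] at this
    exact (Pi.single_injective _ this).symm
  have hga : ∀ a m, aV a (g m) = g (act a m) := by
    intro a m
    rw [hg, hg, ← Module.End.mul_apply, hcomm, Module.End.mul_apply]
    congr 1
    funext i
    rw [haV]
    by_cases h : i = i₀
    · subst h; simp
    · simp [h]
  -- the idempotent
  have heg : ∀ m, ρ (1 ⊗ₜ e) (g m) = g m := by
    intro m
    rw [hg, ← Module.End.mul_apply, ← map_mul, h1]
  have her : ∀ x, ρ (1 ⊗ₜ e) x = g (ρ v x i₀) := by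
    intro x
    rw [hg, ← h3, map_mul, Module.End.mul_apply]
    nth_rw 1 [← h2]
    rw [map_mul, hEρ, Module.End.mul_apply, matUnit_apply]
  let N' : Submodule k M := N.comap (g.restrictScalars k)
  have hN' : ∀ m, m ∈ N' ↔ g m ∈ N := fun _ => Iff.rfl
  refine ⟨N', ?_, ?_⟩
  · intro a x hx
    rw [hN', ← hga]
    exact hN a _ ((hN' x).1 hx)
  · let gN : N' →ₗ[k] N := (g.restrictScalars k).restrict (fun x hx => hx)
    have hgN : Function.Injective gN := by
      intro a b hab
      apply Subtype.ext
      apply hginj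
      exact congrArg Subtype.val hab
    let f : K ⊗[k] N' →ₗ[K] M := LinearMap.liftBaseChange K N'.subtype
    have hf : ∀ a x, f (a ⊗ₜ x) = a • x.1 := fun a x => by simp [f]
    have hcomp : ∀ z, g (f z) = j.equiv (LinearMap.lTensor K gN z) := by
      intro z
      induction z with
      | zero => simp
      | add x y hx hy => simp only [map_add, hx, hy]
      | tmul a x =>
        rw [hf, LinearMap.lTensor_tmul, IsBaseChange.equiv_tmul, map_smul]
        rfl
    have hfinj : Function.Injective f := by
      intro a b hab
      have := congrArg g hab
      rw [hcomp, hcomp] at this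
      exact Module.Flat.lTensor_preserves_injective_linearMap (M := K) gN hgN
        (j.equiv.injective this)
    have hfs : Function.Surjective f := by
      have key : ∀ y : Fin n → M, ∃ z, g (f z) = ρ (1 ⊗ₜ e) y := by
        intro y
        refine j.inductionOn y (fun y => ∃ z, g (f z) = ρ (1 ⊗ₜ e) y) ?_ ?_ ?_ ?_
        · exact ⟨0, by simp⟩
        · intro m
          have hm : ρ (1 ⊗ₜ e) (N.subtype m) ∈ N := by
            rw [hρ]
            exact (τ e m).2
          refine ⟨1 ⊗ₜ ⟨ρ v (N.subtype m) i₀, ?_⟩, ?_⟩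
          · rw [hN', ← her]
            exact hm
          · rw [hf, one_smul]
            exact (her _).symm
        · rintro s y ⟨z, hz⟩
          exact ⟨s • z, by rw [map_smul, map_smul, hz, map_smul]⟩
        · rintro y y' ⟨z, hz⟩ ⟨z', hz'⟩
          exact ⟨z + z', by rw [map_add, map_add, hz, hz', map_add]⟩
      intro m
      obtain ⟨z, hz⟩ := key (g m)
      exact ⟨z, hginj (hz.trans (heg m))⟩
    refine IsBaseChange.of_equiv (LinearEquiv.ofBijective f ⟨hfinj, hfs⟩) fun x => ?_
    exact (hf 1 x).trans (one_smul _ _)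

end PartFive

/-- Let `F` be a `C₁`-field, `A` a finite-dimensional `F`-algebra,
`K/F` a field extension, `M` a finitely generated `A_K`-module, and `K₀` an
intermediate field with `[K₀ : F] < ∞`.  If `Mⁿ` is defined over `K₀` for some
`n > 0`, then so is `M`. -/
theorem descendsTo_of_pow_descendsTo
    (F K A : Type) [Field F] [Field K] [Algebra F K]
    [Ring A] [Algebra F A] [FiniteDimensional F A]
    (hC1 : IsC1Field F)
    (M : Type) [AddCommGroup M] [Module F M] [Module K M] [Module A M]
    [IsScalarTower F K M] [IsScalarTower F A M] [SMulCommClass K A M]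
    [Module.Finite K M]
    (K₀ : IntermediateField F K) [FiniteDimensional F K₀]
    (n : ℕ) (hn : 0 < n)
    (h : DescendsTo F K A (Fin n → M) K₀) :
    DescendsTo F K A M K₀ := by
  obtain ⟨N, hN, j⟩ := h
  let act : A → Module.End K M := fun a =>
    { toFun := fun x => a • x
      map_add' := fun x y => smul_add a x y
      map_smul' := fun c x => (smul_comm c a x).symm }
  refine core_descent act ?_ n hn N hN j
  intro D _ _ _ x y
  letI : Algebra F D := Algebra.compHom D (algebraMap F K₀)
  haveI : IsScalarTower F K₀ D := IsScalarTower.of_algebraMap_eq fun _ => rfl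
  haveI : FiniteDimensional F D := Module.Finite.trans K₀ D
  exact C1_comm hC1 x y
end

section
/- Let F be a C₁-field, A a finite-dimensional F-algebra, K/F a separable algebraic field extension, and M a finitely generated A_K-module. Then M has a minimal field of definition K₀ with F ⊆ K₀ ⊆ K, and [K₀ : F] < ∞. -/
open TensorProduct

theorem divAlg_indep {Z D : Type} [Field Z] [DivisionRing D] [Algebra Z D]
    [Algebra.IsCentral Z D] {ι : Type} [Fintype ι] [DecidableEq ι] (d : ι → D)
    (hd : LinearIndependent Z d) (s : Finset ι) : ∀ (a : ι → D),
    (∀ j, j ∉ s → a j = 0) → (∀ y, ∑ j, a j * y * d j = 0) → a = 0 := by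
  induction s using Finset.induction_on with
  | empty => intro a ha _; funext j; exact ha j (by simp)
  | insert j0 s hj0 ih =>
    intro a ha h
    by_cases h0 : a j0 = 0
    · refine ih a (fun j hj => ?_) h
      by_cases e : j = j0
      · rw [e, h0]
      · exact ha j (by simp [e, hj])
    exfalso
    have key : ∀ z j, z * ((a j0)⁻¹ * a j) = ((a j0)⁻¹ * a j) * z := by
      intro z j
      have := ih (fun j => z * ((a j0)⁻¹ * a j) - ((a j0)⁻¹ * a j) * z) ?_ ?_
      · exact sub_eq_zero.mp (congrFun this j)
      · intro j hj
        by_cases e : j = j0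
        · subst e; simp [h0]
        · simp [ha j (by simp [e, hj])]
      · intro y
        have h1 := congrArg (fun t => z * ((a j0)⁻¹ * t)) (h y)
        have h2 := congrArg (fun t => (a j0)⁻¹ * t) (h (z * y))
        simp only [Finset.mul_sum, mul_zero] at h1 h2
        calc _ = ∑ j, (z * ((a j0)⁻¹ * (a j * y * d j)) - (a j0)⁻¹ * (a j * (z * y) * d j)) := by
              refine Finset.sum_congr rfl fun j _ => ?_
              simp only [sub_mul, mul_assoc]
          _ = 0 := by rw [Finset.sum_sub_distrib, h1, h2, sub_zero]
    have hc : ∀ j, ∃ c : Z, algebraMap Z D c = (a j0)⁻¹ * a j := by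
      intro j
      have : (a j0)⁻¹ * a j ∈ Subalgebra.center Z D := by
        rw [Subalgebra.mem_center_iff]; exact fun z => key z j
      rw [Algebra.IsCentral.center_eq_bot] at this
      exact Algebra.mem_bot.mp this
    choose c hc using hc
    have h1 := congrArg (fun t => (a j0)⁻¹ * t) (h 1)
    simp only [Finset.mul_sum, mul_zero, mul_one, ← mul_assoc, ← hc, ← Algebra.smul_def] at h1
    have := Fintype.linearIndependent_iff.mp hd c h1 j0
    have h3 := hc j0
    rw [this, map_zero, inv_mul_cancel₀ h0] at h3
    exact zero_ne_one h3

theorem charpoly_compLeft {R M : Type} [CommRing R] [Nontrivial R] [AddCommGroup M] [Module R M]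
    [Module.Free R M] [Module.Finite R M] (f : M →ₗ[R] M) (m : ℕ) :
    LinearMap.charpoly (f.compLeft (Fin m)) = f.charpoly ^ m := by
  induction m with
  | zero => 
    rw [pow_zero]
    have := LinearMap.charpoly_natDegree (f.compLeft (Fin 0))
    rw [Module.finrank_zero_of_subsingleton] at this
    exact (LinearMap.charpoly_monic _).natDegree_eq_zero.mp this
  | succ m ih =>
    rw [pow_succ', ← ih, ← LinearMap.charpoly_prodMap, ← LinearEquiv.charpoly_conj
      (Fin.consLinearEquiv R (fun _ : Fin (m+1) => M))]
    congr 1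
    refine LinearMap.ext fun v => funext fun i => ?_
    simp only [LinearEquiv.conj_apply]
    refine Fin.cases ?_ (fun i => ?_) i <;> simp [Fin.tail]

theorem divAlg_finite (Z D L : Type) [Field Z] [DivisionRing D] [Algebra Z D] [Module.Finite Z D]
    [Field L] [Algebra Z L] [Module L D] [IsScalarTower Z L D] : Module.Finite L D :=
  Module.Finite.of_restrictScalars_finite Z L D

theorem divAlg_finite' (Z D L : Type) [Field Z] [DivisionRing D] [Algebra Z D] [Module.Finite Z D]
    [Field L] [Algebra Z L] [Module L D] [IsScalarTower Z L D] : Module.Finite Z L := by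
  refine Module.Finite.of_injective (LinearMap.restrictScalars Z (LinearMap.toSpanSingleton L D 1)) ?_
  exact smul_left_injective L one_ne_zero

section
variable {Z D : Type} [Field Z] [DivisionRing D] [Algebra Z D] [Module.Finite Z D]
  (L : Type) [Field L] [Algebra Z L] [Module L D] [IsScalarTower Z L D] [IsScalarTower L D D]

variable [Module.Finite L D] [Module.Finite Z L]

theorem divAlg_theta [Algebra.IsCentral Z D]
    (hmax : ∀ a : D, (∀ l : L, a * (l • (1:D)) = l • a) → ∃ l : L, a = l • (1:D)) :
    Module.finrank Z L = Module.finrank L D ∧ ∀ x : D,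
      (LinearMap.mulRight L x).charpoly ^ (Module.finrank L D) =
       ((LinearMap.mulRight Z x).charpoly).map (algebraMap Z L) := by
  let b := Module.finBasis L D
  let d := Module.finBasis Z D
  set m := Module.finrank L D with hm
  let Θ : L ⊗[Z] D →ₗ[L] (Fin m → D) :=
    LinearMap.liftBaseChange L (LinearMap.pi fun i => LinearMap.mulLeft Z (b i))
  have hΘ : ∀ l x i, Θ (l ⊗ₜ x) i = l • (b i * x) := by
    intro l x i; simp [Θ]
  let dL := Algebra.TensorProduct.basis L d
  have hΘb : ∀ (c : Fin (Module.finrank Z D) → L) i, Θ (∑ j, c j • dL j) i =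
      ∑ j, (c j • (1:D)) * b i * d j := by
    intro c i
    rw [map_sum, Finset.sum_apply]
    refine Finset.sum_congr rfl fun j _ => ?_
    rw [map_smul]
    simp [dL, hΘ, smul_mul_assoc]
  have hinj : Function.Injective Θ := by
    rw [injective_iff_map_eq_zero]
    intro t ht
    have e := dL.sum_repr t
    rw [← e] at ht ⊢
    set c := dL.repr t
    have hz : ∀ y, ∑ j, (c j • (1:D)) * y * d j = 0 := by
      intro y
      have : (∑ j, (LinearMap.mulRight L (d j) ∘ₗ (c j • LinearMap.id))) = (0 : D →ₗ[L] D) := by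
        refine b.ext fun i => ?_
        have := (hΘb c i).symm.trans (congrFun ht i)
        simpa [smul_mul_assoc] using this
      simpa [smul_mul_assoc] using LinearMap.congr_fun this y
    have := divAlg_indep d d.linearIndependent Finset.univ _ (by simp) hz
    refine Finset.sum_eq_zero fun j _ => ?_
    have h0 := congrFun this j
    rcases smul_eq_zero.mp (show c j • (1:D) = 0 from h0) with h | h
    · rw [h, zero_smul]
    · exact absurd h one_ne_zero
  have hsurj : Function.Surjective Θ := by
    intro f
    let φ : D →ₗ[L] D := b.constr L f
    let Ψ : (Fin (Module.finrank Z D) → D) →ₗ[Z] (D →ₗ[Z] D) :=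
      ∑ j, (LinearMap.llcomp Z D D D (LinearMap.mulRight Z (d j))) ∘ₗ (LinearMap.mul Z D) ∘ₗ LinearMap.proj j
    have hΨ : ∀ a y, Ψ a y = ∑ j, a j * y * d j := by
      intro a y; simp [Ψ]
    have hΨi : Function.Injective Ψ := by
      rw [injective_iff_map_eq_zero]
      intro a ha
      exact divAlg_indep d d.linearIndependent Finset.univ a (by simp)
        (fun y => by rw [← hΨ, ha]; rfl)
    have hΨs : Function.Surjective Ψ := by
      refine (LinearMap.injective_iff_surjective_of_finrank_eq_finrank ?_).mp hΨi
      simp [Module.finrank_linearMap, Module.finrank_pi_fintype]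
    obtain ⟨a, ha⟩ := hΨs (φ.restrictScalars Z)
    have ha' : ∀ y, φ y = ∑ j, a j * y * d j := fun y => by rw [← hΨ, ha]; rfl
    have hcomm : ∀ l : L, (fun j => a j * (l • (1:D)) - l • a j) = 0 := by
      intro l
      refine divAlg_indep d d.linearIndependent Finset.univ _ (by simp) (fun y => ?_)
      have h1 := ha' (l • y)
      rw [map_smul, ha' y, Finset.smul_sum] at h1
      simp only [sub_mul, Finset.sum_sub_distrib]
      rw [sub_eq_zero]
      calc _ = ∑ j, a j * l • y * d j := by simp [mul_assoc, smul_mul_assoc]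
        _ = _ := by rw [← h1]; simp [mul_assoc, smul_mul_assoc]
    have : ∀ j, ∃ l : L, a j = l • (1:D) :=
      fun j => hmax _ fun l => sub_eq_zero.mp (congrFun (hcomm l) j)
    choose c hc using this
    refine ⟨∑ j, c j • dL j, ?_⟩
    funext i
    rw [hΘb]
    simp only [← hc, ← ha']
    simp [φ]
  let e := LinearEquiv.ofBijective Θ ⟨hinj, hsurj⟩
  constructor
  · have h1 := e.finrank_eq
    rw [Module.finrank_baseChange, Module.finrank_pi_fintype, ← Module.finrank_mul_finrank Z L D] at h1
    simp only [Finset.sum_const, Finset.card_univ, Fintype.card_fin, smul_eq_mul, ← hm] at h1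
    have : 0 < m := Module.finrank_pos
    exact Nat.eq_of_mul_eq_mul_right this h1
  · intro x
    rw [← charpoly_compLeft, ← LinearMap.charpoly_baseChange, ← LinearEquiv.charpoly_conj e]
    congr 1
    refine LinearMap.ext fun v => ?_
    rw [LinearEquiv.conj_apply]
    obtain ⟨t, rfl⟩ := e.surjective v
    simp only [LinearMap.comp_apply, LinearEquiv.coe_coe, LinearEquiv.symm_apply_apply]
    induction t using TensorProduct.induction_on with
    | zero => simp
    | add t s h1 h2 => rw [map_add, map_add, map_add, map_add, h1, h2]
    | tmul l y => 
      funext i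
      change (Θ (l ⊗ₜ y) i) * x = Θ (l ⊗ₜ (y * x)) i
      rw [hΘ, hΘ, smul_mul_assoc, mul_assoc]

theorem divAlg_P (l : L) :
    (LinearMap.mulLeft Z (l • (1:D))).charpoly = (LinearMap.mulLeft Z l).charpoly ^ (Module.finrank L D) := by
  let b := Module.finBasis L D
  rw [← charpoly_compLeft, ← LinearEquiv.charpoly_conj (b.equivFun.restrictScalars Z)]
  congr 1
  refine LinearMap.ext fun v => ?_
  obtain ⟨w, rfl⟩ := (b.equivFun.restrictScalars Z).surjective v
  rw [LinearEquiv.conj_apply]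
  simp only [LinearMap.comp_apply, LinearEquiv.coe_coe, LinearEquiv.symm_apply_apply]
  funext i
  simp
end

theorem exists_max_comm {Z D : Type} [Field Z] [DivisionRing D] [Algebra Z D] [Module.Finite Z D] (x : D) :
    ∃ S : Subalgebra Z D, x ∈ S ∧ (∀ a ∈ S, ∀ b ∈ S, a * b = b * a) ∧
      ∀ a, (∀ b ∈ S, a * b = b * a) → a ∈ S := by
  let P : ℕ → Prop := fun n => ∃ S : Subalgebra Z D, x ∈ S ∧ (∀ a ∈ S, ∀ b ∈ S, a * b = b * a) ∧ Module.finrank Z S = n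
  classical
  have hb : ∀ n, P n → n ≤ Module.finrank Z D := by
    rintro n ⟨S, _, _, rfl⟩
    exact Submodule.finrank_le (Subalgebra.toSubmodule S)
  have hcomm : ∀ s : Set D, (∀ a ∈ s, ∀ b ∈ s, a * b = b * a) → ∀ a ∈ Algebra.adjoin Z s, ∀ b ∈ Algebra.adjoin Z s, a * b = b * a := by
    intro s hs
    have := Algebra.isMulCommutative_adjoin (R := Z) (s := s) hs
    intro a ha b hb
    exact congrArg Subtype.val (this.is_comm.comm ⟨a, ha⟩ ⟨b, hb⟩)
  have h0 : P (Module.finrank Z (Algebra.adjoin Z {x})) :=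
    ⟨_, Algebra.self_mem_adjoin_singleton Z x, hcomm _ (by simp), rfl⟩
  obtain ⟨S, hxS, hS, hfin⟩ := Nat.findGreatest_spec (P := P) (hb _ h0) h0
  refine ⟨S, hxS, hS, fun a ha => ?_⟩
  let S' := Algebra.adjoin Z (insert a (S : Set D))
  have hle : S ≤ S' := fun y hy => Algebra.subset_adjoin (Set.mem_insert_of_mem _ hy)
  have hc' := hcomm (insert a (S : Set D)) (by
    rintro y (rfl | hy) z (rfl | hz)
    · rfl
    · exact ha z hz
    · exact (ha y hy).symm
    · exact hS y hy z hz)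
  have hP : P (Module.finrank Z S') := ⟨S', hle hxS, hc', rfl⟩
  have h1 := Nat.le_findGreatest (hb _ hP) hP
  rw [← hfin] at h1
  have : Subalgebra.toSubmodule S = Subalgebra.toSubmodule S' :=
    Submodule.eq_of_le_of_finrank_le hle h1
  have h2 : a ∈ Subalgebra.toSubmodule S' := Algebra.subset_adjoin (Set.mem_insert _ _)
  rw [← this] at h2
  exact h2

theorem exists_max_field {Z D : Type} [Field Z] [DivisionRing D] [Algebra Z D] [Module.Finite Z D] (x : D) :
    ∃ (L : Type) (_ : Field L) (_ : Algebra Z L) (_ : Module L D) (_ : IsScalarTower Z L D) (_ : IsScalarTower L D D),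
     (∀ a : D, (∀ l : L, a * (l • (1:D)) = l • a) → ∃ l : L, a = l • (1:D)) ∧ ∃ l : L, x = l • (1:D) := by
  obtain ⟨S, hx, hS, hmax⟩ := exists_max_comm (Z := Z) x
  have hf : IsField S := 
    { exists_pair_ne := ⟨0, 1, zero_ne_one⟩
      mul_comm := fun a b => Subtype.ext (hS a a.2 b b.2)
      mul_inv_cancel := by
        intro a ha
        have ha' : (a : D) ≠ 0 := fun h => ha (Subtype.ext h)
        refine ⟨⟨(a:D)⁻¹, hmax _ fun b hb => ?_⟩, Subtype.ext (mul_inv_cancel₀ ha')⟩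
        have := hS a a.2 b hb
        rw [inv_mul_eq_iff_eq_mul₀ ha', ← mul_assoc, this, mul_assoc, mul_inv_cancel₀ ha', mul_one] }
  let _ : Field S := hf.toField
  refine ⟨S, inferInstance, S.algebra, inferInstance, inferInstance, inferInstance, ?_, ?_⟩
  · intro a ha
    have : a ∈ S := hmax a fun b hb => by simpa [Subalgebra.smul_def] using ha ⟨b, hb⟩
    exact ⟨⟨a, this⟩, by simp [Subalgebra.smul_def]⟩
  · exact ⟨⟨x, hx⟩, by simp [Subalgebra.smul_def]⟩

theorem divAlg_det {Z D : Type} [Field Z] [DivisionRing D] [Algebra Z D] [Module.Finite Z D]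
    [Algebra.IsCentral Z D]
    (L : Type) [Field L] [Algebra Z L] [Module L D] [IsScalarTower Z L D] [IsScalarTower L D D]
    [Module.Finite L D]
    (hmax : ∀ a : D, (∀ l : L, a * (l • (1:D)) = l • a) → ∃ l : L, a = l • (1:D)) (x : D) :
    ∃ z : Z, LinearMap.det (LinearMap.mulRight L x) = algebraMap Z L z := by
  have : Module.Finite Z L := divAlg_finite' Z D L
  obtain ⟨h1, h2⟩ := divAlg_theta (Z := Z) L hmax
  have : Algebra.IsCentral Z Dᵐᵒᵖ := by
    constructor
    intro y hy
    have : y.unop ∈ Subalgebra.center Z D := by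
      rw [Subalgebra.mem_center_iff] at hy ⊢
      intro b
      exact congrArg MulOpposite.unop (hy (MulOpposite.op b)).symm
    rw [Algebra.IsCentral.center_eq_bot] at this
    obtain ⟨c, hc⟩ := Algebra.mem_bot.mp this
    exact Algebra.mem_bot.mpr ⟨c, MulOpposite.unop_injective hc⟩
  obtain ⟨L', _, _, _, _, _, hmax', l, hl⟩ := exists_max_field (Z := Z) (MulOpposite.op x)
  have : Module.Finite Z L' := divAlg_finite' Z Dᵐᵒᵖ L'
  have : Module.Finite L' Dᵐᵒᵖ := divAlg_finite Z Dᵐᵒᵖ L'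
  obtain ⟨h1', h2'⟩ := divAlg_theta (Z := Z) L' hmax'
  have h3 := divAlg_P (Z := Z) (D := Dᵐᵒᵖ) L' l
  have h4 : (LinearMap.mulLeft Z (MulOpposite.op x)).charpoly = (LinearMap.mulRight Z x).charpoly := by
    rw [← LinearEquiv.charpoly_conj (MulOpposite.opLinearEquiv Z).symm]
    rfl
  have hm : Module.finrank L' Dᵐᵒᵖ = Module.finrank L D := by
    have e1 := Module.finrank_mul_finrank Z L D
    have e2 := Module.finrank_mul_finrank Z L' Dᵐᵒᵖ
    rw [← (MulOpposite.opLinearEquiv Z (M := D)).finrank_eq] at e2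
    rw [h1] at e1; rw [h1'] at e2
    exact Nat.mul_self_inj.mp (e2.trans e1.symm)
  rw [← hl, h4, hm] at h3
  have h5 := h2 x
  rw [h3, Polynomial.map_pow] at h5
  have hpos : Module.finrank L D ≠ 0 := Module.finrank_pos.ne'
  have h6 : (LinearMap.mulRight L x).charpoly = (LinearMap.mulLeft Z l).charpoly.map (algebraMap Z L) := by
    refine Polynomial.eq_of_monic_of_associated (LinearMap.charpoly_monic _) ((LinearMap.charpoly_monic _).map _) ?_
    refine associated_of_dvd_dvd ?_ ?_
    · exact (UniqueFactorizationMonoid.pow_dvd_pow_iff_dvd hpos).mp h5.dvd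
    · exact (UniqueFactorizationMonoid.pow_dvd_pow_iff_dvd hpos).mp h5.symm.dvd
  rw [LinearMap.det_eq_sign_charpoly_coeff, h6, Polynomial.coeff_map]
  exact ⟨(-1) ^ Module.finrank L D * (LinearMap.mulLeft Z l).charpoly.coeff 0, by rw [map_mul, map_pow, map_neg, map_one]⟩

noncomputable def polyMapCoeff {σ F B : Type} [Field F] [CommRing B] [Algebra F B] (ψ : B →ₗ[F] F)
    (p : MvPolynomial σ B) : MvPolynomial σ F :=
  ∑ μ ∈ p.support, MvPolynomial.monomial μ (ψ (p.coeff μ))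

theorem eval_polyMapCoeff {σ F B : Type} [Field F] [CommRing B] [Algebra F B] (ψ : B →ₗ[F] F)
    (p : MvPolynomial σ B) (x : σ → F) :
    MvPolynomial.eval x (polyMapCoeff ψ p) =
      ψ (MvPolynomial.eval (fun i => algebraMap F B (x i)) p) := by
  rw [polyMapCoeff, map_sum, MvPolynomial.eval_eq (f := p), map_sum]
  refine Finset.sum_congr rfl fun μ _ => ?_
  rw [MvPolynomial.eval_monomial]
  have : p.coeff μ * ∏ i ∈ μ.support, algebraMap F B (x i) ^ μ i =
      (∏ i ∈ μ.support, x i ^ μ i) • p.coeff μ := by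
    rw [Algebra.smul_def, map_prod, mul_comm]; simp
  rw [this, map_smul, smul_eq_mul, mul_comm]; rfl

theorem polyMapCoeff_isHomogeneous {σ F B : Type} [Field F] [CommRing B] [Algebra F B] (ψ : B →ₗ[F] F)
    (p : MvPolynomial σ B) (d : ℕ) (hp : p.IsHomogeneous d) : (polyMapCoeff ψ p).IsHomogeneous d := by
  refine MvPolynomial.IsHomogeneous.sum _ _ _ fun μ hμ => ?_
  refine MvPolynomial.isHomogeneous_monomial _ ?_
  have := hp (MvPolynomial.mem_support_iff.mp hμ)
  rw [← this, Finsupp.degree_eq_weight_one]; rfl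

theorem det_isHomogeneous {σ B : Type} [CommRing B] {k d : ℕ}
    (Q : Matrix (Fin k) (Fin k) (MvPolynomial σ B)) (hQ : ∀ i j, (Q i j).IsHomogeneous d) :
    Q.det.IsHomogeneous (k * d) := by
  rw [Matrix.det_apply]
  refine MvPolynomial.IsHomogeneous.sum _ _ _ fun τ _ => ?_
  have h := MvPolynomial.IsHomogeneous.prod Finset.univ (fun i => Q (τ i) i) (fun _ => d)
    (fun i _ => hQ _ _)
  simp only [Finset.sum_const, Finset.card_univ, Fintype.card_fin, smul_eq_mul] at h
  rw [Units.smul_def, zsmul_eq_mul]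
  have h2 : ((((Equiv.Perm.sign τ : ℤˣ) : ℤ) : MvPolynomial σ B)).IsHomogeneous 0 := by
    have : ((((Equiv.Perm.sign τ : ℤˣ) : ℤ) : MvPolynomial σ B)) =
      MvPolynomial.C (((Equiv.Perm.sign τ : ℤˣ) : ℤ) : B) := by simp
    rw [this]; exact MvPolynomial.isHomogeneous_C _ _
  simpa using h2.mul h

theorem c1_central {F Z D : Type} [Field F] [Field Z] [DivisionRing D] [Algebra F Z] [Algebra Z D]
    [Algebra F D] [IsScalarTower F Z D] [Module.Finite F D] [Module.Finite F Z] [Module.Finite Z D]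
    [Algebra.IsCentral Z D] (hC1 : IsC1Field F) (a b : D) : a * b = b * a := by
  obtain ⟨L, _, _, _, _, _, hmax, -⟩ := exists_max_field (Z := Z) (1 : D)
  have : Module.Finite Z L := divAlg_finite' Z D L
  have : Module.Finite L D := divAlg_finite Z D L
  have hm1 : Module.finrank L D ≤ 1 := by
    by_contra! hm
    let _ : Algebra F L := ((algebraMap Z L).comp (algebraMap F Z)).toAlgebra
    have : IsScalarTower F Z L := IsScalarTower.of_algebraMap_eq fun _ => rfl
    have : IsScalarTower F L D := ⟨fun f l d => by
      rw [← algebraMap_smul Z f (l • d), ← smul_assoc, algebraMap_smul]⟩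
    have hfin : Module.finrank F D = Module.finrank F Z * Module.finrank L D * Module.finrank L D := by
      rw [← Module.finrank_mul_finrank F Z D, ← Module.finrank_mul_finrank Z L D,
        (divAlg_theta (Z := Z) L hmax).1, mul_assoc]
    let v := Module.finBasis F D
    let bL := Module.finBasis L D
    let bz := Module.finBasis F Z
    obtain ⟨lam, hlam⟩ := (Algebra.linearMap Z L).exists_leftInverse_of_injective
      (LinearMap.ker_eq_bot.mpr (algebraMap Z L).injective)
    have hlam' : ∀ z, lam (algebraMap Z L z) = z := fun z => LinearMap.congr_fun hlam z
    let m := Module.finrank L D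
    let k := Module.finrank F Z
    let n := Module.finrank F D
    let Mv : Fin n → Matrix (Fin m) (Fin m) L := fun i =>
      LinearMap.toMatrix bL bL (LinearMap.mulRight L (v i))
    let PM : Matrix (Fin m) (Fin m) (MvPolynomial (Fin n) L) := Matrix.of fun r s =>
      ∑ i, MvPolynomial.X i * MvPolynomial.C (Mv i r s)
    have hPM : ∀ r s, (PM r s).IsHomogeneous 1 := fun r s => by
      refine MvPolynomial.IsHomogeneous.sum Finset.univ
        (fun i : Fin n => (MvPolynomial.X i * MvPolynomial.C (Mv i r s) : MvPolynomial (Fin n) L)) 1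
        fun i _ => ?_
      have h := (MvPolynomial.isHomogeneous_X (R := L) i).mul
        (MvPolynomial.isHomogeneous_C (Fin n) (Mv i r s))
      simpa using h
    let p := PM.det
    have hp : p.IsHomogeneous m := by simpa using det_isHomogeneous PM hPM
    let ψ : Fin k → Fin k → (L →ₗ[F] F) := fun r s =>
      (Matrix.entryLinearMap F F r s) ∘ₗ (Algebra.leftMulMatrix bz).toLinearMap ∘ₗ
        (lam.restrictScalars F)
    let Q : Matrix (Fin k) (Fin k) (MvPolynomial (Fin n) F) := Matrix.of fun r s =>
      polyMapCoeff (ψ r s) p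
    have hQ : Q.det.IsHomogeneous (k * m) := det_isHomogeneous Q fun r s =>
      polyMapCoeff_isHomogeneous _ _ _ hp
    have hk : 0 < k := Module.finrank_pos
    have hlt : k * m < n := by
      change _ < Module.finrank F D
      rw [hfin]
      exact lt_mul_of_one_lt_right (Nat.mul_pos hk (by omega)) hm
    obtain ⟨x, hx0, hx⟩ := hC1 n (k * m) Q.det hQ (Nat.mul_pos hk (by omega)) hlt
    let y : D := ∑ i, x i • v i
    have hevp : MvPolynomial.eval (fun i => algebraMap F L (x i)) p =
        LinearMap.det (LinearMap.mulRight L y) := by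
      rw [← LinearMap.det_toMatrix bL, RingHom.map_det]
      congr 1
      ext r s
      have : LinearMap.mulRight L y = ∑ i, algebraMap F L (x i) • LinearMap.mulRight L (v i) := by
        ext d
        simp [y, Finset.mul_sum]
      rw [this]
      have h2 : ∀ c, LinearMap.toMatrix bL bL (algebraMap F L (x c) • LinearMap.mulRight L (v c)) =
          algebraMap F L (x c) • LinearMap.toMatrix bL bL (LinearMap.mulRight L (v c)) :=
        fun c => map_smul _ _ _
      simp only [map_sum, h2, Matrix.sum_apply, Matrix.smul_apply, smul_eq_mul]
      simp [PM, Mv]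
    obtain ⟨z, hz⟩ := divAlg_det (Z := Z) L hmax y
    have hevq : MvPolynomial.eval x Q.det = Algebra.norm F z := by
      rw [Algebra.norm_eq_matrix_det bz, RingHom.map_det]
      congr 1
      ext r s
      simp only [Q, RingHom.mapMatrix_apply, Matrix.map_apply, Matrix.of_apply]
      rw [eval_polyMapCoeff, hevp, hz]
      simp [ψ, hlam', Matrix.entryLinearMap]
      rfl
    rw [hx] at hevq
    have hz0 : z = 0 := Algebra.norm_eq_zero_iff.mp hevq.symm
    rw [hz0, map_zero] at hz
    have hy : y = 0 := by
      by_contra hy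
      have : IsUnit (LinearMap.mulRight L y) := by
        refine ⟨⟨LinearMap.mulRight L y, LinearMap.mulRight L y⁻¹, ?_, ?_⟩, rfl⟩ <;>
        · ext d; simp [hy]
      exact (this.map LinearMap.det).ne_zero hz
    apply hx0
    funext i
    exact Fintype.linearIndependent_iff.mp v.linearIndependent x hy i
  have h1 : ∀ d : D, ∃ l : L, l • (1:D) = d := by
    intro d
    exact (finrank_eq_one_iff_of_nonzero' (1:D) one_ne_zero).mp
      (le_antisymm hm1 Module.finrank_pos) d
  obtain ⟨l, rfl⟩ := h1 a
  obtain ⟨l', rfl⟩ := h1 b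
  rw [smul_mul_assoc, smul_mul_assoc, one_mul, one_mul, smul_comm]

theorem c1_division_comm {F D : Type} [Field F] [DivisionRing D]
    [Algebra F D] [Module.Finite F D] (hC1 : IsC1Field F) (a b : D) : a * b = b * a := by
  let Z := Subalgebra.center F D
  have hf : IsField Z :=
    { exists_pair_ne := ⟨0, 1, zero_ne_one⟩
      mul_comm := fun a b => mul_comm a b
      mul_inv_cancel := by
        intro a ha
        have ha' : (a : D) ≠ 0 := fun h => ha (Subtype.ext h)
        have h2 : (a : D)⁻¹ ∈ Z := by
          rw [Subalgebra.mem_center_iff]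
          exact fun b => Set.inv_mem_center a.2 |>.comm b |>.symm
        exact ⟨⟨(a:D)⁻¹, h2⟩, Subtype.ext (mul_inv_cancel₀ ha')⟩ }
  let iF : Field Z := hf.toField
  let iA : Algebra Z D := RingHom.toAlgebra' (Z.val.toRingHom : Z →+* D) (fun c x => by
    have := Subalgebra.mem_center_iff.mp c.2 x
    exact this.symm)
  have : IsScalarTower F Z D := IsScalarTower.of_algebraMap_eq fun x => rfl
  have : Module.Finite Z D := Module.Finite.of_restrictScalars_finite F Z D
  have : Algebra.IsCentral Z D := ⟨fun x hx => by
    rw [Subalgebra.mem_center_iff] at hx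
    have : x ∈ Z := by rw [Subalgebra.mem_center_iff]; exact hx
    exact Algebra.mem_bot.mpr ⟨⟨x, this⟩, rfl⟩⟩
  exact @c1_central F Z D _ iF _ Z.algebra iA _ ‹_› _ (inferInstanceAs (Module.Finite F Z.toSubmodule)) ‹_› ‹_› hC1 a b

theorem isBaseChange_of_decomp {R S M ι : Type} [CommRing R] [CommRing S] [Algebra R S]
    [AddCommGroup M] [Module R M] [Module S M] [IsScalarTower R S M] [Fintype ι]
    (N : Submodule R M) (g : ι → S) (hg : Submodule.span R (Set.range g) = ⊤)
    (h1 : ∀ m : M, ∃ w : ι → N, m = ∑ i, g i • (w i : M))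
    (h2 : ∀ w : ι → N, ∑ i, g i • (w i : M) = 0 → w = 0) : IsBaseChange S N.subtype := by
  have key : ∀ z : S ⊗[R] N, ∃ w : ι → N, z = ∑ i, g i ⊗ₜ w i := by
    intro z
    induction z with
    | zero => exact ⟨0, by simp⟩
    | add x y hx hy =>
      obtain ⟨w, rfl⟩ := hx
      obtain ⟨w', rfl⟩ := hy
      exact ⟨w + w', by simp [TensorProduct.tmul_add, Finset.sum_add_distrib]⟩
    | tmul s n =>
      have hs : s ∈ Submodule.span R (Set.range g) := by rw [hg]; trivial
      obtain ⟨c, rfl⟩ := (Submodule.mem_span_range_iff_exists_fun R).mp hs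
      exact ⟨fun i => c i • n, by
        simp [TensorProduct.sum_tmul, TensorProduct.smul_tmul]⟩
  refine IsBaseChange.of_equiv (LinearEquiv.ofBijective
    (TensorProduct.AlgebraTensorModule.lift
      ((LinearMap.mk₂' S R (fun (s : S) (n : N) => s • (n : M))
          (by intros; rw [add_smul]) (by intros; rw [smul_assoc])
          (by intros; simp) (by
            intro c m n
            rw [Submodule.coe_smul, ← algebraMap_smul S c, smul_comm, algebraMap_smul])))) ⟨?_, ?_⟩) ?_
  · rw [injective_iff_map_eq_zero]
    intro z hz
    obtain ⟨w, rfl⟩ := key z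
    have := h2 w (by simpa using hz)
    simp [this]
  · intro m
    obtain ⟨w, rfl⟩ := h1 m
    exact ⟨∑ i, g i ⊗ₜ w i, by simp⟩
  · intro n
    change (1 : S) • (n : M) = n
    rw [one_smul]

theorem free_of_two {T T1 T2 V V1 V2 : Type} [CommRing T] [CommRing T1] [CommRing T2]
    [Algebra T1 T] [Algebra T2 T] [AddCommGroup V] [AddCommGroup V1] [AddCommGroup V2]
    [Module T V] [Module T1 V] [Module T2 V] [IsScalarTower T1 T V] [IsScalarTower T2 T V]
    [Module T1 V1] [Module T2 V2] [IsSemisimpleRing T] [IsSemisimpleRing T1] [IsSemisimpleRing T2]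
    [Module.Finite T V] [Module.Finite T1 V1] [Module.Finite T2 V2]
    (f1 : V1 →ₗ[T1] V) (f2 : V2 →ₗ[T2] V) (h1 : IsBaseChange T f1) (h2 : IsBaseChange T f2)
    (he : ∀ (a : T1) (b : T2), algebraMap T1 T a = algebraMap T2 T b →
      IsIdempotentElem (algebraMap T1 T a) → algebraMap T1 T a = 0 ∨ algebraMap T1 T a = 1) :
    Module.Free T V := by
  have := Module.projective_of_isSemisimpleRing T V
  have := Module.projective_of_isSemisimpleRing T1 V1
  have := Module.projective_of_isSemisimpleRing T2 V2
  rcases subsingleton_or_nontrivial T with hT | hT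
  · have : Subsingleton V := Module.subsingleton T V
    infer_instance
  have := Module.finitePresentation_of_finite T1 V1
  have := Module.finitePresentation_of_finite T2 V2
  obtain ⟨p0⟩ : Nonempty (PrimeSpectrum T) := inferInstance
  let n := Module.rankAtStalk V p0
  have c1 : IsClopen ((Module.rankAtStalk (R := T1) V1) ⁻¹' {n}) :=
    (Module.isLocallyConstant_rankAtStalk (R := T1) (M := V1)).isClopen_fiber n
  have c2 : IsClopen ((Module.rankAtStalk (R := T2) V2) ⁻¹' {n}) :=
    (Module.isLocallyConstant_rankAtStalk (R := T2) (M := V2)).isClopen_fiber n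
  obtain ⟨a, ha, hae⟩ := PrimeSpectrum.isClopen_iff.mp c1
  obtain ⟨b, hb, hbe⟩ := PrimeSpectrum.isClopen_iff.mp c2
  have m1 : ∀ p : PrimeSpectrum T, Module.rankAtStalk V p = n ↔
      p ∈ PrimeSpectrum.basicOpen (algebraMap T1 T a) := by
    intro p
    rw [Module.rankAtStalk_isBaseChange h1 p]
    exact Set.ext_iff.mp hae (p.comap (algebraMap T1 T))
  have m2 : ∀ p : PrimeSpectrum T, Module.rankAtStalk V p = n ↔
      p ∈ PrimeSpectrum.basicOpen (algebraMap T2 T b) := by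
    intro p
    rw [Module.rankAtStalk_isBaseChange h2 p]
    exact Set.ext_iff.mp hbe (p.comap (algebraMap T2 T))
  have ha' : IsIdempotentElem (algebraMap T1 T a) := ha.map _
  have hb' : IsIdempotentElem (algebraMap T2 T b) := hb.map _
  have hab : algebraMap T1 T a = algebraMap T2 T b :=
    PrimeSpectrum.basicOpen_injOn_isIdempotentElem ha' hb' (by
      ext p; exact (m1 p).symm.trans (m2 p))
  have hall : ∀ p : PrimeSpectrum T, Module.rankAtStalk V p = n := by
    rcases he a b hab ha' with h | h
    · have := (m1 p0).mp rfl
      rw [h] at this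
      simp at this
    · intro p
      rw [m1, h]
      simp
  have : IsArtinianRing T := inferInstance
  refine Module.free_of_flat_of_finrank_eq T V n fun P => ?_
  let _ : Field (T ⧸ P.1) := Ideal.Quotient.field P.1
  have h3 : Module.rankAtStalk ((T ⧸ P.1) ⊗[T] V) (⊥ : PrimeSpectrum (T ⧸ P.1)) = n := by
    rw [Module.rankAtStalk_baseChange, hall]
  have h4 := Module.rankAtStalk_eq_finrank_of_free (R := T ⧸ P.1) (M := (T ⧸ P.1) ⊗[T] V)
  rw [h4] at h3
  exact h3

/-- A system of matrix units extending the action of `K`, relative to a basis of `K / E`. -/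
def HasUnits {E K I R : Type} [Field E] [Field K] [Algebra E K] [Fintype I] [DecidableEq I]
    [Ring R] (g : Module.Basis I E K) (ι : K →+* R) : Prop :=
  ∃ s : I → R, (∀ i j l, s i * ι (g j) * s l = if i = j then s l else 0) ∧
    ∑ i, ι (g i) * s i = 1 ∧
    ∀ (x : E) (l : I), s l * ι (algebraMap E K x) = ι (algebraMap E K x) * s l

theorem HasUnits.map {E K I R S : Type} [Field E] [Field K] [Algebra E K] [Fintype I]
    [DecidableEq I] [Ring R] [Ring S] {g : Module.Basis I E K} {ι : K →+* R} (h : HasUnits g ι)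
    (f : R →+* S) : HasUnits g (f.comp ι) := by
  obtain ⟨s, h1, h2, h3⟩ := h
  refine ⟨fun i => f (s i), fun i j l => ?_, ?_, fun x l => ?_⟩
  · have := congrArg f (h1 i j l)
    simp only [map_mul] at this
    simp only [RingHom.comp_apply, this]
    split_ifs <;> simp
  · have := congrArg f h2
    simpa using this
  · have := congrArg f (h3 x l)
    simpa using this

theorem exists_basis_one (E K : Type) [Field E] [Field K] [Algebra E K] [FiniteDimensional E K] :
    ∃ (I : Type) (_ : Fintype I) (_ : DecidableEq I) (g : Module.Basis I E K) (i0 : I),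
      g i0 = 1 := by
  classical
  have hli : LinearIndepOn E (id : K → K) {(1 : K)} := LinearIndepOn.singleton one_ne_zero
  let b := Module.Basis.extend hli
  have : Fintype (hli.extend (Set.subset_univ {(1:K)})) := FiniteDimensional.fintypeBasisIndex b
  refine ⟨_, this, inferInstance, b, ⟨1, ?_⟩, ?_⟩
  · exact hli.subset_extend _ rfl
  · simp [b]

theorem tensor_semisimple (E D L : Type) [Field E] [Field D] [Field L] [Algebra E D] [Algebra E L]
    [FiniteDimensional E L] [Algebra.IsSeparable E L] : IsSemisimpleRing (D ⊗[E] L) := by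
  have : Algebra.FormallyUnramified E L := Algebra.FormallyUnramified.of_isSeparable E L
  have : IsReduced (D ⊗[E] L) := Algebra.FormallyUnramified.isReduced_of_field D _
  have : IsArtinianRing (D ⊗[E] L) := IsArtinianRing.of_finite D _
  exact IsArtinianRing.isSemisimpleRing_of_isReduced _

theorem tensor_inter (E D K : Type) [Field E] [Field D] [Field K] [Algebra E D] [Algebra E K]
    (E1 E2 : IntermediateField E K) (h : E1 ⊓ E2 = ⊥)
    (a : D ⊗[E] E1) (b : D ⊗[E] E2)
    (hab : Algebra.TensorProduct.map (AlgHom.id D D) E1.val a =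
      Algebra.TensorProduct.map (AlgHom.id D D) E2.val b) :
    ∃ d : D, Algebra.TensorProduct.map (AlgHom.id D D) E1.val a = d ⊗ₜ 1 := by
  classical
  let bD := Module.Basis.ofVectorSpace E D
  have key : ∀ (L : IntermediateField E K) (a : D ⊗[E] L) i,
      TensorProduct.equivFinsuppOfBasisLeft bD (Algebra.TensorProduct.map (AlgHom.id D D) L.val a) i =
      ((TensorProduct.equivFinsuppOfBasisLeft bD a i : L) : K) := by
    intro L a i
    induction a with
    | zero => simp
    | add x y hx hy => simp [hx, hy]
    | tmul x y => simp
  have h3 : ∀ i, ∃ c : E, algebraMap E K c = TensorProduct.equivFinsuppOfBasisLeft bD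
      (Algebra.TensorProduct.map (AlgHom.id D D) E1.val a) i := by
    intro i
    have m1 := key E1 a i
    have m2 := key E2 b i
    rw [← hab] at m2
    have : (TensorProduct.equivFinsuppOfBasisLeft bD
      (Algebra.TensorProduct.map (AlgHom.id D D) E1.val a) i) ∈ E1 ⊓ E2 :=
      ⟨by rw [m1]; exact SetLike.coe_mem _, by rw [m2]; exact SetLike.coe_mem _⟩
    rw [h] at this
    exact IntermediateField.mem_bot.mp this
  choose c hc using h3
  generalize Algebra.TensorProduct.map (AlgHom.id D D) E1.val a = t at *
  refine ⟨∑ i ∈ (TensorProduct.equivFinsuppOfBasisLeft bD t).support, c i • bD i, ?_⟩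
  have h4 := (TensorProduct.equivFinsuppOfBasisLeft bD).symm_apply_apply t
  rw [TensorProduct.equivFinsuppOfBasisLeft_symm_apply] at h4
  conv_lhs => rw [← h4]
  rw [TensorProduct.sum_tmul, Finsupp.sum]
  refine Finset.sum_congr rfl fun i _ => ?_
  rw [TensorProduct.smul_tmul, ← hc, Algebra.algebraMap_eq_smul_one]

theorem free_sub {E D K V I T T1 : Type} [Field E] [Field D] [Field K] [Algebra E D] [Algebra E K]
    [FiniteDimensional E K] [CommRing T] [CommRing T1] [IsNoetherianRing T1]
    [AddCommGroup V] [Module D V] [Module.Finite D V] [Module T V]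
    (φ : D ⊗[E] K →+* T) (hφ : Function.Surjective φ)
    (ι : K →+* Module.End D V) (hT : ∀ d k (v : V), φ (d ⊗ₜ k) • v = d • ι k v)
    (E1 : IntermediateField E K) (φ1 : D ⊗[E] E1 →+* T1) (hφ1 : Function.Surjective φ1)
    [Algebra T1 T] [Module T1 V]
    [IsScalarTower T1 T V]
    (hA : ∀ x : D ⊗[E] E1, algebraMap T1 T (φ1 x) =
      φ (Algebra.TensorProduct.map (AlgHom.id D D) E1.val x))
    [Fintype I] [DecidableEq I] (g : Module.Basis I E1 K) (i0 : I) (hi0 : g i0 = 1)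
    (hu : HasUnits g ι) :
    ∃ N : Submodule T1 V, IsBaseChange T N.subtype ∧ Module.Finite T1 N := by
  obtain ⟨s, h1, h2, h3⟩ := hu
  have hT1 : ∀ d (k : E1) (v : V), φ1 (d ⊗ₜ k : D ⊗[E] E1) • v = d • ι (k : K) v := by
    intro d k v
    rw [← algebraMap_smul T (φ1 (d ⊗ₜ k : D ⊗[E] E1)) v, hA]
    simp [hT]
  have hsl : ∀ l, s i0 * s l = s l := by
    intro l
    have := h1 i0 i0 l
    rwa [hi0, map_one, mul_one, if_pos rfl] at this
  let N : Submodule T1 V :=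
    { carrier := {v | s i0 v = v}
      add_mem' := by
        intro a b ha hb
        simp only [Set.mem_ofPred_eq] at *
        rw [map_add, ha, hb]
      zero_mem' := by simp
      smul_mem' := by
        intro c x hx
        simp only [Set.mem_ofPred_eq] at *
        obtain ⟨c, rfl⟩ := hφ1 c
        induction c with
        | zero => simp
        | add a b ha hb => rw [map_add, add_smul, map_add, ha, hb]
        | tmul d k =>
          rw [hT1, map_smul]
          congr 1
          have := LinearMap.congr_fun (h3 k i0) x
          simp only [Module.End.mul_apply, hx] at this
          exact this }
  have hN : ∀ v, v ∈ N ↔ s i0 v = v := fun v => Iff.rfl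
  refine ⟨N, ?_, ?_⟩
  · refine isBaseChange_of_decomp N (fun i => φ ((1 : D) ⊗ₜ g i)) ?_ ?_ ?_
    · rw [eq_top_iff]
      rintro t -
      obtain ⟨t, rfl⟩ := hφ t
      induction t with
      | zero => rw [map_zero]; exact zero_mem _
      | add a b ha hb => rw [map_add]; exact add_mem ha hb
      | tmul d k =>
        rw [← g.sum_repr k, TensorProduct.tmul_sum, map_sum]
        refine sum_mem fun i _ => ?_
        have : φ (d ⊗ₜ[E] (g.repr k i • g i)) =
            (φ1 (d ⊗ₜ[E] (g.repr k i))) • φ ((1 : D) ⊗ₜ[E] g i) := by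
          rw [Algebra.smul_def (A := T), hA, ← map_mul]
          simp [Algebra.smul_def]
        rw [this]
        exact Submodule.smul_mem _ _ (Submodule.subset_span ⟨i, rfl⟩)
    · intro v
      refine ⟨fun i => ⟨s i v, ?_⟩, ?_⟩
      · rw [hN, ← Module.End.mul_apply, hsl]
      · have := LinearMap.congr_fun h2 v
        simp only [LinearMap.sum_apply, Module.End.mul_apply, Module.End.one_apply] at this
        simp [hT, this]
    · intro w hw
      funext i
      apply Subtype.ext
      have h5 := congrArg (s i) hw
      simp only [hT, one_smul, map_sum, map_zero] at h5
      have h6 : ∀ j, s i (ι (g j) (w j)) = if i = j then (w j : V) else 0 := by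
        intro j
        have h7 := LinearMap.congr_fun (h1 i j i0) (w j)
        have h8 : s i0 (w j) = w j := (w j).2
        simp only [Module.End.mul_apply, h8] at h7
        rw [h7]
        split_ifs
        · exact h8
        · rfl
      simpa [h6] using h5
  · let ψ := φ1.comp (Algebra.TensorProduct.includeLeftRingHom (R := E) (A := D) (B := E1))
    let _ : Algebra D T1 := ψ.toAlgebra
    have hD : ∀ (d : D) (v : V), algebraMap D T1 d • v = d • v := by
      intro d v
      change φ1 (d ⊗ₜ 1) • v = _
      rw [hT1]; simp
    have : IsScalarTower D T1 V := IsScalarTower.of_algebraMap_smul hD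
    have : Module.Finite T1 V := Module.Finite.of_restrictScalars_finite D _ V
    infer_instance

theorem tensor_copy (E D L : Type) [Field E] [Field D] [Field L] [Algebra E D] [Algebra E L]
    [FiniteDimensional E L] [Algebra.IsSeparable E L] :
    ∃ (T : Type) (_ : CommRing T) (_ : Algebra D T) (_ : D ⊗[E] L ≃ₐ[D] T), IsSemisimpleRing T :=
  ⟨D ⊗[E] L, inferInstance, inferInstance, AlgEquiv.refl, tensor_semisimple E D L⟩

theorem hasUnits_inf {E D K V I1 I2 I : Type} [Field E] [Field D] [Field K] [Algebra E D]
    [Algebra E K] [FiniteDimensional E K] [Algebra.IsSeparable E K]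
    [AddCommGroup V] [Module D V] [Module.Finite D V]
    (ι : K →+* Module.End D V)
    (hι : ∀ (x : E) (v : V), ι (algebraMap E K x) v = algebraMap E D x • v)
    (E1 E2 : IntermediateField E K) (hE : E1 ⊓ E2 = ⊥)
    [Fintype I1] [DecidableEq I1] (g1 : Module.Basis I1 E1 K) (i1 : I1) (hi1 : g1 i1 = 1)
    [Fintype I2] [DecidableEq I2] (g2 : Module.Basis I2 E2 K) (i2 : I2) (hi2 : g2 i2 = 1)
    [Fintype I] [DecidableEq I] (g : Module.Basis I E K)
    (hu1 : HasUnits g1 ι) (hu2 : HasUnits g2 ι) : HasUnits g ι := by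
  let _ : Module K V := Module.compHom V ι
  let _ : Module E V := Module.compHom V (algebraMap E D)
  have hK : ∀ (k : K) (v : V), k • v = ι k v := fun _ _ => rfl
  have hEv : ∀ (k : E) (v : V), k • v = algebraMap E D k • v := fun _ _ => rfl
  have : IsScalarTower E D V := IsScalarTower.of_algebraMap_smul fun _ _ => rfl
  have : IsScalarTower E K V := IsScalarTower.of_algebraMap_smul fun x v => by
    rw [hK, hι, hEv]
  have : SMulCommClass D K V := ⟨fun d k v => by rw [hK, hK, map_smul]⟩
  obtain ⟨T, _, _, φ, _⟩ := tensor_copy E D K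
  obtain ⟨T1, _, _, φ1, _⟩ := tensor_copy E D E1
  obtain ⟨T2, _, _, φ2, _⟩ := tensor_copy E D E2
  let _ : Module T V := @Module.compHom _ _ V _ _ TensorProduct.Algebra.module _
    (φ.symm : T →+* D ⊗[E] K)
  have hT' : ∀ (x : D ⊗[E] K) (v : V), φ x • v = TensorProduct.Algebra.moduleAux x v := by
    intro x v
    change TensorProduct.Algebra.moduleAux (φ.symm (φ x)) v = _
    rw [AlgEquiv.symm_apply_apply]
  have hT : ∀ d k (v : V), φ (d ⊗ₜ k : D ⊗[E] K) • v = d • ι k v := by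
    intro d k v
    rw [hT']
    rfl
  let f1 := ((φ : D ⊗[E] K →ₐ[D] T).comp
    (Algebra.TensorProduct.map (AlgHom.id D D) E1.val)).comp (φ1.symm : T1 →ₐ[D] D ⊗[E] E1)
  let f2 := ((φ : D ⊗[E] K →ₐ[D] T).comp
    (Algebra.TensorProduct.map (AlgHom.id D D) E2.val)).comp (φ2.symm : T2 →ₐ[D] D ⊗[E] E2)
  let _ : Algebra T1 T := f1.toRingHom.toAlgebra
  let _ : Algebra T2 T := f2.toRingHom.toAlgebra
  have hA1 : ∀ x, algebraMap T1 T (φ1 x) =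
      φ (Algebra.TensorProduct.map (AlgHom.id D D) E1.val x) := by
    intro x
    change φ (Algebra.TensorProduct.map (AlgHom.id D D) E1.val (φ1.symm (φ1 x))) = _
    rw [AlgEquiv.symm_apply_apply]
  have hA2 : ∀ x, algebraMap T2 T (φ2 x) =
      φ (Algebra.TensorProduct.map (AlgHom.id D D) E2.val x) := by
    intro x
    change φ (Algebra.TensorProduct.map (AlgHom.id D D) E2.val (φ2.symm (φ2 x))) = _
    rw [AlgEquiv.symm_apply_apply]
  let _ : Module T1 V := Module.compHom V (algebraMap T1 T)
  let _ : Module T2 V := Module.compHom V (algebraMap T2 T)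
  have : IsScalarTower T1 T V := IsScalarTower.of_algebraMap_smul fun _ _ => rfl
  have : IsScalarTower T2 T V := IsScalarTower.of_algebraMap_smul fun _ _ => rfl
  obtain ⟨N1, hN1, _⟩ := free_sub (φ : D ⊗[E] K →+* T) φ.surjective ι hT E1
    (φ1 : D ⊗[E] E1 →+* T1) φ1.surjective hA1 g1 i1 hi1 hu1
  obtain ⟨N2, hN2, _⟩ := free_sub (φ : D ⊗[E] K →+* T) φ.surjective ι hT E2
    (φ2 : D ⊗[E] E2 →+* T2) φ2.surjective hA2 g2 i2 hi2 hu2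
  have hsc : IsScalarTower D T V := IsScalarTower.of_algebraMap_smul fun d v => by
    rw [← φ.commutes d]
    have : algebraMap D (D ⊗[E] K) d = d ⊗ₜ 1 := rfl
    rw [this, hT]
    simp
  have : Module.Finite T V := Module.Finite.of_restrictScalars_finite D _ V
  have hfree : Module.Free T V := by
    refine free_of_two N1.subtype N2.subtype hN1 hN2 ?_
    intro a b hab hid
    obtain ⟨a, rfl⟩ := φ1.surjective a
    obtain ⟨b, rfl⟩ := φ2.surjective b
    rw [hA1, hA2] at hab
    obtain ⟨d, hd⟩ := tensor_inter E D K E1 E2 hE a b (φ.injective hab)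
    have hd' : algebraMap T1 T (φ1 a) = algebraMap D T d := by
      rw [hA1, hd, ← φ.commutes d]
      rfl
    rw [hd'] at hid ⊢
    have : Nontrivial T := φ.injective.nontrivial
    have h5 : algebraMap D T (d * d) = algebraMap D T d := by
      rw [map_mul]; exact hid
    have h6 := (algebraMap D T).injective h5
    rcases (IsIdempotentElem.iff_eq_zero_or_one (p := d)).mp h6 with rfl | rfl
    · left; exact map_zero _
    · right; exact map_one _
  let c := Module.Free.chooseBasis T V
  let bT : Module.Basis I D T := (g.baseChange D).map φ.toLinearEquiv
  let B := bT.smulTower c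
  have hB : ∀ i k, B (i, k) = ι (g i) (c k) := by
    intro i k
    simp only [B, Module.Basis.smulTower_apply, bT, Module.Basis.map_apply,
      Module.Basis.baseChange_apply, AlgEquiv.toLinearEquiv_apply, hT, one_smul]
  let s : I → Module.End D V := fun i => B.constr D fun p => if i = p.1 then c p.2 else 0
  have hs : ∀ i j k, s i (ι (g j) (c k)) = if i = j then c k else 0 := by
    intro i j k
    rw [← hB]
    exact B.constr_basis D _ (j, k)
  refine ⟨s, ?_, ?_, ?_⟩
  · intro i j l
    refine B.ext fun ⟨a, k⟩ => ?_
    rw [hB, Module.End.mul_apply, Module.End.mul_apply, hs]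
    by_cases h1 : l = a
    · rw [if_pos h1, hs]
      by_cases h2 : i = j
      · rw [if_pos h2, if_pos h2, hs, if_pos h1]
      · rw [if_neg h2, if_neg h2]
        rfl
    · rw [if_neg h1, map_zero, map_zero]
      by_cases h2 : i = j
      · rw [if_pos h2, hs, if_neg h1]
      · rw [if_neg h2]
        rfl
  · refine B.ext fun ⟨a, k⟩ => ?_
    rw [hB, LinearMap.sum_apply, Finset.sum_eq_single a]
    · rw [Module.End.mul_apply, hs, if_pos rfl, Module.End.one_apply]
    · intro b _ hb
      rw [Module.End.mul_apply, hs, if_neg hb, map_zero]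
    · simp
  · intro x l
    ext v
    simp [hι]

theorem hasUnits_matrix_field {E D K I1 I2 I : Type} {d : ℕ} [Field E] [Field D] [Field K]
    [Algebra E D]
    [Algebra E K] [FiniteDimensional E K] [Algebra.IsSeparable E K]
    (ι : K →+* Matrix (Fin d) (Fin d) D)
    (hι : ∀ (x : E), ι (algebraMap E K x) = algebraMap E (Matrix (Fin d) (Fin d) D) x)
    (E1 E2 : IntermediateField E K) (hE : E1 ⊓ E2 = ⊥)
    [Fintype I1] [DecidableEq I1] (g1 : Module.Basis I1 E1 K) (i1 : I1) (hi1 : g1 i1 = 1)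
    [Fintype I2] [DecidableEq I2] (g2 : Module.Basis I2 E2 K) (i2 : I2) (hi2 : g2 i2 = 1)
    [Fintype I] [DecidableEq I] (g : Module.Basis I E K)
    (hu1 : HasUnits g1 ι) (hu2 : HasUnits g2 ι) : HasUnits g ι := by
  let e : Matrix (Fin d) (Fin d) D ≃ₐ[D] Module.End D (Fin d → D) := Matrix.toLinAlgEquiv'
  have h := hasUnits_inf ((e : Matrix (Fin d) (Fin d) D →+* Module.End D (Fin d → D)).comp ι)
    (fun x v => by
      have : algebraMap E (Matrix (Fin d) (Fin d) D) x =
        algebraMap D (Matrix (Fin d) (Fin d) D) (algebraMap E D x) := rfl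
      change e (ι (algebraMap E K x)) v = _
      rw [hι, this, AlgEquiv.commutes]
      rfl) E1 E2 hE g1 i1 hi1 g2 i2 hi2 g (hu1.map _) (hu2.map _)
  have h2 := h.map (e.symm : Module.End D (Fin d → D) →+* Matrix (Fin d) (Fin d) D)
  convert h2 using 1
  ext x : 1
  exact (e.symm_apply_apply (ι x)).symm

theorem hasUnits_matrix {E D K I1 I2 I : Type} {d : ℕ} [Field E] [iD : DivisionRing D] [Field K]
    [iA : Algebra E D] (hcomm : ∀ a b : D, a * b = b * a)
    [Algebra E K] [FiniteDimensional E K] [Algebra.IsSeparable E K]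
    (ι : K →+* Matrix (Fin d) (Fin d) D)
    (hι : ∀ (x : E), ι (algebraMap E K x) = algebraMap E (Matrix (Fin d) (Fin d) D) x)
    (E1 E2 : IntermediateField E K) (hE : E1 ⊓ E2 = ⊥)
    [Fintype I1] [DecidableEq I1] (g1 : Module.Basis I1 E1 K) (i1 : I1) (hi1 : g1 i1 = 1)
    [Fintype I2] [DecidableEq I2] (g2 : Module.Basis I2 E2 K) (i2 : I2) (hi2 : g2 i2 = 1)
    [Fintype I] [DecidableEq I] (g : Module.Basis I E K)
    (hu1 : HasUnits g1 ι) (hu2 : HasUnits g2 ι) : HasUnits g ι := by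
  let iF : Field D := { iD with mul_comm := hcomm }
  exact @hasUnits_matrix_field E D K I1 I2 I d _ iF _ iA _ _ _ ι hι E1 E2 hE _ _ g1 i1 hi1
    _ _ g2 i2 hi2 _ _ g hu1 hu2

theorem HasUnits.of_pi {E K I J : Type} {R : J → Type} [Field E] [Field K] [Algebra E K] [Fintype I]
    [DecidableEq I] [∀ j, Ring (R j)] {g : Module.Basis I E K} (ι : K →+* ∀ j, R j)
    (h : ∀ j, HasUnits g ((Pi.evalRingHom R j).comp ι)) : HasUnits g ι := by
  choose s h1 h2 h3 using h
  refine ⟨fun i j => s j i, ?_, ?_, ?_⟩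
  · intro i k l
    funext j
    have := h1 j i k l
    simp only [RingHom.comp_apply, Pi.evalRingHom_apply] at this
    simp only [Pi.mul_apply, this]
    split_ifs <;> rfl
  · funext j
    have := h2 j
    simp only [RingHom.comp_apply, Pi.evalRingHom_apply] at this
    simp [this]
  · intro x l
    funext j
    exact h3 j x l

theorem hasUnits_semisimple {F E R K I1 I2 I : Type} [Field F] [Field E] [Algebra F E]
    [Module.Finite F E] (hC1 : IsC1Field F)
    [Ring R] [Algebra E R] [Module.Finite E R] [IsSemisimpleRing R]
    [Field K] [Algebra E K] [FiniteDimensional E K] [Algebra.IsSeparable E K]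
    (ι : K →+* R)
    (hι : ∀ (x : E), ι (algebraMap E K x) = algebraMap E R x)
    (E1 E2 : IntermediateField E K) (hE : E1 ⊓ E2 = ⊥)
    [Fintype I1] [DecidableEq I1] (g1 : Module.Basis I1 E1 K) (i1 : I1) (hi1 : g1 i1 = 1)
    [Fintype I2] [DecidableEq I2] (g2 : Module.Basis I2 E2 K) (i2 : I2) (hi2 : g2 i2 = 1)
    [Fintype I] [DecidableEq I] (g : Module.Basis I E K)
    (hu1 : HasUnits g1 ι) (hu2 : HasUnits g2 ι) : HasUnits g ι := by
  obtain ⟨n, D, d, _, _, _, -, ⟨e⟩⟩ := IsSemisimpleRing.exists_algEquiv_pi_matrix_divisionRing_finite E R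
  let ι' := (e : R →+* ∀ i, Matrix (Fin (d i)) (Fin (d i)) (D i)).comp ι
  have h : HasUnits g ι' := by
    refine HasUnits.of_pi ι' fun j => ?_
    refine hasUnits_matrix (iA := inferInstance) ?_ _ ?_ E1 E2 hE g1 i1 hi1 g2 i2 hi2 g
      ((hu1.map _).map _) ((hu2.map _).map _)
    · intro a b
      let _ : Algebra F (D j) := Algebra.compHom (D j) (algebraMap F E)
      have : IsScalarTower F E (D j) := IsScalarTower.of_algebraMap_eq fun _ => rfl
      have : Module.Finite F (D j) := Module.Finite.trans E (D j)
      exact c1_division_comm hC1 a b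
    · intro x
      change e (ι (algebraMap E K x)) j = _
      rw [hι, AlgEquiv.commutes]
      rfl
  have h2 := h.map (e.symm : _ →+* R)
  convert h2 using 1
  ext x : 1
  exact (e.symm_apply_apply (ι x)).symm

theorem lift_form {F E R K W I1 I2 : Type} [Field F] [Field E] [Algebra F E] [Module.Finite F E]
    (hC1 : IsC1Field F) [Ring R] [Algebra E R] [Module.Finite E R]
    [Field K] [Algebra E K] [FiniteDimensional E K] [Algebra.IsSeparable E K]
    [Fintype I1] [DecidableEq I1] [Fintype I2] [DecidableEq I2]
    (ι : K →+* R) (hι : ∀ x : E, ι (algebraMap E K x) = algebraMap E R x)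
    (E1 E2 : IntermediateField E K) (hE : E1 ⊓ E2 = ⊥)
    (g1 : Module.Basis I1 E1 K) (i1 : I1) (hi1 : g1 i1 = 1)
    (g2 : Module.Basis I2 E2 K) (i2 : I2) (hi2 : g2 i2 = 1)
    (hu1 : HasUnits g1 ι) (hu2 : HasUnits g2 ι)
    [AddCommGroup W] [Module E W] [Module K W] [Module R W] [IsScalarTower E K W]
    [IsScalarTower E R W] (hW : ∀ (x : K) (w : W), ι x • w = x • w) :
    ∃ (e : R) (N : Submodule E W), (∀ w, w ∈ N ↔ e • w = w) ∧ IsBaseChange K N.subtype := by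
  have : IsArtinianRing R := IsArtinianRing.of_finite E R
  obtain ⟨I, _, _, g, i0, hg0⟩ := exists_basis_one E K
  let π : R →+* R ⧸ Ring.jacobson R := Ideal.Quotient.mk _
  have hu : HasUnits g (π.comp ι) :=
    hasUnits_semisimple hC1 (π.comp ι) (fun x => by
      simp only [RingHom.comp_apply, hι]; rfl) E1 E2 hE g1 i1 hi1 g2 i2 hi2 g
      (hu1.map π) (hu2.map π)
  obtain ⟨sb, hs1, hs2, -⟩ := hu
  have hker : ∀ x ∈ RingHom.ker π, IsNilpotent x := by
    intro x hx
    have hx' : x ∈ Ring.jacobson R := by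
      simpa [π, RingHom.mem_ker, Ideal.Quotient.eq_zero_iff_mem] using hx
    obtain ⟨n, hn⟩ := IsSemiprimaryRing.isNilpotent (R := R)
    exact ⟨n, by simpa [hn] using Ideal.pow_mem_pow hx' n⟩
  have hsurj : Function.Surjective π := Ideal.Quotient.mk_surjective
  have hee : ∀ l, sb i0 * sb l = sb l := by
    intro l
    have := hs1 i0 i0 l
    simpa [hg0] using this
  obtain ⟨e, he, hpe⟩ := exists_isIdempotentElem_eq_of_ker_isNilpotent π hker (sb i0)
    (hsurj _) (hee i0)
  choose s hs using fun i => hsurj (sb i)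
  have hmem : ∀ x y : R, π x = π y → x - y ∈ Ring.jacobson R := fun x y h =>
    Ideal.Quotient.eq.mp h
  have hunit : IsUnit (∑ i, ι (g i) * e * s i) := by
    have h1 : π (∑ i, ι (g i) * e * s i) = π 1 := by
      rw [map_sum, map_one, ← hs2]
      refine Finset.sum_congr rfl fun i _ => ?_
      rw [map_mul, map_mul, hpe, hs, mul_assoc, hee]; rfl
    have h2 : IsNilpotent (1 - ∑ i, ι (g i) * e * s i) := hker _ (by
      rw [RingHom.mem_ker, map_sub, h1, sub_self])
    simpa using h2.isUnit_one_sub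
  have hkey : ∀ i j, e * s i * ι (g j) * e - (if i = j then e else 0) ∈ Ring.jacobson R := by
    intro i j
    apply hmem
    rw [map_mul, map_mul, map_mul, hpe, hs, hee, ← RingHom.comp_apply, hs1]
    split_ifs <;> simp [hpe]
  let N : Submodule E W :=
    { carrier := {w | e • w = w}
      add_mem' := fun {a b} ha hb => by
        simp only [Set.mem_ofPred_eq] at *
        rw [smul_add, ha, hb]
      zero_mem' := by simp
      smul_mem' := fun c w hw => by
        simp only [Set.mem_ofPred_eq] at *
        rw [← algebraMap_smul R c w, ← mul_smul, ← Algebra.commutes, mul_smul, hw] }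
  refine ⟨e, N, fun w => Iff.rfl, ?_⟩
  refine isBaseChange_of_decomp N g g.span_eq ?_ ?_
  · intro m
    obtain ⟨u, hu⟩ := hunit
    refine ⟨fun i => ⟨e • s i • ((u⁻¹ : Rˣ) : R) • m, ?_⟩, ?_⟩
    · change e • _ = _
      rw [← mul_smul e e, he]
    · calc m = (u : R) • ((u⁻¹ : Rˣ) : R) • m := by rw [← mul_smul, Units.mul_inv, one_smul]
        _ = _ := by
          rw [hu, Finset.sum_smul]
          refine Finset.sum_congr rfl fun i _ => ?_
          rw [← hW, mul_smul, mul_smul]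
  · intro w hw
    have hwN : ∀ i, e • (w i : W) = w i := fun i => (w i).2
    let S : Submodule R W := Submodule.span R (Set.range fun i => (w i : W))
    have hS : S = ⊥ := by
      apply Submodule.FG.eq_bot_of_le_jacobson_smul
        (Submodule.fg_span (Set.finite_range _))
      rw [Submodule.span_le]
      rintro _ ⟨i, rfl⟩
      have h1 : ∑ j, (e * s i * ι (g j) * e) • (w j : W) = 0 := by
        have := congrArg (fun z => (e * s i) • z) hw
        simp only [Finset.smul_sum, smul_zero] at this
        rw [← this]
        refine Finset.sum_congr rfl fun j _ => ?_
        rw [mul_smul _ e, hwN, mul_smul, hW]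
      have h2 : (w i : W) = - ∑ j, (e * s i * ι (g j) * e - (if i = j then e else 0)) • (w j : W) := by
        simp only [sub_smul, Finset.sum_sub_distrib, h1]
        simp [ite_smul, hwN]
      change (w i : W) ∈ _
      rw [h2]
      refine Submodule.neg_mem _ (Submodule.sum_mem _ fun j _ => ?_)
      exact Submodule.smul_mem_smul (hkey i j) (Submodule.subset_span ⟨j, rfl⟩)
    funext i
    have : (w i : W) ∈ S := Submodule.subset_span ⟨i, rfl⟩
    rw [hS] at this
    exact Subtype.ext (by simpa using this)

/-- coordinatewise projection -/
noncomputable def projCoord {E K I : Type} [Field E] [Field K] [Algebra E K] (E1 : IntermediateField E K)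
    (g : Module.Basis I E1 K) (n : ℕ) (i : I) : Module.End E (Fin n → K) where
  toFun w := fun k => algebraMap E1 K (g.repr (w k) i)
  map_add' v w := by
    funext k
    simp
  map_smul' c w := by
    funext k
    have : c • w k = (algebraMap E E1 c) • w k := (algebraMap_smul E1 c (w k)).symm
    simp only [Pi.smul_apply, this, map_smul, RingHom.id_apply, Finsupp.smul_apply, smul_eq_mul,
      map_mul]
    rw [← IsScalarTower.algebraMap_apply, Algebra.smul_def]

theorem projCoord_smul {E K I : Type} [Field E] [Field K] [Algebra E K] (E1 : IntermediateField E K)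
    (g : Module.Basis I E1 K) (n : ℕ) (i : I) (c : E1) (w : Fin n → K) :
    projCoord E1 g n i ((c : K) • w) = (c : K) • projCoord E1 g n i w := by
  funext k
  have : (c : K) * w k = c • w k := rfl
  simp only [projCoord, LinearMap.coe_mk, AddHom.coe_mk, Pi.smul_apply, smul_eq_mul, this,
    map_smul, Finsupp.smul_apply, map_mul]
  rfl

theorem projCoord_mulVec {E K I : Type} [Field E] [Field K] [Algebra E K]
    (E1 : IntermediateField E K)
    (g : Module.Basis I E1 K) (n : ℕ) (i : I) (A : Matrix (Fin n) (Fin n) K)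
    (hA : ∀ i j, A i j ∈ E1) (w : Fin n → K) :
    projCoord E1 g n i (A.mulVec w) = A.mulVec (projCoord E1 g n i w) := by
  funext k
  have : ∀ j, A k j * w j = (⟨A k j, hA k j⟩ : E1) • w j := fun j => rfl
  simp only [projCoord, LinearMap.coe_mk, AddHom.coe_mk, Matrix.mulVec, dotProduct, this,
    map_sum, map_smul, Finsupp.smul_apply, map_mul, Finsupp.finsetSum_apply, smul_eq_mul]
  rfl

theorem projCoord_basis {E K I : Type} [Field E] [Field K] [Algebra E K] [DecidableEq I]
    (E1 : IntermediateField E K)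
    (g : Module.Basis I E1 K) (n : ℕ) (i j l : I) (w : Fin n → K) :
    projCoord E1 g n i (g j • projCoord E1 g n l w)
      = if i = j then projCoord E1 g n l w else 0 := by
  funext k
  have : ∀ c : E1, g j * algebraMap E1 K c = c • g j := fun c => by
    rw [Algebra.smul_def, mul_comm]
  simp only [projCoord, LinearMap.coe_mk, AddHom.coe_mk, Pi.smul_apply, smul_eq_mul, this,
    map_smul, Finsupp.smul_apply, map_mul, Module.Basis.repr_self, Finsupp.single_apply]
  by_cases h : i = j
  · simp [h]
  · simp [h, Ne.symm h]

theorem projCoord_sum {E K I : Type} [Field E] [Field K] [Algebra E K] [Fintype I]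
    (E1 : IntermediateField E K)
    (g : Module.Basis I E1 K) (n : ℕ) (w : Fin n → K) :
    ∑ i, g i • projCoord E1 g n i w = w := by
  funext k
  conv_rhs => rw [← g.sum_repr (w k)]
  simp only [projCoord, LinearMap.coe_mk, AddHom.coe_mk, Finset.sum_apply, Pi.smul_apply,
    smul_eq_mul]
  exact Finset.sum_congr rfl fun i _ => by rw [Algebra.smul_def, mul_comm]

/-- the commuting algebra -/
def commAlg (E : Type) {K A : Type} [Field E] [Field K] [Algebra E K] {n : ℕ}
    (ρ : A → Matrix (Fin n) (Fin n) K) : Subalgebra E (Module.End E (Fin n → K)) :=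
  Subalgebra.centralizer E (Set.range fun a => ((Matrix.mulVecLin (ρ a)).restrictScalars E))

theorem mem_commAlg {E K A : Type} [Field E] [Field K] [Algebra E K] {n : ℕ}
    {ρ : A → Matrix (Fin n) (Fin n) K} {f : Module.End E (Fin n → K)} :
    f ∈ commAlg E ρ ↔ ∀ a w, f ((ρ a).mulVec w) = (ρ a).mulVec (f w) := by
  rw [commAlg, Subalgebra.mem_centralizer_iff]
  constructor
  · intro h a w
    exact (congrArg (fun (z : Module.End E (Fin n → K)) => z w) (h _ ⟨a, rfl⟩)).symm
  · rintro h _ ⟨a, rfl⟩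
    exact LinearMap.ext fun w => (h a w).symm

/-- scalars inside the commuting algebra -/
noncomputable def scalarHom (E : Type) {K A : Type} [Field E] [Field K] [Algebra E K] {n : ℕ}
    (ρ : A → Matrix (Fin n) (Fin n) K) : K →ₐ[E] commAlg E ρ :=
  (Algebra.lsmul E E (Fin n → K) : K →ₐ[E] Module.End E (Fin n → K)).codRestrict _ (by
    intro x
    rw [mem_commAlg]
    intro a w
    simp [Matrix.mulVec_smul])

theorem hasUnits_commAlg {E K A I : Type} [Field E] [Field K] [Algebra E K] {n : ℕ}
    [Fintype I] [DecidableEq I]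
    (ρ : A → Matrix (Fin n) (Fin n) K) (E1 : IntermediateField E K)
    (g : Module.Basis I E1 K) (P P' : Matrix (Fin n) (Fin n) K) (h1 : P * P' = 1)
    (h2 : P' * P = 1) (h : ∀ a i j, (P' * ρ a * P) i j ∈ E1) :
    HasUnits (R := commAlg E ρ) g (scalarHom E ρ : K →+* commAlg E ρ) := by
  let s : I → Module.End E (Fin n → K) := fun i =>
    (P.mulVecLin.restrictScalars E) ∘ₗ projCoord E1 g n i ∘ₗ (P'.mulVecLin.restrictScalars E)
  have sapp : ∀ i w, s i w = P.mulVec (projCoord E1 g n i (P'.mulVec w)) := fun _ _ => rfl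
  have hs : ∀ i, s i ∈ commAlg E ρ := by
    intro i
    rw [mem_commAlg]
    intro a w
    rw [sapp, sapp]
    have e1 : P'.mulVec ((ρ a).mulVec w) = (P' * ρ a * P).mulVec (P'.mulVec w) := by
      simp only [Matrix.mulVec_mulVec, Matrix.mul_assoc, h1, Matrix.mul_one]
    rw [e1, projCoord_mulVec _ _ _ _ _ (h a)]
    simp only [Matrix.mulVec_mulVec, ← Matrix.mul_assoc, h1, Matrix.one_mul]
  have hsc : ∀ (x : K) (w : Fin n → K),
      ((scalarHom E ρ x : commAlg E ρ) : Module.End E (Fin n → K)) w = x • w := fun _ _ => rfl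
  refine ⟨fun i => ⟨s i, hs i⟩, ?_, ?_, ?_⟩
  · intro i j l
    apply Subtype.ext
    refine LinearMap.ext fun w => ?_
    change s i (g j • s l w) = _
    rw [sapp, sapp, Matrix.mulVec_smul, Matrix.mulVec_mulVec _ P' P, h2, Matrix.one_mulVec,
      projCoord_basis]
    split_ifs
    · rfl
    · simp
  · apply Subtype.ext
    refine LinearMap.ext fun w => ?_
    rw [AddSubmonoidClass.coe_finsetSum, LinearMap.sum_apply]
    change ∑ i, g i • s i w = w
    simp only [sapp, ← Matrix.mulVec_smul]
    rw [← Matrix.mulVec_sum, projCoord_sum, Matrix.mulVec_mulVec, h1, Matrix.one_mulVec]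
  · intro x l
    apply Subtype.ext
    refine LinearMap.ext fun w => ?_
    change s l ((x : K) • w) = (x : K) • s l w
    rw [sapp, sapp, Matrix.mulVec_smul, projCoord_smul, Matrix.mulVec_smul]

theorem core0 {F E K A : Type} [Field F] [Field E] [Algebra F E] [Module.Finite F E]
    (hC1 : IsC1Field F) [Field K] [Algebra E K] [FiniteDimensional E K] [Algebra.IsSeparable E K]
    (E1 E2 : IntermediateField E K) (hE : E1 ⊓ E2 = ⊥) {n : ℕ}
    (ρ : A → Matrix (Fin n) (Fin n) K) (h1 : ∀ a i j, ρ a i j ∈ E1)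
    (P P' : Matrix (Fin n) (Fin n) K) (hP : P * P' = 1) (hP' : P' * P = 1)
    (h2 : ∀ a i j, (P' * ρ a * P) i j ∈ E2) :
    ∃ N : Submodule E (Fin n → K), (∀ a w, w ∈ N → (ρ a).mulVec w ∈ N) ∧
      IsBaseChange K N.subtype := by
  obtain ⟨I1, _, _, g1, i1, hi1⟩ := exists_basis_one E1 K
  obtain ⟨I2, _, _, g2, i2, hi2⟩ := exists_basis_one E2 K
  have hu1 := hasUnits_commAlg ρ E1 g1 1 1 (by simp) (by simp) (by simpa using h1)
  have hu2 := hasUnits_commAlg ρ E2 g2 P P' hP hP' h2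
  have : Module.Finite E (commAlg E ρ) := inferInstance
  obtain ⟨e, N, hN, hb⟩ := lift_form (W := Fin n → K) (R := commAlg E ρ) hC1 (scalarHom E ρ : K →+* commAlg E ρ)
    (fun x => (scalarHom E ρ).commutes x) E1 E2 hE g1 i1 hi1 g2 i2 hi2 hu1 hu2
    (fun x w => rfl)
  refine ⟨N, fun a w hw => ?_, hb⟩
  rw [hN] at hw ⊢
  have := (mem_commAlg.mp e.2) a w
  change (e : Module.End E (Fin n → K)) w = w at hw
  change (e : Module.End E (Fin n → K)) _ = _
  rw [this, hw]

theorem basis_of_form {E K V : Type} [Field E] [Field K] [Algebra E K] [AddCommGroup V]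
    [Module E V] [Module K V] [IsScalarTower E K V] {n : ℕ} (b0 : Module.Basis (Fin n) K V)
    (N : Submodule E V) (h : IsBaseChange K N.subtype) :
    ∃ b : Module.Basis (Fin n) K V, (∀ j, b j ∈ N) ∧
      ∀ v ∈ N, ∀ i, ∃ c : E, b.repr v i = algebraMap E K c := by
  let c := Module.Free.chooseBasis E N
  let b := h.basis c
  let e := b.indexEquiv b0
  refine ⟨b.reindex e, fun j => ?_, fun v hv i => ?_⟩
  · rw [Module.Basis.reindex_apply, IsBaseChange.basis_apply]
    exact (c (e.symm j)).2
  · refine ⟨c.repr ⟨v, hv⟩ (e.symm i), ?_⟩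
    rw [Module.Basis.repr_reindex_apply]
    exact h.basis_repr_comp_apply c ⟨v, hv⟩ _

theorem form_of_basis {E K V ι : Type} [Field E] [Field K] [Algebra E K] [AddCommGroup V]
    [Module E V] [Module K V] [IsScalarTower E K V] [Fintype ι] (b : Module.Basis ι K V) :
    ∃ N : Submodule E V, (∀ v, v ∈ N ↔ ∀ i, ∃ c : E, b.repr v i = algebraMap E K c) ∧
      IsBaseChange K N.subtype := by
  let f := Fintype.linearCombination E (b : ι → V)
  have hf : IsBaseChange K f := IsBaseChange.of_fintype_basis E b
  have hinj : Function.Injective f := by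
    intro x y hxy
    have h1 := (IsBaseChange.of_fintype_basis_eq (A := E) (b := b) (a := x) (v := f y)).mp hxy
    have h2 := (IsBaseChange.of_fintype_basis_eq (A := E) (b := b) (a := y) (v := f y)).mp rfl
    funext i
    exact (algebraMap E K).injective (congrFun (h1.trans h2.symm) i)
  let e := LinearEquiv.ofInjective f hinj
  refine ⟨LinearMap.range f, fun v => ?_, ?_⟩
  · constructor
    · rintro ⟨x, hx⟩ i
      have h1 := (IsBaseChange.of_fintype_basis_eq (A := E) (b := b) (a := x) (v := v)).mp hx
      exact ⟨x i, (congrFun h1 i).symm⟩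
    · intro h
      choose c hc using h
      exact ⟨c, (IsBaseChange.of_fintype_basis_eq (A := E) (b := b) (a := c) (v := v)).mpr
        (funext fun i => (hc i).symm)⟩
  · have := (IsBaseChange.ofEquiv e.symm).comp hf
    convert this using 1
    ext v
    have := LinearEquiv.ofInjective_apply f (h := hinj) (e.symm v)
    change (v : V) = f (e.symm v)
    rw [← this]
    exact congrArg Subtype.val (e.apply_symm_apply v).symm

theorem core_fin {F K A : Type} [Field F] (hC1 : IsC1Field F) [Field K] [Algebra F K]
    [FiniteDimensional F K] [Algebra.IsSeparable F K]
    (E1 E2 : IntermediateField F K) {n : ℕ}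
    (ρ : A → Matrix (Fin n) (Fin n) K) (h1 : ∀ a i j, ρ a i j ∈ E1)
    (P P' : Matrix (Fin n) (Fin n) K) (hP : P * P' = 1) (hP' : P' * P = 1)
    (h2 : ∀ a i j, (P' * ρ a * P) i j ∈ E2) :
    ∃ Q Q' : Matrix (Fin n) (Fin n) K, Q * Q' = 1 ∧ Q' * Q = 1 ∧
      ∀ a i j, (Q' * ρ a * Q) i j ∈ E1 ⊓ E2 := by
  let E : IntermediateField F K := E1 ⊓ E2
  have l1 : E ≤ E1 := inf_le_left
  have l2 : E ≤ E2 := inf_le_right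
  have : Algebra.IsSeparable E K := Algebra.isSeparable_tower_top_of_isSeparable F E K
  obtain ⟨N, hN, hb⟩ := core0 (F := F) (E := E) (K := K) hC1
    (IntermediateField.extendScalars l1) (IntermediateField.extendScalars l2) (by
      rw [eq_bot_iff]
      intro x hx
      rw [IntermediateField.mem_bot]
      exact ⟨⟨x, hx.1, hx.2⟩, rfl⟩) ρ h1 P P' hP hP' h2
  obtain ⟨b, hbN, hbr⟩ := basis_of_form (Pi.basisFun K (Fin n)) N hb
  refine ⟨(Pi.basisFun K (Fin n)).toMatrix b, b.toMatrix (Pi.basisFun K (Fin n)),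
    Module.Basis.toMatrix_mul_toMatrix_flip _ _, Module.Basis.toMatrix_mul_toMatrix_flip _ _, ?_⟩
  intro a i j
  have h3 : b.toMatrix (Pi.basisFun K (Fin n)) * ρ a * (Pi.basisFun K (Fin n)).toMatrix b
      = LinearMap.toMatrix b b (Matrix.toLin' (ρ a)) := by
    have h4 : LinearMap.toMatrix (Pi.basisFun K (Fin n)) (Pi.basisFun K (Fin n))
        (Matrix.toLin' (ρ a)) = ρ a := by
      rw [LinearMap.toMatrix_eq_toMatrix', LinearMap.toMatrix'_toLin']
    have h5 := basis_toMatrix_mul_linearMap_toMatrix_mul_basis_toMatrix b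
      (Pi.basisFun K (Fin n)) b (Pi.basisFun K (Fin n)) (Matrix.toLin' (ρ a))
    rw [h4] at h5
    exact h5
  rw [h3, LinearMap.toMatrix_apply]
  obtain ⟨c, hc⟩ := hbr _ (hN a _ (hbN j)) i
  rw [Matrix.toLin'_apply, hc]
  exact c.2

theorem core_gen {F K A : Type} [Field F] (hC1 : IsC1Field F) [Field K] [Algebra F K]
    [Algebra.IsSeparable F K]
    (E1 E2 : IntermediateField F K) [FiniteDimensional F E1] [FiniteDimensional F E2] {n : ℕ}
    (ρ : A → Matrix (Fin n) (Fin n) K) (h1 : ∀ a i j, ρ a i j ∈ E1)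
    (P P' : Matrix (Fin n) (Fin n) K) (hP : P * P' = 1) (hP' : P' * P = 1)
    (h2 : ∀ a i j, (P' * ρ a * P) i j ∈ E2) :
    ∃ Q Q' : Matrix (Fin n) (Fin n) K, Q * Q' = 1 ∧ Q' * Q = 1 ∧
      ∀ a i j, (Q' * ρ a * Q) i j ∈ E1 ⊓ E2 := by
  let S : Set K := (Set.range fun p : Fin n × Fin n => P p.1 p.2) ∪
    Set.range fun p : Fin n × Fin n => P' p.1 p.2
  have hSf : Finite S := Set.Finite.union (Set.finite_range _) (Set.finite_range _)
  have : FiniteDimensional F (IntermediateField.adjoin F S) :=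
    IntermediateField.finiteDimensional_adjoin fun x _ => Algebra.IsIntegral.isIntegral x
  let L : IntermediateField F K := E1 ⊔ IntermediateField.adjoin F S
  have hL1 : E1 ≤ L := le_sup_left
  have hLP : ∀ i j, P i j ∈ L := fun i j =>
    (le_sup_right : _ ≤ L) (IntermediateField.subset_adjoin F S (Or.inl ⟨(i, j), rfl⟩))
  have hLP' : ∀ i j, P' i j ∈ L := fun i j =>
    (le_sup_right : _ ≤ L) (IntermediateField.subset_adjoin F S (Or.inr ⟨(i, j), rfl⟩))
  let φ : L →+* K := algebraMap L K
  let ρ' : A → Matrix (Fin n) (Fin n) L := fun a => Matrix.of fun i j => ⟨ρ a i j, hL1 (h1 a i j)⟩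
  let R : Matrix (Fin n) (Fin n) L := Matrix.of fun i j => ⟨P i j, hLP i j⟩
  let R' : Matrix (Fin n) (Fin n) L := Matrix.of fun i j => ⟨P' i j, hLP' i j⟩
  have eρ : ∀ a, φ.mapMatrix (ρ' a) = ρ a := fun a => rfl
  have eR : φ.mapMatrix R = P := rfl
  have eR' : φ.mapMatrix R' = P' := rfl
  have hinj : Function.Injective (φ.mapMatrix (m := Fin n)) :=
    Matrix.map_injective φ.injective
  obtain ⟨Q, Q', hQ, hQ', h⟩ := core_fin hC1 (E1.comap L.val) (E2.comap L.val) ρ'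
    (fun a i j => h1 a i j) R R'
    (hinj (by rw [map_mul, eR, eR', hP, map_one])) (hinj (by rw [map_mul, eR, eR', hP', map_one]))
    (fun a i j => by
      have : φ ((R' * ρ' a * R) i j) = (P' * ρ a * P) i j := by
        have h3 : φ.mapMatrix (R' * ρ' a * R) = P' * ρ a * P := by
          rw [map_mul, map_mul, eρ, eR, eR']
        exact congrFun (congrFun h3 i) j
      change φ ((R' * ρ' a * R) i j) ∈ E2
      rw [this]
      exact h2 a i j)
  refine ⟨φ.mapMatrix Q, φ.mapMatrix Q', by rw [← map_mul, hQ, map_one],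
    by rw [← map_mul, hQ', map_one], fun a i j => ?_⟩
  rw [← eρ, ← map_mul, ← map_mul]
  exact h a i j

theorem descendsTo_iff {F K A M : Type} [Field F] [Field K] [Algebra F K]
    [Ring A] [Algebra F A] [AddCommGroup M] [Module F M] [Module K M] [Module A M]
    [IsScalarTower F K M] [IsScalarTower F A M] [SMulCommClass K A M]
    {n : ℕ} (b0 : Module.Basis (Fin n) K M) (E : IntermediateField F K) :
    DescendsTo F K A M E ↔
      ∃ b : Module.Basis (Fin n) K M, ∀ (a : A) i j, b.repr (a • b j) i ∈ E := by
  constructor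
  · rintro ⟨N, hN, hb⟩
    obtain ⟨b, h1, h2⟩ := basis_of_form b0 N hb
    refine ⟨b, fun a i j => ?_⟩
    obtain ⟨c, hc⟩ := h2 _ (hN a _ (h1 j)) i
    rw [hc]
    exact c.2
  · rintro ⟨b, hb⟩
    obtain ⟨N, hN, h⟩ := form_of_basis (E := E) b
    refine ⟨N, fun a x hx => ?_, h⟩
    rw [hN] at hx ⊢
    intro i
    choose c hc using hx
    have hmem : b.repr (a • x) i ∈ E := by
      rw [← b.sum_repr x, Finset.smul_sum, map_sum, Finsupp.finsetSum_apply]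
      refine sum_mem fun j _ => ?_
      rw [← smul_comm, map_smul, Finsupp.smul_apply, hc, smul_eq_mul]
      exact mul_mem (c j).2 (hb a i j)
    exact ⟨⟨_, hmem⟩, rfl⟩

theorem good_inf {F K A M : Type} [Field F] [Field K] [Algebra F K] [Algebra.IsSeparable F K]
    (hC1 : IsC1Field F)
    [Ring A] [Algebra F A] [AddCommGroup M] [Module F M] [Module K M] [Module A M]
    [IsScalarTower F K M] [IsScalarTower F A M] [SMulCommClass K A M]
    {n : ℕ} (E1 E2 : IntermediateField F K) [FiniteDimensional F E1] [FiniteDimensional F E2]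
    (b1 b2 : Module.Basis (Fin n) K M) (h1 : ∀ (a : A) i j, b1.repr (a • b1 j) i ∈ E1)
    (h2 : ∀ (a : A) i j, b2.repr (a • b2 j) i ∈ E2) :
    ∃ b : Module.Basis (Fin n) K M, ∀ (a : A) i j, b.repr (a • b j) i ∈ E1 ⊓ E2 := by
  have : SMulCommClass A K M := SMulCommClass.symm K A M
  let f : A → (M →ₗ[K] M) := fun a => DistribSMul.toLinearMap K M a
  obtain ⟨Q, Q', hQ, hQ', h⟩ := core_gen hC1 E1 E2 (fun a => LinearMap.toMatrix b1 b1 (f a))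
    (fun a i j => by rw [LinearMap.toMatrix_apply]; exact h1 a i j)
    (b1.toMatrix b2) (b2.toMatrix b1) (Module.Basis.toMatrix_mul_toMatrix_flip _ _)
    (Module.Basis.toMatrix_mul_toMatrix_flip _ _)
    (fun a i j => by
      rw [basis_toMatrix_mul_linearMap_toMatrix_mul_basis_toMatrix, LinearMap.toMatrix_apply]
      exact h2 a i j)
  refine ⟨b1.map (Matrix.toLinOfInv b1 b1 hQ hQ'), fun a i j => ?_⟩
  have := h a i j
  have e : Q' * LinearMap.toMatrix b1 b1 (f a) * Q
      = LinearMap.toMatrix b1 b1 (Matrix.toLin b1 b1 Q' ∘ₗ f a ∘ₗ Matrix.toLin b1 b1 Q) := by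
    rw [LinearMap.toMatrix_comp b1 b1 b1, LinearMap.toMatrix_comp b1 b1 b1,
      LinearMap.toMatrix_toLin, LinearMap.toMatrix_toLin, Matrix.mul_assoc]
  rw [e, LinearMap.toMatrix_apply] at this
  exact this

theorem good_finite {F K A M : Type} [Field F] [Field K] [Algebra F K] [Algebra.IsSeparable F K]
    [Ring A] [Algebra F A] [FiniteDimensional F A]
    [AddCommGroup M] [Module F M] [Module K M] [Module A M]
    [IsScalarTower F K M] [IsScalarTower F A M] [SMulCommClass K A M]
    {n : ℕ} (L : IntermediateField F K)
    (b : Module.Basis (Fin n) K M) (h : ∀ (a : A) i j, b.repr (a • b j) i ∈ L) :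
    ∃ L' : IntermediateField F K, L' ≤ L ∧ FiniteDimensional F L' ∧
      ∀ (a : A) i j, b.repr (a • b j) i ∈ L' := by
  let c := Module.finBasis F A
  let S : Set K := Set.range fun p : Fin _ × Fin n × Fin n => b.repr (c p.1 • b p.2.2) p.2.1
  have hSf : Finite S := Set.finite_range _
  refine ⟨IntermediateField.adjoin F S, ?_,
    IntermediateField.finiteDimensional_adjoin fun x _ => Algebra.IsIntegral.isIntegral x, ?_⟩
  · rw [IntermediateField.adjoin_le_iff]
    rintro _ ⟨p, rfl⟩
    exact h _ _ _
  · intro a i j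
    rw [← c.sum_repr a, Finset.sum_smul, map_sum, Finsupp.finsetSum_apply]
    refine sum_mem fun k _ => ?_
    rw [smul_assoc, ← algebraMap_smul K, map_smul, Finsupp.smul_apply, smul_eq_mul]
    exact mul_mem (IntermediateField.algebraMap_mem _ _)
      (IntermediateField.subset_adjoin F S ⟨(k, i, j), rfl⟩)

/-- **Theorem 1.1.** Let `F` be a `C₁`-field, `A` a finite-dimensional
`F`-algebra, `K/F` a separable algebraic field extension, and `M` a finitely
generated `A_K`-module.  Then `M` has a minimal field of definition `K₀` with
`F ⊆ K₀ ⊆ K` and `[K₀ : F] < ∞`. -/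
theorem exists_minimal_field_of_definition_of_separable_algebraic
    (F K A : Type) [Field F] [Field K] [Algebra F K] [Algebra.IsSeparable F K]
    [Ring A] [Algebra F A] [FiniteDimensional F A]
    (hC1 : IsC1Field F)
    (M : Type) [AddCommGroup M] [Module F M] [Module K M] [Module A M]
    [IsScalarTower F K M] [IsScalarTower F A M] [SMulCommClass K A M]
    [Module.Finite K M] :
    ∃ K₀ : IntermediateField F K, FiniteDimensional F K₀ ∧
      DescendsTo F K A M K₀ ∧
      ∀ L : IntermediateField F K, DescendsTo F K A M L → K₀ ≤ L := by
  let b0 := Module.finBasis K M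
  simp only [descendsTo_iff b0]
  obtain ⟨L0, -, hL0, hL0'⟩ := good_finite (F := F) (A := A) ⊤ b0 (fun _ _ _ => IntermediateField.mem_top)
  let S : Set (IntermediateField F K) := {L | FiniteDimensional F L ∧
    ∃ b : Module.Basis (Fin (Module.finrank K M)) K M, ∀ (a : A) i j, b.repr (a • b j) i ∈ L}
  have hS : S.Nonempty := ⟨L0, hL0, b0, hL0'⟩
  let K0 := Function.argminOn (fun L : IntermediateField F K => Module.finrank F L) S hS
  have hK0 : K0 ∈ S := Function.argminOn_mem _ _ _
  obtain ⟨hf0, b, hb⟩ := id hK0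
  refine ⟨K0, hf0, ⟨b, hb⟩, ?_⟩
  rintro L ⟨b', hb'⟩
  obtain ⟨L', hL'L, hL', hbL'⟩ := good_finite (A := A) L b' hb'
  have hmem : K0 ⊓ L' ∈ S :=
    ⟨Module.Finite.of_injective
      (IntermediateField.inclusion (inf_le_left : K0 ⊓ L' ≤ K0)).toLinearMap
      (IntermediateField.inclusion (inf_le_left : K0 ⊓ L' ≤ K0)).toRingHom.injective, good_inf hC1 K0 L' b b' hb hbL'⟩
  have hle : Module.finrank F K0 ≤ Module.finrank F (K0 ⊓ L' : IntermediateField F K) :=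
    Function.argminOn_le (fun L : IntermediateField F K => Module.finrank F L) S hmem
  have heq : K0 ⊓ L' = K0 := IntermediateField.eq_of_le_of_finrank_le inf_le_left hle
  exact (inf_eq_left.mp heq).trans hL'L
end
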